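/- Let 𝕂 be a number field and let β > 2 > α > 1. There exists a constant C = C(α, β, 𝕂) such that the following holds. Let N ≥ 2 and define W : ℐ → ℝ by W(𝔞) = 1 if 𝒩(𝔞) ≤ N and W(𝔞) = 0 otherwise. Let 𝔭 ∈ ℙ and let 𝔯 ∈ ℐ with 𝒩(𝔯) ≤ N/2; set y := N/𝒩(𝔯) and u := log y / log 𝒩(𝔭), and assume α ≤ u ≤ β. Then |Φ_𝔯(W, 𝔭) − ℬ(u) · y / log 𝒩(𝔭)| ≤ C · ℬ(u) · y / (log 𝒩(𝔭) · log y). -/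

import Mathlib

open NumberField

open scoped Classical

variable (K : Type*) [Field K] [NumberField K]

/-- The nonzero prime ideals of the ring of integers. -/
def PrimeIdeal := {p : Ideal (𝓞 K) // p ≠ ⊥ ∧ p.IsPrime}

/-- `𝔞` is coprime to `Π(𝔮) = ∏_{𝔭 ≺ 𝔮} 𝔭`, i.e. coprime to every prime ideal `𝔭 ≺ 𝔮`. -/
def CoprimeBelow (lt : PrimeIdeal K → PrimeIdeal K → Prop) (q : PrimeIdeal K)
    (a : Ideal (𝓞 K)) : Prop :=
  ∀ p : PrimeIdeal K, lt p q → a ⊔ p.1 = ⊤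

/-- `Φ_𝔯(w, 𝔮) = ∑_{𝔞 ∈ ℐ, (𝔞, Π(𝔮)) = 1} w(𝔞𝔯)`. -/
noncomputable def Phi (lt : PrimeIdeal K → PrimeIdeal K → Prop)
    (w : Ideal (𝓞 K) → ℝ) (r : Ideal (𝓞 K)) (q : PrimeIdeal K) : ℝ :=
  ∑' a : Ideal (𝓞 K), if a ≠ ⊥ ∧ CoprimeBelow K lt q a then w (a * r) else 0

/-- `B` satisfies the defining properties of the Buchstab function: it is continuous on
`[1, ∞)`, `B(u) = 1/u` for `1 ≤ u ≤ 2` and `(d/du)(u·B(u)) = B(u−1)` for `u > 2`. -/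
def IsBuchstab (B : ℝ → ℝ) : Prop :=
  ContinuousOn B (Set.Ici (1 : ℝ)) ∧
  (∀ u : ℝ, 1 ≤ u → u ≤ 2 → B u = 1 / u) ∧
  (∀ u : ℝ, 2 < u → HasDerivAt (fun v : ℝ => v * B v) (B (u - 1)) u)

section Perron
open MeasureTheory Complex

/-- the kernel `1/(s(s+1))` on a vertical line -/
noncomputable def perK (s : ℂ) : ℂ := 1 / s - 1 / (s + 1)

lemma perK_eq {s : ℂ} (h0 : s ≠ 0) (h1 : s + 1 ≠ 0) : perK s = 1 / (s * (s + 1)) := by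
  unfold perK; field_simp; ring

lemma perK_norm_le {c : ℝ} (hc : 1 ≤ c) (y : ℝ) :
    ‖perK (c + y * I)‖ ≤ 1 / (1 + y ^ 2) := by
  have h0 : ((c : ℂ) + y * I) ≠ 0 := fun h => by
    have := congrArg re h; simp at this; linarith
  have h1 : ((c : ℂ) + y * I) + 1 ≠ 0 := fun h => by
    have := congrArg re h; simp at this; linarith
  rw [perK_eq h0 h1, norm_div, norm_one, norm_mul]
  have e1 : (1 + y ^ 2) ≤ ‖(c : ℂ) + y * I‖ ^ 2 := by
    rw [← normSq_eq_norm_sq, normSq_add_mul_I]; nlinarith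
  have e2 : ‖(c : ℂ) + y * I‖ ≤ ‖(c : ℂ) + y * I + 1‖ := by
    rw [← sq_le_sq₀ (norm_nonneg _) (norm_nonneg _), ← normSq_eq_norm_sq, ← normSq_eq_norm_sq]
    have : ((c : ℂ) + y * I + 1) = ((c + 1 : ℝ) : ℂ) + y * I := by push_cast; ring
    rw [this, normSq_add_mul_I, normSq_add_mul_I]; nlinarith
  apply one_div_le_one_div_of_le (by positivity)
  nlinarith [norm_nonneg ((c : ℂ) + y * I)]

lemma perK_cont {c : ℝ} (hc : 1 ≤ c) : Continuous fun y : ℝ => perK (c + y * I) := by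
  unfold perK
  refine Continuous.sub (Continuous.div continuous_const (by fun_prop) fun y h => ?_)
    (Continuous.div continuous_const (by fun_prop) fun y h => ?_)
  · have := congrArg re h; simp at this; linarith
  · have := congrArg re h; simp at this; linarith

lemma perK_integrable {c : ℝ} (hc : 1 ≤ c) : Integrable fun y : ℝ => perK (c + y * I) := by
  refine Integrable.mono' (g := fun y : ℝ => (1 + y ^ 2)⁻¹) integrable_inv_one_add_sq
    (perK_cont hc).aestronglyMeasurable ?_
  filter_upwards with y
  simpa using perK_norm_le hc y

lemma hasMellin_hat {s : ℂ} (hs : 0 < s.re) :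
    HasMellin (fun v : ℝ => ((max (1 - v) 0 : ℝ) : ℂ)) s (perK s) := by
  have h1 := hasMellin_one_Ioc hs
  have h2 := hasMellin_cpow_Ioc 1 (s := s) (by simp; linarith)
  have h3 := h1.1.sub h2.1
  have key : Set.EqOn (fun t : ℝ => (t : ℂ) ^ (s - 1) • ((Set.Ioc (0:ℝ) 1).indicator (fun _ => (1 : ℂ)) t -
      (Set.Ioc (0:ℝ) 1).indicator (fun t : ℝ => (t : ℂ) ^ (1 : ℂ)) t))
      (fun v : ℝ => (v : ℂ) ^ (s - 1) • ((max (1 - v) 0 : ℝ) : ℂ)) (Set.Ioi 0) := by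
    intro v hv
    have hv : 0 < v := hv
    by_cases h : v ≤ 1
    · have : v ∈ Set.Ioc (0:ℝ) 1 := ⟨hv, h⟩
      simp [this, h]
    · have : v ∉ Set.Ioc (0:ℝ) 1 := fun h' => h h'.2
      have hm : max (1 - v) 0 = 0 := max_eq_right (by linarith)
      simp [this, hm]
  have h4 := hasMellin_sub h1.1 h2.1
  refine ⟨?_, ?_⟩
  · exact (integrableOn_congr_fun key measurableSet_Ioi).1 h4.1
  · rw [perK, ← h1.2, ← h2.2, ← h4.2]
    exact (setIntegral_congr_fun measurableSet_Ioi key).symm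

lemma perron_kernel {c v : ℝ} (hc : 1 ≤ c) (hv : 0 < v) :
    (1 / (2 * Real.pi)) • ∫ y : ℝ, (v : ℂ) ^ (-((c : ℂ) + y * I)) * perK (c + y * I)
      = ((max (1 - v) 0 : ℝ) : ℂ) := by
  have hre : ∀ y : ℝ, 0 < ((c : ℂ) + y * I).re := fun y => by simp; linarith
  have hm : ∀ y : ℝ, mellin (fun v : ℝ => ((max (1 - v) 0 : ℝ) : ℂ)) (c + y * I) = perK (c + y * I) :=
    fun y => (hasMellin_hat (hre y)).2
  have := mellinInv_mellin_eq c (fun v : ℝ => ((max (1 - v) 0 : ℝ) : ℂ)) hv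
    (by simpa using (hasMellin_hat (s := (c:ℂ)) (by simp; linarith)).1)
    (by
      unfold VerticalIntegrable
      simp_rw [hm]
      exact perK_integrable hc)
    (by fun_prop)
  rw [← this, mellinInv]
  simp_rw [hm, smul_eq_mul]

/-- General Perron formula over an index measure space. -/
lemma perron_general {X : Type*} [MeasurableSpace X] (μ : Measure X) [SFinite μ]
    (w u : X → ℝ) (hw : Measurable w) (hu : Measurable u) (hu0 : ∀ a, 0 < u a)
    {c x : ℝ} (hc : 1 ≤ c) (hx : 0 < x)
    (hintg : Integrable (fun a => w a * (u a) ^ (-c)) μ) :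
    ((∫ a, w a * max (1 - u a / x) 0 ∂μ : ℝ) : ℂ) =
      (1 / (2 * Real.pi)) • ∫ y : ℝ, (∫ a, (w a : ℂ) * (u a : ℂ) ^ (-((c : ℂ) + y * I)) ∂μ) *
        (x : ℂ) ^ ((c : ℂ) + y * I) * perK (c + y * I) := by
  have hpt : ∀ a (y : ℝ), ((u a / x : ℝ) : ℂ) ^ (-((c : ℂ) + y * I)) =
      (u a : ℂ) ^ (-((c : ℂ) + y * I)) * (x : ℂ) ^ ((c : ℂ) + y * I) := by
    intro a y
    rw [div_eq_mul_inv, ofReal_mul, Complex.mul_cpow_ofReal_nonneg (hu0 a).le (by positivity),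
      ofReal_inv, Complex.cpow_neg (x⁻¹ : ℂ), Complex.inv_cpow, inv_inv]
    rw [Complex.arg_ofReal_of_nonneg hx.le]; exact Real.pi_ne_zero.symm
  have hsw : Integrable (Function.uncurry fun (a : X) (y : ℝ) =>
      (w a : ℂ) * ((u a / x : ℝ) : ℂ) ^ (-((c : ℂ) + y * I)) * perK (c + y * I)) (μ.prod volume) := by
    have h1 := Integrable.mul_prod (hintg.mul_const (x ^ c)).norm (perK_integrable hc).norm
    refine h1.mono' ?_ ?_
    · apply Measurable.aestronglyMeasurable
      have := (perK_cont hc).measurable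
      refine Measurable.mul (Measurable.mul ?_ (Measurable.pow ?_ ?_)) (this.comp measurable_snd)
      · exact Complex.measurable_ofReal.comp (hw.comp measurable_fst)
      · exact Complex.measurable_ofReal.comp ((hu.comp measurable_fst).div_const x)
      · exact ((measurable_const.add ((Complex.measurable_ofReal.comp measurable_snd).mul_const I))).neg
    · filter_upwards with ⟨a, y⟩
      simp only [Function.uncurry, norm_mul]
      rw [hpt, norm_mul, Complex.norm_cpow_eq_rpow_re_of_pos (hu0 a),
        Complex.norm_cpow_eq_rpow_re_of_pos hx]
      have e1 : (-((c : ℂ) + y * I)).re = -c := by simp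
      have e2 : ((c : ℂ) + y * I).re = c := by simp
      rw [e1, e2, Complex.norm_real, Real.norm_of_nonneg (Real.rpow_nonneg (hu0 a).le _),
        Real.norm_of_nonneg (Real.rpow_nonneg hx.le _)]
      apply le_of_eq; ring
  have hswap := integral_integral_swap hsw
  rw [← integral_complex_ofReal]
  have h1 : ∀ a, ((w a * max (1 - u a / x) 0 : ℝ) : ℂ) = (1 / (2 * Real.pi)) •
      ∫ y : ℝ, (w a : ℂ) * ((u a / x : ℝ) : ℂ) ^ (-((c : ℂ) + y * I)) * perK (c + y * I) := by
    intro a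
    rw [ofReal_mul, ← perron_kernel hc (div_pos (hu0 a) hx), mul_smul_comm, ← integral_const_mul]
    simp_rw [mul_assoc]
  simp_rw [h1]
  rw [integral_smul, hswap]
  congr 1
  refine integral_congr_ae ?_
  filter_upwards with y
  simp_rw [hpt]
  rw [← integral_mul_const, ← integral_mul_const]
  congr 1; ext a; ring
end Perron

section ZetaPart
open MeasureTheory Complex Filter Topology

/-- abstract data: nonnegative Dirichlet coefficients with power saving counting function -/
structure ZData (a Λ : ℕ → ℝ) (κ δ C0 : ℝ) : Prop where
  a_nonneg : ∀ n, 0 ≤ a n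
  L_nonneg : ∀ n, 0 ≤ Λ n
  a_zero : a 0 = 0
  a_one : a 1 = 1
  L_zero : Λ 0 = 0
  L_one : Λ 1 = 0
  conv : ∀ n : ℕ, 1 ≤ n → ∑ p ∈ n.divisorsAntidiagonal, a p.1 * Λ p.2 = a n * Real.log n
  kpos : 0 < κ
  dpos : 0 < δ
  dlt : δ < 1
  count : ∀ x : ℝ, 1 ≤ x → |∑ k ∈ Finset.Icc 1 ⌊x⌋₊, a k - κ * x| ≤ C0 * x ^ (1 - δ)

/-- counting error -/
noncomputable def zE (a : ℕ → ℝ) (κ : ℝ) (t : ℝ) : ℝ := ∑ k ∈ Finset.Icc 1 ⌊t⌋₊, a k - κ * t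

/-- `(s-1) ζ(s)` -/
noncomputable def zH (a : ℕ → ℝ) (κ : ℝ) (s : ℂ) : ℂ :=
  κ * s + (s - 1) * s * ∫ t : ℝ in Set.Ioi 1, (zE a κ t : ℂ) * (t : ℂ) ^ (-(s + 1))

variable {a Λ : ℕ → ℝ} {κ δ C0 : ℝ}

lemma ZData.C0_nonneg (h : ZData a Λ κ δ C0) : 0 ≤ C0 := by
  have := h.count 1 le_rfl
  simp only [Real.one_rpow, mul_one] at this
  exact (abs_nonneg _).trans this

lemma ZData.sum_le (h : ZData a Λ κ δ C0) {x : ℝ} (hx : 1 ≤ x) :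
    ∑ k ∈ Finset.Icc 1 ⌊x⌋₊, a k ≤ (κ + C0) * x := by
  have h1 := (abs_le.1 (h.count x hx)).2
  have h2 : x ^ (1 - δ) ≤ x := by
    calc x ^ (1-δ) ≤ x ^ (1:ℝ) := Real.rpow_le_rpow_of_exponent_le hx (by linarith [h.dpos])
      _ = x := Real.rpow_one x
  nlinarith [h.C0_nonneg]

lemma ZData.bigO (h : ZData a Λ κ δ C0) :
    (fun n : ℕ => ∑ k ∈ Finset.Icc 1 n, a k) =O[atTop] fun n => (n : ℝ) ^ (1 : ℝ) := by
  refine Asymptotics.IsBigO.of_bound (κ + C0) ?_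
  filter_upwards [eventually_ge_atTop 1] with n hn
  have := h.sum_le (x := n) (by exact_mod_cast hn)
  rw [Nat.floor_natCast] at this
  rw [Real.rpow_one, Real.norm_of_nonneg (Finset.sum_nonneg fun k _ => h.a_nonneg k)]
  simpa using this

lemma ZData.summable (h : ZData a Λ κ δ C0) {s : ℂ} (hs : 1 < s.re) :
    LSeriesSummable (fun n => (a n : ℂ)) s :=
  LSeriesSummable_of_sum_norm_bigO_and_nonneg h.bigO h.a_nonneg zero_le_one hs

lemma zE_locInt (a : ℕ → ℝ) (κ : ℝ) :
    LocallyIntegrableOn (fun t => (zE a κ t : ℂ)) (Set.Ici 0) := by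
  have h1 : LocallyIntegrableOn (fun t : ℝ => (1:ℂ) * ∑ k ∈ Finset.Icc 1 ⌊t⌋₊, (a k : ℂ)) (Set.Ici 0) :=
    locallyIntegrableOn_mul_sum_Icc (fun k => (a k : ℂ)) le_rfl
      (continuous_const.locallyIntegrable.locallyIntegrableOn _)
  have h2 : LocallyIntegrableOn (fun t : ℝ => (κ * t : ℂ)) (Set.Ici 0) :=
    (by fun_prop : Continuous (fun t : ℝ => (κ * t : ℂ))).locallyIntegrable.locallyIntegrableOn _
  refine (h1.sub h2).congr (ae_of_all _ fun t => ?_)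
  simp [zE]

/-- truncated error -/
noncomputable def zE1 (a : ℕ → ℝ) (κ : ℝ) : ℝ → ℂ := (Set.Ioi 1).indicator fun t => (zE a κ t : ℂ)

lemma zE1_locInt (a : ℕ → ℝ) (κ : ℝ) : LocallyIntegrableOn (zE1 a κ) (Set.Ioi 0) := by
  have h := (zE_locInt a κ).mono_set Set.Ioi_subset_Ici_self
  intro x hx
  obtain ⟨U, hU, hU2⟩ := h x hx
  exact ⟨U, hU, hU2.indicator measurableSet_Ioi⟩

lemma ZData.zE1_top (h : ZData a Λ κ δ C0) :
    zE1 a κ =O[atTop] fun x : ℝ => x ^ (-(δ - 1)) := by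
  refine Asymptotics.IsBigO.of_bound C0 ?_
  filter_upwards [eventually_gt_atTop (1:ℝ)] with t ht
  rw [zE1, Set.indicator_of_mem (by exact ht), Complex.norm_real, Real.norm_eq_abs,
    Real.norm_of_nonneg (by positivity)]
  rw [show -(δ - 1) = 1 - δ by ring]
  exact h.count t ht.le

lemma zE1_zero (a : ℕ → ℝ) (κ b : ℝ) :
    zE1 a κ =O[𝓝[>] 0] fun x : ℝ => x ^ (-b) := by
  have : zE1 a κ =ᶠ[𝓝[>] 0] fun _ => 0 := by
    filter_upwards [nhdsWithin_le_nhds (Iio_mem_nhds (show (0:ℝ) < 1 by norm_num))] with t ht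
    rw [zE1, Set.indicator_of_notMem]
    simp at ht ⊢; exact ht.le
  exact this.trans_isBigO (Asymptotics.isBigO_zero _ _)

lemma zM_eq (a : ℕ → ℝ) (κ : ℝ) (s : ℂ) :
    ∫ t : ℝ in Set.Ioi 1, (zE a κ t : ℂ) * (t : ℂ) ^ (-(s + 1)) = mellin (zE1 a κ) (-s) := by
  rw [mellin]
  have : ∀ t : ℝ, (t:ℂ) ^ (-s - 1) • zE1 a κ t =
      (Set.Ioi 1).indicator (fun t : ℝ => (zE a κ t : ℂ) * (t : ℂ) ^ (-(s + 1))) t := by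
    intro t
    by_cases ht : t ∈ Set.Ioi (1:ℝ)
    · simp only [zE1, Set.indicator_of_mem ht, smul_eq_mul]; ring_nf
    · simp only [zE1, Set.indicator_of_notMem ht, smul_zero]
  simp_rw [this]
  rw [setIntegral_indicator measurableSet_Ioi]
  congr 2
  ext t; simp

lemma ZData.int1 (h : ZData a Λ κ δ C0) {s : ℂ} (hs : 1 - δ < s.re) :
    IntegrableOn (fun t : ℝ => (zE a κ t : ℂ) * (t : ℂ) ^ (-(s + 1))) (Set.Ioi 1) := by
  have h1 : MellinConvergent (zE1 a κ) (-s) :=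
    mellinConvergent_of_isBigO_rpow (a := δ - 1) (b := -s.re - 1) (zE1_locInt a κ) h.zE1_top
      (by simp; linarith) (zE1_zero a κ _) (by simp)
  have h2 := h1.mono_set (show Set.Ioi (1:ℝ) ⊆ Set.Ioi 0 from Set.Ioi_subset_Ioi zero_le_one)
  refine h2.congr_fun (fun t ht => ?_) measurableSet_Ioi
  simp only [zE1, Set.indicator_of_mem ht, smul_eq_mul]; ring_nf

lemma ZData.H_diff (h : ZData a Λ κ δ C0) {s : ℂ} (hs : 1 - δ < s.re) :
    DifferentiableAt ℂ (zH a κ) s := by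
  have h1 : DifferentiableAt ℂ (mellin (zE1 a κ)) (-s) :=
    mellin_differentiableAt_of_isBigO_rpow (a := δ - 1) (b := -s.re - 1) (zE1_locInt a κ) h.zE1_top
      (by simp; linarith) (zE1_zero a κ _) (by simp)
  have h2 : DifferentiableAt ℂ (fun s => mellin (zE1 a κ) (-s)) s :=
    h1.comp s differentiableAt_id.neg
  unfold zH
  simp_rw [zM_eq]
  fun_prop

lemma zH_one (a : ℕ → ℝ) (κ : ℝ) : zH a κ 1 = κ := by simp [zH]

lemma ZData.H_eq (h : ZData a Λ κ δ C0) {s : ℂ} (hs : 1 < s.re) :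
    zH a κ s = (s - 1) * LSeries (fun n => (a n : ℂ)) s := by
  rw [LSeries_eq_mul_integral_of_nonneg a zero_le_one hs h.bigO h.a_nonneg]
  have i1 := h.int1 (s := s) (by linarith [h.dpos])
  have i2 : IntegrableOn (fun t : ℝ => (t : ℂ) ^ (-s)) (Set.Ioi 1) :=
    integrableOn_Ioi_cpow_of_lt (by simpa using hs) one_pos
  have e : ∫ t : ℝ in Set.Ioi 1, (∑ k ∈ Finset.Icc 1 ⌊t⌋₊, (a k : ℂ)) * (t:ℂ) ^ (-(s + 1)) =
      ∫ t : ℝ in Set.Ioi 1, ((zE a κ t : ℂ) * (t : ℂ) ^ (-(s + 1)) + κ * (t : ℂ) ^ (-s)) := by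
    refine setIntegral_congr_fun measurableSet_Ioi fun t ht => ?_
    have ht0 : (t : ℂ) ≠ 0 := by
      have : (0:ℝ) < t := lt_trans one_pos ht
      exact_mod_cast this.ne'
    have : (t : ℂ) ^ (-s) = t * (t:ℂ) ^ (-(s+1)) := by
      rw [show -s = 1 + -(s+1) by ring, Complex.cpow_add _ _ ht0, Complex.cpow_one]
    simp only [this, zE]; push_cast; ring
  rw [e, integral_add i1 (i2.const_mul _), integral_const_mul,
    integral_Ioi_cpow_of_lt (by simpa using hs) one_pos]
  have hs1 : s - 1 ≠ 0 := fun h => by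
    have := congrArg re h; simp at this; linarith
  have hs2 : -s + 1 ≠ 0 := fun h => hs1 (by linear_combination -h)
  simp only [zH, Complex.ofReal_one, Complex.one_cpow]
  field_simp
  ring

lemma ZData.H_trunc (h : ZData a Λ κ δ C0) {s : ℂ} (hs : 1 - δ < s.re) {X : ℝ} (hX : 1 ≤ X) :
    zH a κ s = (s - 1) * (∑ n ∈ Finset.Icc 1 ⌊X⌋₊, (a n : ℂ) * (n : ℂ) ^ (-s)
        - (∑ n ∈ Finset.Icc 1 ⌊X⌋₊, (a n : ℂ)) * (X : ℂ) ^ (-s)) + κ * s * (X : ℂ) ^ (1 - s)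
      + (s - 1) * s * ∫ t : ℝ in Set.Ioi X, (zE a κ t : ℂ) * (t : ℂ) ^ (-(s + 1)) := by
  have hs0 : s ≠ 0 := fun h0 => by
    rw [h0] at hs; simp at hs; linarith [h.dlt]
  have i1 := h.int1 hs
  have split : ∫ t : ℝ in Set.Ioi 1, (zE a κ t : ℂ) * (t : ℂ) ^ (-(s + 1)) =
      (∫ t : ℝ in Set.Ioc 1 X, (zE a κ t : ℂ) * (t : ℂ) ^ (-(s + 1))) +
      ∫ t : ℝ in Set.Ioi X, (zE a κ t : ℂ) * (t : ℂ) ^ (-(s + 1)) := by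
    rw [← setIntegral_union (Set.Ioc_disjoint_Ioi le_rfl) measurableSet_Ioi
      (i1.mono_set Set.Ioc_subset_Ioi_self) (i1.mono_set (Set.Ioi_subset_Ioi hX)),
      Set.Ioc_union_Ioi_eq_Ioi hX]
  have hder : ∀ t : ℝ, t ∈ Set.Icc 1 X → HasDerivAt (fun t : ℝ => (t:ℂ) ^ (-s)) (-s * (t:ℂ) ^ (-s - 1)) t := by
    intro t ht
    exact hasDerivAt_ofReal_cpow_const (by linarith [ht.1]) (by simpa using hs0)
  have cont : ∀ r : ℂ, ContinuousOn (fun t : ℝ => (t:ℂ) ^ r) (Set.Icc 1 X) := fun r t ht =>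
    ((Complex.continuousAt_ofReal_cpow_const t r (Or.inr (by linarith [ht.1]))).continuousWithinAt)
  have abel := sum_mul_eq_sub_integral_mul₀ (fun n => (a n : ℂ)) (f := fun t : ℝ => (t:ℂ) ^ (-s))
    (by simp [h.a_zero]) X (fun t ht => (hder t ht).differentiableAt) (by
      refine IntegrableOn.congr_fun (f := fun t : ℝ => -s * (t:ℂ) ^ (-s - 1)) ?_ (fun t ht => (hder t ht).deriv.symm) measurableSet_Icc
      exact ((cont _).const_mul _ |>.integrableOn_Icc))
  have h01 : ∀ (g : ℕ → ℂ) (n : ℕ), ∑ k ∈ Finset.Icc 0 n, g k = g 0 + ∑ k ∈ Finset.Icc 1 n, g k := by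
    intro g n
    rw [← Finset.add_sum_Ioc_eq_sum_Icc (Nat.zero_le n)]; rfl
  simp only [h01, h.a_zero, Complex.ofReal_zero, mul_zero, zero_add] at abel
  have e1 : ∫ t : ℝ in Set.Ioc 1 X, deriv (fun t : ℝ => (t:ℂ) ^ (-s)) t * ∑ k ∈ Finset.Icc 1 ⌊t⌋₊, (a k : ℂ)
      = -s * ((∫ t : ℝ in Set.Ioc 1 X, (zE a κ t : ℂ) * (t : ℂ) ^ (-(s + 1))) +
         κ * ∫ t : ℝ in Set.Ioc 1 X, (t : ℂ) ^ (-s)) := by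
    rw [← integral_const_mul, ← integral_add (i1.mono_set Set.Ioc_subset_Ioi_self)
      (((cont _).integrableOn_Icc.mono_set Set.Ioc_subset_Icc_self).const_mul _), ← integral_const_mul]
    refine setIntegral_congr_fun measurableSet_Ioc fun t ht => ?_
    have ht0 : (t : ℂ) ≠ 0 := by
      have : (0:ℝ) < t := lt_trans one_pos ht.1
      exact_mod_cast this.ne'
    have e2 : (t : ℂ) ^ (-s) = t * (t:ℂ) ^ (-(s+1)) := by
      rw [show -s = 1 + -(s+1) by ring, Complex.cpow_add _ _ ht0, Complex.cpow_one]
    simp only [(hder t ⟨ht.1.le, ht.2⟩).deriv, zE]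
    rw [e2, show -s - 1 = -(s+1) by ring]
    push_cast; ring
  rw [e1] at abel
  have e3 : (s - 1) * ∫ t : ℝ in Set.Ioc 1 X, (t : ℂ) ^ (-s) = 1 - (X:ℂ) ^ (1 - s) := by
    by_cases hs1 : s = 1
    · subst hs1; simp
    rw [← intervalIntegral.integral_of_le hX, integral_cpow (Or.inr ⟨fun h => hs1 (neg_inj.1 h), by
      rw [Set.uIcc_of_le hX]; simp⟩)]
    have : s - 1 ≠ 0 := sub_ne_zero.2 hs1
    have h2 : -s + 1 ≠ 0 := fun h => this (by linear_combination -h)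
    rw [show (1:ℂ) - s = -s + 1 by ring]
    simp only [Complex.ofReal_one, Complex.one_cpow]
    field_simp
    ring
  have e4 : ∑ n ∈ Finset.Icc 1 ⌊X⌋₊, (a n : ℂ) * (n : ℂ) ^ (-s) =
     ∑ n ∈ Finset.Icc 1 ⌊X⌋₊, (n : ℂ) ^ (-s) * (a n : ℂ) := Finset.sum_congr rfl fun n _ => mul_comm _ _
  rw [e4, zH, split]
  simp only [Complex.ofReal_natCast] at abel
  rw [abel]
  linear_combination (-κ * s) * e3

end ZetaPart

section ZetaPart2
open MeasureTheory Complex Filter Topology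
variable {a Λ : ℕ → ℝ} {κ δ C0 : ℝ}

lemma ZData.summable_real (h : ZData a Λ κ δ C0) {σ : ℝ} (hs : 1 < σ) :
    Summable fun n : ℕ => a n * (n:ℝ) ^ (-σ) := by
  have := (h.summable (s := σ) (by simpa using hs)).norm
  refine this.congr fun n => ?_
  rcases Nat.eq_zero_or_pos n with rfl | hn
  · simp [h.a_zero]
  rw [LSeries.norm_term_eq, if_neg hn.ne', Real.rpow_neg (by positivity)]
  simp only [Complex.norm_real, Real.norm_of_nonneg (h.a_nonneg n), Complex.ofReal_re]
  rfl

lemma norm_cpow_real {x : ℝ} (hx : 0 < x) (s : ℂ) : ‖(x:ℂ) ^ s‖ = x ^ s.re :=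
  Complex.norm_cpow_eq_rpow_re_of_pos hx s

/-- polynomial upper bound for `H` to the left of the line `Re s = 1` -/
lemma ZData.H_bound (h : ZData a Λ κ δ C0) {η : ℝ} (hη : 0 < η) (hηδ : η ≤ δ / 2) :
    ∃ C : ℝ, 0 < C ∧ ∀ s : ℂ, 1 - η ≤ s.re → s.re ≤ 3 →
      ‖zH a κ s‖ ≤ C * (1 + |s.im|) ^ (1 + 4 * η / δ) := by
  have hd := h.dpos
  have hC0 := h.C0_nonneg
  have hk := h.kpos
  set Z := ∑' n : ℕ, a n * (n:ℝ) ^ (-(1 + η)) with hZ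
  have hZs := h.summable_real (σ := 1 + η) (by linarith)
  have hZ0 : 0 ≤ Z := tsum_nonneg fun n => mul_nonneg (h.a_nonneg n) (by positivity)
  refine ⟨3 * (Z + (κ + C0)) + 3 * κ + 9 * C0 * (2 / δ), by positivity, fun s hs1 hs3 => ?_⟩
  set T := 1 + |s.im| with hT
  have hT1 : 1 ≤ T := by simp [hT]
  have hT0 : 0 < T := by linarith
  set X := T ^ (2 / δ) with hX
  have hX1 : 1 ≤ X := Real.one_le_rpow hT1 (by positivity)
  have hX0 : 0 < X := by linarith
  have hre : 1 - δ < s.re := by linarith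
  have hs_norm : ‖s‖ ≤ 3 * T := by
    have := Complex.norm_le_abs_re_add_abs_im s
    have : |s.re| ≤ 3 := abs_le.2 ⟨by linarith [h.dlt], hs3⟩
    have := abs_nonneg s.im
    linarith
  have hs1_norm : ‖s - 1‖ ≤ 3 * T := by
    have := Complex.norm_le_abs_re_add_abs_im (s - 1)
    simp only [sub_re, one_re, sub_im, one_im, sub_zero] at this
    have : |s.re - 1| ≤ 3 := abs_le.2 ⟨by linarith [h.dlt], by linarith⟩
    have := abs_nonneg s.im
    linarith
  rw [h.H_trunc hre hX1]
  set Q := T ^ (4 * η / δ) with hQ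
  have hQ1 : 1 ≤ Q := Real.one_le_rpow hT1 (by positivity)
  have hXQ : X ^ (2 * η) = Q := by
    rw [hX, hQ, ← Real.rpow_mul hT0.le]; ring_nf
  have hXle : ∀ e : ℝ, e ≤ 2 * η → X ^ e ≤ Q := fun e he => by
    rw [← hXQ]; exact Real.rpow_le_rpow_of_exponent_le hX1 he
  -- first sum
  have b1 : ‖∑ n ∈ Finset.Icc 1 ⌊X⌋₊, (a n : ℂ) * (n : ℂ) ^ (-s)‖ ≤ Z * Q := by
    calc _ ≤ ∑ n ∈ Finset.Icc 1 ⌊X⌋₊, ‖(a n : ℂ) * (n : ℂ) ^ (-s)‖ := norm_sum_le _ _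
      _ ≤ ∑ n ∈ Finset.Icc 1 ⌊X⌋₊, (a n * (n:ℝ) ^ (-(1 + η))) * Q := by
        refine Finset.sum_le_sum fun n hn => ?_
        have hn1 : (1:ℝ) ≤ n := by exact_mod_cast (Finset.mem_Icc.1 hn).1
        have hnX : (n:ℝ) ≤ X := (Nat.le_floor_iff hX0.le).1 (Finset.mem_Icc.1 hn).2
        have := norm_cpow_real (x := n) (by linarith) (-s)
        rw [norm_mul, Complex.norm_real, Real.norm_of_nonneg (h.a_nonneg n), mul_assoc]
        refine mul_le_mul_of_nonneg_left ?_ (h.a_nonneg n)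
        simp only [Complex.ofReal_natCast] at this
        rw [this]
        calc (n:ℝ) ^ (-s).re ≤ (n:ℝ) ^ (-(1+η) + 2 * η) :=
              Real.rpow_le_rpow_of_exponent_le hn1 (by simp; linarith)
          _ = (n:ℝ) ^ (-(1+η)) * (n:ℝ) ^ (2 * η) := Real.rpow_add (by linarith) _ _
          _ ≤ _ := by
            refine mul_le_mul_of_nonneg_left ?_ (by positivity)
            rw [← hXQ]
            exact Real.rpow_le_rpow (by linarith) hnX (by linarith)
      _ = (∑ n ∈ Finset.Icc 1 ⌊X⌋₊, (a n * (n:ℝ) ^ (-(1 + η)))) * Q := (Finset.sum_mul _ _ _).symm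
      _ ≤ Z * Q := by
        refine mul_le_mul_of_nonneg_right ?_ (by linarith)
        exact hZs.sum_le_tsum _ fun n _ => mul_nonneg (h.a_nonneg n) (by positivity)
  have b2 : ‖(∑ n ∈ Finset.Icc 1 ⌊X⌋₊, (a n : ℂ)) * (X : ℂ) ^ (-s)‖ ≤ (κ + C0) * Q := by
    rw [norm_mul, norm_cpow_real hX0, ← Complex.ofReal_sum, Complex.norm_real,
      Real.norm_of_nonneg (Finset.sum_nonneg fun k _ => h.a_nonneg k)]
    calc _ ≤ ((κ + C0) * X) * X ^ (-s).re := mul_le_mul_of_nonneg_right (h.sum_le hX1) (by positivity)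
      _ = (κ + C0) * X ^ (1 + (-s).re) := by rw [Real.rpow_add hX0, Real.rpow_one]; ring
      _ ≤ _ := by
        refine mul_le_mul_of_nonneg_left (hXle _ ?_) (by linarith)
        simp; linarith
  have b3 : ‖(X : ℂ) ^ (1 - s)‖ ≤ Q := by
    rw [norm_cpow_real hX0]; refine hXle _ ?_
    simp; linarith
  have b4 : ‖∫ t : ℝ in Set.Ioi X, (zE a κ t : ℂ) * (t : ℂ) ^ (-(s + 1))‖ ≤ C0 * (2 / δ) * T⁻¹ := by
    have hexp : (1 - δ) + (-(s+1)).re ≤ -1 - δ / 2 := by simp; linarith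
    have hlt : -1 - δ / 2 < -1 := by linarith
    calc _ ≤ ∫ t : ℝ in Set.Ioi X, C0 * t ^ (-1 - δ / 2) := by
          refine norm_integral_le_of_norm_le ((integrableOn_Ioi_rpow_of_lt hlt hX0).const_mul _) ?_
          refine (ae_restrict_iff' measurableSet_Ioi).2 (ae_of_all _ fun t ht => ?_)
          have ht1 : 1 ≤ t := hX1.trans (le_of_lt ht)
          have ht0 : 0 < t := by linarith
          rw [norm_mul, norm_cpow_real ht0, Complex.norm_real, Real.norm_eq_abs]
          calc _ ≤ (C0 * t ^ (1 - δ)) * t ^ (-(s+1)).re :=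
                mul_le_mul_of_nonneg_right (h.count t ht1) (by positivity)
            _ = C0 * t ^ ((1 - δ) + (-(s+1)).re) := by rw [Real.rpow_add ht0]; ring
            _ ≤ _ := mul_le_mul_of_nonneg_left (Real.rpow_le_rpow_of_exponent_le ht1 hexp) hC0
      _ = _ := by
        rw [integral_const_mul, integral_Ioi_rpow_of_lt hlt hX0]
        have : X ^ (-1 - δ / 2 + 1) = T⁻¹ := by
          rw [hX, ← Real.rpow_mul hT0.le, ← Real.rpow_neg_one]; congr 1; field_simp; ring
        rw [this, show -1 - δ / 2 + 1 = -(δ / 2) by ring]; field_simp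
  have hTQ : T ^ (1 + 4 * η / δ) = T * Q := by rw [Real.rpow_add hT0, Real.rpow_one]
  rw [hTQ]
  have c1 : ‖(s - 1) * (∑ n ∈ Finset.Icc 1 ⌊X⌋₊, (a n : ℂ) * (n : ℂ) ^ (-s)
        - (∑ n ∈ Finset.Icc 1 ⌊X⌋₊, (a n : ℂ)) * (X : ℂ) ^ (-s))‖ ≤ (3 * T) * (Z * Q + (κ + C0) * Q) := by
    rw [norm_mul]
    exact mul_le_mul hs1_norm ((norm_sub_le _ _).trans (add_le_add b1 b2)) (norm_nonneg _) (by linarith)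
  have c2 : ‖(κ:ℂ) * s * (X : ℂ) ^ (1 - s)‖ ≤ κ * (3 * T) * Q := by
    rw [norm_mul, norm_mul, Complex.norm_real, Real.norm_of_nonneg hk.le]
    gcongr
  have c3 : ‖(s - 1) * s * ∫ t : ℝ in Set.Ioi X, (zE a κ t : ℂ) * (t : ℂ) ^ (-(s + 1))‖
      ≤ (3 * T) * (3 * T) * (C0 * (2 / δ) * T⁻¹) := by
    rw [norm_mul, norm_mul]; gcongr
  have c3' : (3 * T) * (3 * T) * (C0 * (2 / δ) * T⁻¹) = 9 * C0 * (2/δ) * T := by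
    field_simp; ring
  have c3'' : 9 * C0 * (2/δ) * T ≤ 9 * C0 * (2/δ) * (T * Q) := by
    refine mul_le_mul_of_nonneg_left ?_ (by positivity)
    nlinarith
  calc _ ≤ _ := norm_add₃_le
    _ ≤ (3 * T) * (Z * Q + (κ + C0) * Q) + κ * (3 * T) * Q + 9 * C0 * (2/δ) * (T * Q) := by
      linarith
    _ = _ := by ring

end ZetaPart2

section ZetaPart3
open MeasureTheory Complex Filter Topology
variable {a Λ : ℕ → ℝ} {κ δ C0 : ℝ}

lemma ZData.L_le (h : ZData a Λ κ δ C0) (n : ℕ) : Λ n ≤ a n * Real.log n := by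
  rcases Nat.eq_zero_or_pos n with rfl | hn
  · simp [h.L_zero]
  rw [← h.conv n hn]
  have := Finset.single_le_sum (f := fun p : ℕ × ℕ => a p.1 * Λ p.2) (s := n.divisorsAntidiagonal)
    (fun p _ => mul_nonneg (h.a_nonneg _) (h.L_nonneg _)) (a := (1, n))
    (by simp [hn.ne'])
  simpa [h.a_one] using this

lemma ZData.abs_a (h : ZData a Λ κ δ C0) {s : ℂ} (hs : 1 < s.re) :
    LSeries.abscissaOfAbsConv (fun n => (a n : ℂ)) < s.re := by
  refine lt_of_le_of_lt (b := ((1:ℝ):EReal)) ?_ (by exact_mod_cast hs)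
  refine LSeries.abscissaOfAbsConv_le_of_forall_lt_LSeriesSummable fun y hy => ?_
  exact h.summable (by simpa using hy)

lemma ZData.summable_L (h : ZData a Λ κ δ C0) {s : ℂ} (hs : 1 < s.re) :
    LSeriesSummable (fun n => (Λ n : ℂ)) s := by
  have h1 : LSeriesSummable (LSeries.logMul fun n => (a n : ℂ)) s := by
    apply LSeriesSummable_of_abscissaOfAbsConv_lt_re
    rw [LSeries.abscissaOfAbsConv_logMul]; exact h.abs_a hs
  refine Summable.of_norm_bounded h1.norm fun n => ?_
  apply LSeries.norm_term_le
  rw [Complex.norm_real, Real.norm_of_nonneg (h.L_nonneg n), LSeries.logMul, norm_mul, Complex.norm_real,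
    Real.norm_of_nonneg (h.a_nonneg n), Complex.natCast_log.symm, Complex.norm_real, Real.norm_of_nonneg (Real.log_natCast_nonneg n),
    mul_comm]
  exact h.L_le n

lemma ZData.abs_L (h : ZData a Λ κ δ C0) {s : ℂ} (hs : 1 < s.re) :
    LSeries.abscissaOfAbsConv (fun n => (Λ n : ℂ)) < s.re := by
  refine lt_of_le_of_lt (b := ((1:ℝ):EReal)) ?_ (by exact_mod_cast hs)
  refine LSeries.abscissaOfAbsConv_le_of_forall_lt_LSeriesSummable fun y hy => ?_
  exact h.summable_L (by simpa using hy)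

/-- coefficients of the logarithm -/
noncomputable def zl (Λ : ℕ → ℝ) (n : ℕ) : ℝ := Λ n / Real.log n

lemma ZData.zl_nonneg (h : ZData a Λ κ δ C0) (n : ℕ) : 0 ≤ zl Λ n :=
  div_nonneg (h.L_nonneg n) (Real.log_natCast_nonneg n)

lemma ZData.zl_le (h : ZData a Λ κ δ C0) (n : ℕ) : zl Λ n ≤ a n := by
  rw [zl]
  rcases (Real.log_natCast_nonneg n).eq_or_lt with h0 | h0
  · rw [← h0, div_zero]; exact h.a_nonneg n
  · rw [div_le_iff₀ h0]; exact h.L_le n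

lemma ZData.summable_l (h : ZData a Λ κ δ C0) {s : ℂ} (hs : 1 < s.re) :
    LSeriesSummable (fun n => (zl Λ n : ℂ)) s := by
  refine Summable.of_norm_bounded (h.summable hs).norm fun n => ?_
  apply LSeries.norm_term_le
  rw [Complex.norm_real, Real.norm_of_nonneg (h.zl_nonneg n), Complex.norm_real, Real.norm_of_nonneg (h.a_nonneg n)]
  exact h.zl_le n

lemma ZData.abs_l (h : ZData a Λ κ δ C0) {s : ℂ} (hs : 1 < s.re) :
    LSeries.abscissaOfAbsConv (fun n => (zl Λ n : ℂ)) < s.re := by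
  refine lt_of_le_of_lt (b := ((1:ℝ):EReal)) ?_ (by exact_mod_cast hs)
  refine LSeries.abscissaOfAbsConv_le_of_forall_lt_LSeriesSummable fun y hy => ?_
  exact h.summable_l (by simpa using hy)

lemma ZData.logMul_l (h : ZData a Λ κ δ C0) :
    LSeries.logMul (fun n => (zl Λ n : ℂ)) = fun n => (Λ n : ℂ) := by
  funext n
  rw [LSeries.logMul, zl, ← Complex.natCast_log, ← Complex.ofReal_mul]
  congr 1
  rcases Nat.lt_or_ge n 2 with hn | hn
  · interval_cases n <;> simp [h.L_zero, h.L_one]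
  · have : 0 < Real.log n := Real.log_pos (by exact_mod_cast hn)
    field_simp

lemma ZData.deriv_zeta (h : ZData a Λ κ δ C0) {s : ℂ} (hs : 1 < s.re) :
    HasDerivAt (LSeries fun n => (a n : ℂ))
      (-(LSeries (fun n => (a n : ℂ)) s * LSeries (fun n => (Λ n : ℂ)) s)) s := by
  have h1 := LSeries_hasDerivAt (h.abs_a hs)
  rw [← LSeries_convolution' (h.summable hs) (h.summable_L hs)]
  convert h1 using 2
  refine LSeries_congr (fun {n} hn => ?_) s
  have := h.conv n (Nat.pos_of_ne_zero hn)
  rw [LSeries.convolution_def, LSeries.logMul, ← Complex.natCast_log, ← Complex.ofReal_mul, mul_comm, ← this]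
  push_cast; rfl

lemma ZData.zeta_exp (h : ZData a Λ κ δ C0) {s : ℂ} (hs : 1 < s.re) :
    LSeries (fun n => (a n : ℂ)) s = exp (LSeries (fun n => (zl Λ n : ℂ)) s) := by
  set U : Set ℂ := {s | 1 < s.re} with hU
  have hUo : IsOpen U := isOpen_lt continuous_const Complex.continuous_re
  have hUc : Convex ℝ U := convex_halfSpace_re_gt 1
  set G : ℂ → ℂ := fun s => LSeries (fun n => (a n : ℂ)) s * exp (-LSeries (fun n => (zl Λ n : ℂ)) s) with hG
  have hder : ∀ z ∈ U, HasDerivAt G 0 z := by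
    intro z hz
    have h1 := h.deriv_zeta hz
    have h2 := LSeries_hasDerivAt (h.abs_l hz)
    rw [h.logMul_l] at h2
    have h3 := h1.mul (h2.neg.cexp)
    convert h3 using 1
    any_goals rfl
    ring
  have hconst : ∀ z ∈ U, G z = G s := by
    intro z hz
    exact hUo.is_const_of_deriv_eq_zero hUc.isPreconnected
      (fun w hw => (hder w hw).differentiableAt.differentiableWithinAt)
      (fun w hw => (hder w hw).deriv) hz hs
  have l1 : Tendsto (fun x : ℝ => LSeries (fun n => (a n : ℂ)) x) atTop (𝓝 1) := by
    have := LSeries.tendsto_atTop (lt_top_of_lt (h.abs_a (s := 2) (by norm_num)))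
    simpa [h.a_one] using this
  have l2 : Tendsto (fun x : ℝ => LSeries (fun n => (zl Λ n : ℂ)) x) atTop (𝓝 0) := by
    have := LSeries.tendsto_atTop (lt_top_of_lt (h.abs_l (s := 2) (by norm_num)))
    simpa [zl] using this
  have l3 : Tendsto (fun x : ℝ => G x) atTop (𝓝 1) := by
    have := l1.mul (l2.neg.cexp)
    simpa using this
  have l4 : Tendsto (fun x : ℝ => G x) atTop (𝓝 (G s)) := by
    refine tendsto_const_nhds.congr' ?_
    filter_upwards [eventually_gt_atTop (1:ℝ)] with x hx
    exact (hconst x (by simpa [hU] using hx)).symm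
  have : G s = 1 := tendsto_nhds_unique l4 l3
  rw [hG] at this
  simp only [Complex.exp_neg] at this
  field_simp at this
  exact this

lemma ZData.re_log (h : ZData a Λ κ δ C0) {s : ℂ} (hs : 1 < s.re) :
    HasSum (fun n : ℕ => zl Λ n * (n:ℝ) ^ (-s.re) * Real.cos (s.im * Real.log n))
      (LSeries (fun n => (zl Λ n : ℂ)) s).re := by
  have h1 := Complex.hasSum_re (h.summable_l hs).hasSum
  refine h1.congr_fun ?_ |> fun x => x
  intro n
  rcases Nat.eq_zero_or_pos n with rfl | hn
  · simp [zl]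
  have hn0 : (n:ℂ) ≠ 0 := by exact_mod_cast hn.ne'
  rw [LSeries.term_of_ne_zero hn.ne', div_eq_mul_inv, ← Complex.cpow_neg, Complex.re_ofReal_mul, mul_assoc]
  congr 1
  have e : (n:ℂ) ^ (-s) = ((n:ℝ) ^ (-s.re) : ℝ) * exp ((-(s.im * Real.log n) : ℝ) * I) := by
    rw [Complex.ofReal_cpow (by positivity), Complex.ofReal_natCast]
    rw [Complex.cpow_def_of_ne_zero hn0, Complex.cpow_def_of_ne_zero hn0, ← Complex.exp_add]
    congr 1
    rw [← Complex.natCast_log]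
    apply Complex.ext <;> simp <;> ring
  rw [e, Complex.re_ofReal_mul, Complex.exp_ofReal_mul_I_re, Real.cos_neg]

lemma ZData.norm_zeta (h : ZData a Λ κ δ C0) {s : ℂ} (hs : 1 < s.re) :
    ‖LSeries (fun n => (a n : ℂ)) s‖ = Real.exp (LSeries (fun n => (zl Λ n : ℂ)) s).re := by
  rw [h.zeta_exp hs, Complex.norm_exp]

lemma ZData.three_four_one (h : ZData a Λ κ δ C0) {σ : ℝ} (t : ℝ) (hs : 1 < σ) :
    1 ≤ ‖LSeries (fun n => (a n : ℂ)) σ‖ ^ 3 * ‖LSeries (fun n => (a n : ℂ)) (σ + t * I)‖ ^ 4 *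
      ‖LSeries (fun n => (a n : ℂ)) (σ + (2 * t : ℝ) * I)‖ := by
  have r0 := h.re_log (s := σ) (by simpa using hs)
  have r1 := h.re_log (s := σ + t * I) (by simpa using hs)
  have r2 := h.re_log (s := σ + (2 * t : ℝ) * I) (by simpa using hs)
  rw [h.norm_zeta (s := σ) (by simpa using hs), h.norm_zeta (s := σ + t * I) (by simpa using hs),
    h.norm_zeta (s := σ + (2 * t : ℝ) * I) (by simpa using hs), ← Real.exp_nat_mul, ← Real.exp_nat_mul,
    ← Real.exp_add, ← Real.exp_add]
  refine Real.one_le_exp ?_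
  have := ((r0.mul_left 3).add (r1.mul_left 4)).add r2
  push_cast at this ⊢
  refine this.nonneg fun n => ?_
  simp only [Complex.ofReal_re, Complex.ofReal_im, Complex.add_re, Complex.mul_re, Complex.add_im, Complex.mul_im,
    Complex.I_re, Complex.I_im, Complex.re_ofNat, Complex.im_ofNat, mul_zero, zero_mul, sub_zero, add_zero, mul_one, zero_add, sub_self, Real.cos_zero]
  have hw : 0 ≤ zl Λ n * (n:ℝ) ^ (-σ) := mul_nonneg (h.zl_nonneg n) (by positivity)
  set c := Real.cos (t * Real.log n) with hc
  have : Real.cos (2 * t * Real.log n) = 2 * c ^ 2 - 1 := by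
    rw [mul_assoc, Real.cos_two_mul]
  rw [this]
  have : 0 ≤ (zl Λ n * (n:ℝ) ^ (-σ)) * (2 * (1 + c) ^ 2) := by positivity
  linarith

lemma ZData.zeta_le (h : ZData a Λ κ δ C0) {s : ℂ} {σ : ℝ} (hσ : 1 < σ) (hs : σ ≤ s.re) :
    ‖LSeries (fun n => (a n : ℂ)) s‖ ≤ ‖LSeries (fun n => (a n : ℂ)) σ‖ ∧
    1 ≤ ‖LSeries (fun n => (a n : ℂ)) s‖ * ‖LSeries (fun n => (a n : ℂ)) σ‖ := by
  have hs1 : 1 < s.re := by linarith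
  have r0 := h.re_log (s := σ) (by simpa using hσ)
  have r1 := h.re_log hs1
  rw [h.norm_zeta (s := σ) (by simpa using hσ), h.norm_zeta hs1, ← Real.exp_add]
  have key : ∀ n : ℕ, |zl Λ n * (n:ℝ) ^ (-s.re) * Real.cos (s.im * Real.log n)| ≤
      zl Λ n * (n:ℝ) ^ (-(σ:ℂ).re) * Real.cos ((σ:ℂ).im * Real.log n) := by
    intro n
    rcases Nat.eq_zero_or_pos n with rfl | hn
    · simp [zl]
    have hn1 : (1:ℝ) ≤ n := by exact_mod_cast hn
    rw [abs_mul, abs_mul, abs_of_nonneg (h.zl_nonneg n), abs_of_nonneg (by positivity : 0 ≤ (n:ℝ) ^ (-s.re))]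
    simp only [Complex.ofReal_re, Complex.ofReal_im, zero_mul, Real.cos_zero]
    refine mul_le_mul (mul_le_mul_of_nonneg_left ?_ (h.zl_nonneg n)) (Real.abs_cos_le_one _) (abs_nonneg _)
      (mul_nonneg (h.zl_nonneg n) (by positivity))
    exact Real.rpow_le_rpow_of_exponent_le hn1 (by linarith)
  constructor
  · exact Real.exp_le_exp.2 (hasSum_le (fun n => (le_abs_self _).trans (key n)) r1 r0)
  · refine Real.one_le_exp ?_
    refine (r1.add r0).nonneg fun n => ?_
    have := neg_abs_le (zl Λ n * (n:ℝ) ^ (-s.re) * Real.cos (s.im * Real.log n))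
    have := key n
    linarith

end ZetaPart3

section ZetaPart4
open MeasureTheory Complex Filter Topology
variable {a Λ : ℕ → ℝ} {κ δ C0 : ℝ}

/-- small power weight -/
noncomputable def zP (ε t : ℝ) : ℝ := (1 + |t|) ^ ε

lemma zP_one_le {ε : ℝ} (hε : 0 ≤ ε) (t : ℝ) : 1 ≤ zP ε t :=
  Real.one_le_rpow (by linarith [abs_nonneg t]) hε

lemma zP_two {ε : ℝ} (hε : 0 ≤ ε) (hε1 : ε ≤ 1) {t t' : ℝ} (h : 1 + |t'| ≤ 2 * (1 + |t|)) :
    zP ε t' ≤ 2 * zP ε t := by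
  have h0 := abs_nonneg t
  have h0' := abs_nonneg t'
  calc zP ε t' ≤ (2 * (1 + |t|)) ^ ε := Real.rpow_le_rpow (by linarith) h hε
    _ = 2 ^ ε * zP ε t := Real.mul_rpow (by norm_num) (by linarith)
    _ ≤ 2 * zP ε t := by
      refine mul_le_mul_of_nonneg_right ?_ (by linarith [zP_one_le hε t])
      calc (2:ℝ) ^ ε ≤ 2 ^ (1:ℝ) := Real.rpow_le_rpow_of_exponent_le (by norm_num) hε1
        _ = 2 := Real.rpow_one 2

lemma ZData.Hb (h : ZData a Λ κ δ C0) {ε : ℝ} (hε : 0 < ε) (hε1 : ε ≤ 1) :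
    ∃ C : ℝ, 1 ≤ C ∧ ∀ s : ℂ, 1 - ε * δ / 4 ≤ s.re → s.re ≤ 3 →
      ‖zH a κ s‖ ≤ C * (1 + |s.im|) * zP ε s.im := by
  have hd := h.dpos
  obtain ⟨C, hC, hb⟩ := h.H_bound (η := ε * δ / 4) (by positivity) (by nlinarith)
  refine ⟨max C 1, le_max_right _ _, fun s h1 h2 => (hb s h1 h2).trans ?_⟩
  have h0 := abs_nonneg s.im
  rw [show 1 + 4 * (ε * δ / 4) / δ = 1 + ε by field_simp, Real.rpow_add (by linarith), Real.rpow_one, mul_assoc]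
  refine mul_le_mul_of_nonneg_right (le_max_left _ _) ?_
  positivity

lemma ZData.dH (h : ZData a Λ κ δ C0) {ε : ℝ} (hε : 0 < ε) (hε1 : ε ≤ 1) :
    ∃ D : ℝ, 1 ≤ D ∧ ∀ s : ℂ, 1 - ε * δ / 8 ≤ s.re → s.re ≤ 5 / 2 →
      ‖deriv (zH a κ) s‖ ≤ D * (1 + |s.im|) * zP ε s.im := by
  have hd := h.dpos
  have hd1 := h.dlt
  obtain ⟨C, hC, hb⟩ := h.Hb hε hε1
  have hed : ε * δ ≤ δ := by nlinarith
  have hed0 : 0 < ε * δ := by positivity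
  refine ⟨max (4 * C / (ε * δ / 8)) 1, le_max_right _ _, fun s h1 h2 => ?_⟩
  have h0 := abs_nonneg s.im
  have hP := zP_one_le hε.le s.im
  have key : ‖deriv (zH a κ) s‖ ≤ (4 * C * (1 + |s.im|) * zP ε s.im) / (ε * δ / 8) := by
    refine Complex.norm_deriv_le_of_forall_mem_sphere_norm_le (by positivity) ?_ fun z hz => ?_
    · refine DifferentiableOn.diffContOnCl_ball (U := Metric.closedBall s (ε * δ / 8)) (fun z hz => ?_) le_rfl
      have : |(z - s).re| ≤ ε * δ / 8 := (Complex.abs_re_le_norm _).trans (by simpa [dist_eq_norm] using hz)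
      have := (abs_le.1 this).1
      simp at this
      exact (h.H_diff (by linarith)).differentiableWithinAt
    · have hz' : ‖z - s‖ = ε * δ / 8 := by simpa [dist_eq_norm] using hz
      have r1 : |(z - s).re| ≤ ε * δ / 8 := (Complex.abs_re_le_norm _).trans hz'.le
      have r2 : |(z - s).im| ≤ ε * δ / 8 := (Complex.abs_im_le_norm _).trans hz'.le
      have r3 := abs_le.1 r1
      simp at r3
      have r4 : |z.im| ≤ |s.im| + 1 := by
        have : |z.im| ≤ |s.im| + |(z-s).im| := by
          have := abs_add_le s.im (z-s).im
          simpa using this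
        linarith
      have r5 : 1 + |z.im| ≤ 2 * (1 + |s.im|) := by linarith
      refine (hb z (by linarith) (by linarith)).trans ?_
      have := zP_two hε.le hε1 r5
      calc C * (1 + |z.im|) * zP ε z.im ≤ C * (2 * (1 + |s.im|)) * (2 * zP ε s.im) := by
            have := zP_one_le hε.le z.im
            gcongr
        _ = _ := by ring
  refine key.trans ?_
  calc _ = (4 * C / (ε * δ / 8)) * ((1 + |s.im|) * zP ε s.im) := by ring
    _ ≤ max (4 * C / (ε * δ / 8)) 1 * ((1 + |s.im|) * zP ε s.im) := by
      refine mul_le_mul_of_nonneg_right (le_max_left _ _) (by positivity)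
    _ = _ := by ring

set_option maxHeartbeats 1000000 in
lemma ZData.lower (h : ZData a Λ κ δ C0) {ε : ℝ} (hε : 0 < ε) (hε1 : ε ≤ 1) :
    ∃ c c1 : ℝ, 0 < c ∧ 0 < c1 ∧ c1 ≤ ε * δ / 8 ∧ ∀ s : ℂ, 1 - c1 / zP ε s.im ^ 5 ≤ s.re → s.re ≤ 5 / 2 →
      c * (1 + |s.im|) / zP ε s.im ^ 4 ≤ ‖zH a κ s‖ := by
  have hd := h.dpos
  have hd1 := h.dlt
  have hk := h.kpos
  have hed : ε * δ ≤ δ := by nlinarith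
  have hed0 : 0 < ε * δ := by positivity
  obtain ⟨C, hC, hb⟩ := h.Hb hε hε1
  obtain ⟨D, hD, hdb⟩ := h.dH hε hε1
  -- neighbourhood of 1
  obtain ⟨ρ, hρ, hρ1, hnear⟩ : ∃ ρ : ℝ, 0 < ρ ∧ ρ ≤ 1 ∧ ∀ s : ℂ, ‖s - 1‖ ≤ 2 * ρ → κ / 2 ≤ ‖zH a κ s‖ := by
    have hc : ContinuousAt (zH a κ) 1 := (h.H_diff (s := 1) (by simp; exact hd)).continuousAt
    obtain ⟨r, hr, hr2⟩ := Metric.continuousAt_iff.1 hc (κ / 2) (by positivity)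
    refine ⟨min 1 (r / 4), by positivity, min_le_left _ _, fun s hs => ?_⟩
    have : dist s 1 < r := by
      rw [dist_eq_norm]
      have := min_le_right 1 (r / 4)
      linarith
    have h2 := hr2 this
    rw [zH_one, dist_eq_norm] at h2
    have h3 := norm_sub_norm_le (κ : ℂ) (zH a κ s)
    rw [norm_sub_rev] at h3
    rw [Complex.norm_real, Real.norm_of_nonneg hk.le] at h3
    linarith
  set ζ := LSeries fun n => (a n : ℂ) with hζ
  set B := 4 * C / ρ with hB
  have hB1 : 1 ≤ B := by rw [hB, le_div_iff₀ hρ]; linarith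
  set m := 1 / (C * B) with hm
  have hm0 : 0 < m := by positivity
  set c3 := min (min (ρ * m / (8 * D)) ρ) (min 1 (ε * δ / 8)) with hc3
  have hc30 : 0 < c3 := by positivity
  have hc3a : c3 ≤ ρ * m / (8 * D) := (min_le_left _ _).trans (min_le_left _ _)
  have hc3b : c3 ≤ ρ := (min_le_left _ _).trans (min_le_right _ _)
  have hc3c : c3 ≤ 1 := (min_le_right _ _).trans (min_le_left _ _)
  have hc3d : c3 ≤ ε * δ / 8 := (min_le_right _ _).trans (min_le_right _ _)
  have hc34 : c3 ^ 4 ≤ c3 := by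
    calc c3 ^ 4 ≤ c3 ^ 1 := pow_le_pow_of_le_one hc30.le hc3c (by norm_num)
      _ = c3 := pow_one c3
  set Z := ‖ζ ((1 + ρ : ℝ) : ℂ)‖ with hZ
  have hZ0 : 0 < Z := by
    rw [hZ, hζ, h.norm_zeta (by simp [hρ])]; exact Real.exp_pos _
  set c := min (min (ρ / 4 * m * c3 ^ 3) (κ / 4)) (ρ / (2 * Z)) with hcdef
  have hc0 : 0 < c := by positivity
  have hca : c ≤ ρ / 4 * m * c3 ^ 3 := (min_le_left _ _).trans (min_le_left _ _)
  have hcb : c ≤ κ / 4 := (min_le_left _ _).trans (min_le_right _ _)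
  have hcc : c ≤ ρ / (2 * Z) := min_le_right _ _
  refine ⟨c, c3 ^ 4, hc0, by positivity, hc34.trans hc3d, fun s hs hs5 => ?_⟩
  set P := zP ε s.im with hP
  have hP1 : 1 ≤ P := zP_one_le hε.le _
  have hP0 : 0 < P := by linarith
  set T := 1 + |s.im| with hT
  have him0 := abs_nonneg s.im
  have hT1 : 1 ≤ T := by linarith
  set τ := c3 ^ 4 / P ^ 5 with hτ
  have hτ0 : 0 < τ := by positivity
  have hτle : τ ≤ c3 := (div_le_self (by positivity) (one_le_pow₀ hP1)).trans hc34
  have hle4 : c * T / P ^ 4 ≤ c * T := div_le_self (by positivity) (one_le_pow₀ hP1)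
  rcases lt_or_ge |s.im| ρ with hsmall | hbig
  · have hT2 : T ≤ 2 := by linarith
    rcases le_or_gt s.re (1 + ρ) with h1 | h1
    · have : κ / 2 ≤ ‖zH a κ s‖ := by
        refine hnear s ?_
        have := Complex.norm_le_abs_re_add_abs_im (s - 1)
        simp only [sub_re, one_re, sub_im, one_im, sub_zero] at this
        have : |s.re - 1| ≤ ρ := abs_le.2 ⟨by linarith, by linarith⟩
        linarith
      nlinarith
    · have hz := (h.zeta_le (s := s) (σ := 1 + ρ) (by linarith) h1.le).2
      rw [h.H_eq (by linarith), norm_mul]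
      have h2 : ρ ≤ ‖s - 1‖ := by
        have := (le_abs_self _).trans (Complex.abs_re_le_norm (s - 1))
        simp at this; linarith
      have h3 : 1 / Z ≤ ‖ζ s‖ := by
        rw [div_le_iff₀ hZ0]; exact hz
      calc c * T / P ^ 4 ≤ c * T := hle4
        _ ≤ ρ / (2 * Z) * 2 := mul_le_mul hcc hT2 (by linarith) (by positivity)
        _ = ρ * (1 / Z) := by field_simp
        _ ≤ _ := mul_le_mul h2 h3 (by positivity) (norm_nonneg _)
  · have htT : ρ / 2 * T ≤ |s.im| := by
      have : ρ * T ≤ |s.im| + |s.im| := by rw [hT]; nlinarith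
      linarith
    -- the bound to the right of 1 + τ
    have right : ∀ z : ℂ, z.im = s.im → 1 + τ ≤ z.re → z.re ≤ 5/2 →
        ρ / 2 * T * (m * c3 ^ 3 / P ^ 4) ≤ ‖zH a κ z‖ := by
      intro z hz h1 h2
      rw [h.H_eq (by linarith), norm_mul]
      have h3 : ρ / 2 * T ≤ ‖z - 1‖ := by
        have := (Complex.abs_im_le_norm (z - 1))
        simp [hz] at this; linarith
      refine mul_le_mul h3 ?_ (by positivity) (norm_nonneg _)
      have e1 : ‖ζ (z.re : ℂ)‖ ≤ C / τ := by
        have f1 := (h.zeta_le (s := (z.re : ℂ)) (σ := 1 + τ) (by linarith) (by simpa using h1)).1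
        refine f1.trans ?_
        have f2 := h.H_eq (s := ((1 + τ : ℝ) : ℂ)) (by simpa using hτ0)
        have f3 := hb ((1 + τ : ℝ) : ℂ) (by simp; linarith) (by simp; linarith)
        rw [f2, norm_mul] at f3
        have f4 : ‖((1 + τ : ℝ) : ℂ) - 1‖ = τ := by
          rw [← Complex.ofReal_one, ← Complex.ofReal_sub, Complex.norm_real, Real.norm_of_nonneg] <;> simp [hτ0.le]
        rw [f4] at f3
        simp [zP] at f3
        rw [le_div_iff₀ hτ0, mul_comm]; simpa using f3
      have e2 : ‖ζ (z.re + (2 * z.im : ℝ) * I)‖ ≤ B * P := by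
        have f2 := h.H_eq (s := z.re + (2 * z.im : ℝ) * I) (by simp; linarith)
        have f3 := hb (z.re + (2 * z.im : ℝ) * I) (by simp; linarith) (by simp; linarith)
        rw [f2, norm_mul] at f3
        have f4 : ρ * T ≤ ‖(z.re + (2 * z.im : ℝ) * I : ℂ) - 1‖ := by
          have := (Complex.abs_im_le_norm ((z.re + (2 * z.im : ℝ) * I : ℂ) - 1))
          simp [hz, abs_mul] at this
          simp [hz]; linarith
        have f5 : (z.re + (2 * z.im : ℝ) * I : ℂ).im = 2 * s.im := by simp [hz]
        rw [f5] at f3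
        have f6 : 1 + |2 * s.im| ≤ 2 * T := by rw [abs_mul, abs_two]; linarith
        have f7 := zP_two hε.le hε1 f6
        have f8 : ρ * T * ‖ζ (z.re + (2 * z.im : ℝ) * I)‖ ≤ C * (2 * T) * (2 * P) := by
          calc _ ≤ _ := mul_le_mul_of_nonneg_right f4 (norm_nonneg _)
            _ ≤ _ := f3
            _ ≤ _ := by
              have := zP_one_le hε.le (2 * s.im)
              gcongr
        rw [hB]
        have : ρ * ‖ζ (z.re + (2 * z.im : ℝ) * I)‖ ≤ 4 * C * P := by
          have hT0 : 0 < T := by linarith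
          refine le_of_mul_le_mul_left ?_ hT0
          linarith
        rw [div_mul_eq_mul_div, le_div_iff₀ hρ]; linarith
      have e3 := h.three_four_one (σ := z.re) z.im (by linarith)
      rw [Complex.re_add_im] at e3
      by_contra hcon
      push Not at hcon
      have e4 : ‖ζ z‖ ^ 4 < (m * c3 ^ 3 / P ^ 4) ^ 4 := pow_lt_pow_left₀ hcon (norm_nonneg _) (by norm_num)
      have e5 : ‖ζ (z.re : ℂ)‖ ^ 3 * ‖ζ z‖ ^ 4 * ‖ζ (z.re + (2 * z.im : ℝ) * I)‖ <  1 := by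
        calc _ ≤ (C / τ) ^ 3 * ‖ζ z‖ ^ 4 * (B * P) := by gcongr
          _ < (C / τ) ^ 3 * (m * c3 ^ 3 / P ^ 4) ^ 4 * (B * P) := by gcongr
          _ = 1 / (C * B ^ 3) := by
            rw [hτ, hm]; field_simp
          _ ≤ 1 := by
            rw [div_le_one (by positivity)]
            nlinarith [one_le_pow₀ hB1 (n := 3)]
      linarith
    rcases le_or_gt (1 + τ) s.re with h1 | h1
    · refine le_trans ?_ (right s rfl h1 hs5)
      calc c * T / P ^ 4 ≤ (ρ / 4 * m * c3 ^ 3) * T / P ^ 4 := by gcongr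
        _ ≤ (ρ / 2 * m * c3 ^ 3) * T / P ^ 4 := by gcongr; norm_num
        _ = _ := by ring
    · set z : ℂ := ((1 + τ : ℝ) : ℂ) + s.im * I with hz
      have hzre : z.re = 1 + τ := by simp [hz]
      have hzim : z.im = s.im := by simp [hz]
      have r1 := right z hzim hzre.ge (by linarith)
      have mv : ‖zH a κ s - zH a κ z‖ ≤ D * T * P * ‖s - z‖ := by
        refine Convex.norm_image_sub_le_of_norm_deriv_le (s := (Set.Icc (1 - ε * δ / 8) (5/2)) ×ℂ {s.im})
          (fun w hw => h.H_diff ?_) (fun w hw => ?_) (((convex_Icc _ _).linear_preimage Complex.reLm).inter ((convex_singleton _).linear_preimage Complex.imLm)) ?_ ?_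
        · have := hw.1.1; linarith
        · have := hdb w hw.1.1 hw.1.2
          have h2 : w.im = s.im := hw.2
          rw [h2] at this; exact this
        · exact ⟨⟨by simp only [hzre]; linarith, by simp only [hzre]; linarith⟩, hzim⟩
        · exact ⟨⟨by linarith, hs5⟩, rfl⟩
      have hsz : ‖s - z‖ ≤ 2 * τ := by
        have := Complex.norm_le_abs_re_add_abs_im (s - z)
        simp only [sub_re, sub_im, hzre, hzim, sub_self, abs_zero, add_zero] at this
        refine this.trans (abs_le.2 ⟨by linarith, by linarith⟩)
      have r2 : D * T * P * ‖s - z‖ ≤ ρ / 4 * m * c3 ^ 3 * T / P ^ 4 := by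
        calc _ ≤ D * T * P * (2 * τ) := by gcongr
          _ = 2 * D * T * c3 ^ 3 * c3 / P ^ 4 := by rw [hτ]; field_simp
          _ ≤ 2 * D * T * c3 ^ 3 * (ρ * m / (8 * D)) / P ^ 4 := by gcongr
          _ = _ := by field_simp; ring
      have r3 : ‖zH a κ z‖ ≤ ‖zH a κ s‖ + ‖zH a κ s - zH a κ z‖ := by
        have := norm_sub_norm_le (zH a κ z) (zH a κ s)
        rw [norm_sub_rev] at this; linarith
      have r4 : c * T / P ^ 4 ≤ (ρ / 4 * m * c3 ^ 3) * T / P ^ 4 := by gcongr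
      have r5 : ρ / 2 * T * (m * c3 ^ 3 / P ^ 4) = 2 * ((ρ / 4 * m * c3 ^ 3) * T / P ^ 4) := by ring
      linarith

/-- the logarithmic derivative -/
noncomputable def zL (a : ℕ → ℝ) (κ : ℝ) (s : ℂ) : ℂ := deriv (zH a κ) s / zH a κ s

lemma ZData.L_bound (h : ZData a Λ κ δ C0) {ε : ℝ} (hε : 0 < ε) (hε1 : ε ≤ 1) :
    ∃ C : ℝ, 0 < C ∧ ∀ s : ℂ, 1 < s.re → s.re ≤ 2 →
      ‖iteratedDeriv 2 (zL a κ) s‖ ≤ C * zP ε s.im ^ 15 := by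
  have hd := h.dpos
  have hd1 := h.dlt
  have hed : ε * δ ≤ δ := by nlinarith
  have hed0 : 0 < ε * δ := by positivity
  obtain ⟨D, hD, hdb⟩ := h.dH hε hε1
  obtain ⟨c, c1, hc, hc1, hc1e, hlow⟩ := h.lower hε hε1
  refine ⟨2 * (32 * D / c) / (c1 / 64) ^ 2, by positivity, fun s hs1 hs2 => ?_⟩
  set P := zP ε s.im with hP
  have hP1 : 1 ≤ P := zP_one_le hε.le _
  have hP0 : 0 < P := by linarith
  set R := c1 / (64 * P ^ 5) with hR
  have hR0 : 0 < R := by positivity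
  have hRle : R ≤ 1 / 8 := by
    rw [hR, div_le_iff₀ (by positivity)]
    have := one_le_pow₀ hP1 (n := 5)
    nlinarith
  have ball : ∀ z ∈ Metric.closedBall s R, 1 - ε * δ / 8 ≤ z.re ∧ z.re ≤ 5/2 ∧ zP ε z.im ≤ 2 * P ∧
      1 - c1 / zP ε z.im ^ 5 ≤ z.re := by
    intro z hz
    have hz' : ‖z - s‖ ≤ R := by simpa [dist_eq_norm] using hz
    have r1 : |(z - s).re| ≤ R := (Complex.abs_re_le_norm _).trans hz'
    have r2 : |(z - s).im| ≤ R := (Complex.abs_im_le_norm _).trans hz'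
    have r3 := abs_le.1 r1
    simp at r3
    have r4 : |z.im| ≤ |s.im| + 1 := by
      have : |z.im| ≤ |s.im| + |(z-s).im| := by
        have := abs_add_le s.im (z-s).im
        simpa using this
      linarith
    have r5 : 1 + |z.im| ≤ 2 * (1 + |s.im|) := by linarith [abs_nonneg s.im]
    have r6 := zP_two hε.le hε1 r5
    have r7 := zP_one_le hε.le z.im
    have r8 : R ≤ c1 / zP ε z.im ^ 5 := by
      rw [hR]
      refine div_le_div_of_nonneg_left hc1.le (by positivity) ?_
      calc zP ε z.im ^ 5 ≤ (2 * P) ^ 5 := by gcongr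
        _ = 32 * P ^ 5 := by ring
        _ ≤ _ := by have : 0 < P ^ 5 := by positivity
                    linarith
    have r9 : c1 / zP ε z.im ^ 5 ≤ c1 := div_le_self hc1.le (one_le_pow₀ r7)
    refine ⟨by linarith, by linarith, r6, by linarith⟩
  have hopen : IsOpen {z : ℂ | 1 - δ < z.re} := isOpen_lt continuous_const Complex.continuous_re
  have hdH : DifferentiableOn ℂ (zH a κ) {z : ℂ | 1 - δ < z.re} := fun z hz =>
    (h.H_diff hz).differentiableWithinAt
  have hdd := hdH.deriv hopen
  have hL : ∀ z ∈ Metric.closedBall s R, DifferentiableAt ℂ (zL a κ) z ∧ ‖zL a κ z‖ ≤ 32 * D / c * P ^ 5 := by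
    intro z hz
    obtain ⟨b1, b2, b3, b4⟩ := ball z hz
    have hl := hlow z b4 b2
    have r7 := zP_one_le hε.le z.im
    have hT0 : 0 < 1 + |z.im| := by linarith [abs_nonneg z.im]
    have hpos : 0 < c * (1 + |z.im|) / zP ε z.im ^ 4 := by positivity
    have hne : zH a κ z ≠ 0 := fun h0 => by rw [h0, norm_zero] at hl; linarith
    have hzm : z ∈ {z : ℂ | 1 - δ < z.re} := by show 1 - δ < z.re; linarith
    refine ⟨((hdd z hzm).differentiableAt (hopen.mem_nhds hzm)).div (h.H_diff hzm) hne, ?_⟩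
    rw [zL, norm_div]
    calc _ ≤ (D * (1 + |z.im|) * zP ε z.im) / (c * (1 + |z.im|) / zP ε z.im ^ 4) :=
          div_le_div₀ (by positivity) (hdb z b1 b2) hpos hl
      _ = D / c * zP ε z.im ^ 5 := by field_simp
      _ ≤ D / c * (2 * P) ^ 5 := by gcongr
      _ = _ := by ring
  have := Complex.norm_iteratedDeriv_le_of_forall_mem_sphere_norm_le (n := 2) (f := zL a κ) hR0
    (DifferentiableOn.diffContOnCl_ball (U := Metric.closedBall s R)
      (fun z hz => (hL z hz).1.differentiableWithinAt) le_rfl)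
    (fun z hz => (hL z (Metric.sphere_subset_closedBall hz)).2)
  refine this.trans (le_of_eq ?_)
  rw [hR]; simp [Nat.factorial]; field_simp

end ZetaPart4

section ZetaPart5
open MeasureTheory Complex Filter Topology
variable {a Λ : ℕ → ℝ} {κ δ C0 : ℝ}

lemma sq_exp_integrable {b : ℝ} (hb : 0 < b) :
    IntegrableOn (fun v : ℝ => v ^ 2 * Real.exp (-b * v)) (Set.Ioi 0) := by
  have := integrableOn_rpow_mul_exp_neg_mul_rpow (p := 1) (s := 2) (b := b) (by norm_num) one_pos hb
  refine this.congr_fun (fun v hv => ?_) measurableSet_Ioi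
  simp

lemma sq_exp_integral {w : ℂ} (hw : 0 < w.re) :
    ∫ v : ℝ in Set.Ioi 0, (v:ℂ) ^ 2 * exp (-w * v) = 2 / w ^ 3 := by
  have hw0 : w ≠ 0 := fun h => by rw [h] at hw; simp at hw
  set F : ℝ → ℂ := fun v => -(exp (-w * v) * ((v:ℂ) ^ 2 / w + 2 * v / w ^ 2 + 2 / w ^ 3)) with hF
  have hder : ∀ v : ℝ, HasDerivAt F ((v:ℂ) ^ 2 * exp (-w * v)) v := by
    intro v
    have h1 : HasDerivAt (fun v : ℂ => -(exp (-w * v) * ((v:ℂ) ^ 2 / w + 2 * v / w ^ 2 + 2 / w ^ 3)))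
        (-(exp (-w * v) * (-w * 1) * ((v:ℂ) ^ 2 / w + 2 * v / w ^ 2 + 2 / w ^ 3) +
          exp (-w * v) * (((2:ℕ) * (v:ℂ) ^ (2 - 1) * 1) / w + 2 * 1 / w ^ 2 + 0))) (v:ℂ) := by
      refine HasDerivAt.neg ?_
      refine HasDerivAt.mul (((hasDerivAt_id (v:ℂ)).const_mul (-w)).cexp) ?_
      exact ((((hasDerivAt_id (v:ℂ)).pow 2).div_const w).add
        (((hasDerivAt_id (v:ℂ)).const_mul 2).div_const (w ^ 2))).add (hasDerivAt_const _ _)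
    have h2 := h1.comp_ofReal
    convert h2 using 1
    field_simp
    push_cast
    ring
  have hn : ∀ v : ℝ, ‖exp (-w * v)‖ = Real.exp (-w.re * v) := fun v => by
    rw [Complex.norm_exp]; simp
  have hintg : IntegrableOn (fun v : ℝ => (v:ℂ) ^ 2 * exp (-w * v)) (Set.Ioi 0) := by
    refine (sq_exp_integrable hw).mono' (by fun_prop) ?_
    refine ae_of_all _ fun v => ?_
    rw [norm_mul, hn, norm_pow, Complex.norm_real, Real.norm_eq_abs, sq_abs]
  have tz : ∀ k : ℕ, Tendsto (fun v : ℝ => exp (-w * v) * (v:ℂ) ^ k) atTop (𝓝 0) := by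
    intro k
    rw [tendsto_zero_iff_norm_tendsto_zero]
    refine (tendsto_rpow_mul_exp_neg_mul_atTop_nhds_zero (k:ℝ) w.re hw).congr' ?_
    filter_upwards [eventually_ge_atTop (0:ℝ)] with v hv
    rw [norm_mul, hn, norm_pow, Complex.norm_real, Real.norm_of_nonneg hv, Real.rpow_natCast, mul_comm]
  have hlim : Tendsto F atTop (𝓝 0) := by
    have := ((((tz 2).div_const w).add (((tz 1).const_mul (2 / w ^ 2)))).add ((tz 0).const_mul (2 / w ^ 3))).neg
    simp only [zero_div, mul_zero, add_zero, neg_zero] at this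
    refine this.congr fun v => ?_
    simp only [hF, pow_zero, pow_one]
    ring
  rw [integral_Ioi_of_hasDerivAt_of_tendsto' (fun v _ => hder v) hintg hlim]
  simp [hF]

lemma ZData.LL_eq (h : ZData a Λ κ δ C0) {s : ℂ} (hs : 1 < s.re) :
    LSeries (LSeries.logMul^[2] fun n => (Λ n : ℂ)) s - 2 / (s - 1) ^ 3 = - iteratedDeriv 2 (zL a κ) s := by
  have hopen : IsOpen {z : ℂ | 1 < z.re} := isOpen_lt continuous_const Complex.continuous_re
  have e1 : ∀ z ∈ {z : ℂ | 1 < z.re}, zL a κ z = (z - 1)⁻¹ - LSeries (fun n => (Λ n : ℂ)) z := by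
    intro z hz
    have hz1 : z - 1 ≠ 0 := fun h0 => by
      have h1 : 1 < z.re := hz
      have := congrArg re h0; simp at this; linarith
    have hzeta : LSeries (fun n => (a n : ℂ)) z ≠ 0 := by rw [h.zeta_exp hz]; exact exp_ne_zero _
    have hev : zH a κ =ᶠ[𝓝 z] fun z => (z - 1) * LSeries (fun n => (a n : ℂ)) z := by
      filter_upwards [hopen.mem_nhds hz] with w hw using h.H_eq hw
    have hd : HasDerivAt (fun z => (z - 1) * LSeries (fun n => (a n : ℂ)) z) _ z :=
      ((hasDerivAt_id z).sub_const 1).mul (h.deriv_zeta hz)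
    rw [zL, hev.deriv_eq, hd.deriv, h.H_eq hz]
    simp only [id]
    field_simp
    ring
  have hev : zL a κ =ᶠ[𝓝 s] (fun z => (z - 1)⁻¹) - LSeries (fun n => (Λ n : ℂ)) := by
    filter_upwards [hopen.mem_nhds hs] with w hw using e1 w hw
  have hs1 : s - 1 ≠ 0 := fun h0 => by
    have := congrArg re h0; simp at this; linarith
  have hcd : ContDiffAt ℂ (2:ℕ) (fun z : ℂ => (z - 1)⁻¹) s :=
    ContDiffAt.inv (by fun_prop) hs1
  have hcd2 : ContDiffAt ℂ (2:ℕ) (LSeries (fun n => (Λ n : ℂ))) s := by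
    have : AnalyticAt ℂ (LSeries (fun n => (Λ n : ℂ))) s :=
      LSeries_analyticOnNhd _ s (h.abs_L hs)
    exact this.contDiffAt
  rw [hev.iteratedDeriv_eq, iteratedDeriv_sub hcd hcd2, LSeries_iteratedDeriv 2 (h.abs_L hs)]
  have : iteratedDeriv 2 (fun z : ℂ => (z - 1)⁻¹) s = 2 / (s - 1) ^ 3 := by
    rw [iteratedDeriv_succ, iteratedDeriv_one]
    have hd1 : ∀ z : ℂ, z - 1 ≠ 0 → HasDerivAt (fun z : ℂ => (z - 1)⁻¹) (-1 / (z-1)^2) z := fun z hz => by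
      simpa using ((hasDerivAt_id z).sub_const 1).fun_inv hz
    have hev2 : deriv (fun z : ℂ => (z - 1)⁻¹) =ᶠ[𝓝 s] fun z => -1 / (z-1)^2 := by
      have : ∀ᶠ z in 𝓝 s, z - 1 ≠ 0 := (by fun_prop : ContinuousAt (fun z : ℂ => z - 1) s).eventually_ne hs1
      filter_upwards [this] with z hz using (hd1 z hz).deriv
    rw [hev2.deriv_eq]
    have hd2 : HasDerivAt (fun z : ℂ => -1 / (z-1)^2) _ s :=
      (hasDerivAt_const s (-1:ℂ)).div (((hasDerivAt_id s).sub_const 1).pow 2) (pow_ne_zero 2 hs1)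
    rw [hd2.deriv]
    simp only [id, Pi.sub_apply]
    field_simp
    push_cast
    ring
  rw [this]; ring

end ZetaPart5

section ZetaPart6
open MeasureTheory Complex Filter Topology
variable {a Λ : ℕ → ℝ} {κ δ C0 : ℝ}

/-- main term -/
noncomputable def zM (x : ℝ) : ℝ := ∫ v in Set.Ioi (0:ℝ), v ^ 2 * Real.exp v * max (x - Real.exp v) 0

/-- smoothed sum -/
noncomputable def zJ (Λ : ℕ → ℝ) (x : ℝ) : ℝ := ∑' n : ℕ, Λ n * Real.log n ^ 2 * max (x - n) 0

lemma ZData.summable_LL (h : ZData a Λ κ δ C0) {c : ℝ} (hc : 1 < c) :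
    Summable fun n : ℕ => Λ n * Real.log n ^ 2 * (n:ℝ) ^ (-c) := by
  have h1 : LSeriesSummable (LSeries.logMul^[2] fun n => (Λ n : ℂ)) (c:ℂ) := by
    apply LSeriesSummable_of_abscissaOfAbsConv_lt_re
    rw [Function.iterate_succ, Function.comp, Function.iterate_one]
    rw [LSeries.abscissaOfAbsConv_logMul, LSeries.abscissaOfAbsConv_logMul]; exact h.abs_L (by simpa using hc)
  refine h1.norm.congr fun n => ?_
  rcases Nat.eq_zero_or_pos n with rfl | hn
  · simp [h.L_zero]
  rw [LSeries.norm_term_eq, if_neg hn.ne', Real.rpow_neg (by positivity)]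
  simp only [Function.iterate_succ, Function.comp, Function.iterate_zero, id, LSeries.logMul, norm_mul,
    ← Complex.natCast_log, Complex.norm_real, Real.norm_of_nonneg (h.L_nonneg n), Complex.ofReal_re,
    Real.norm_of_nonneg (Real.log_natCast_nonneg n)]
  rw [div_eq_mul_inv]; ring

lemma max_scale {x u : ℝ} (hx : 0 < x) : max (1 - u / x) 0 = max (x - u) 0 / x := by
  rcases le_total u x with h | h
  · rw [max_eq_left (by rw [sub_nonneg, div_le_one hx]; exact h), max_eq_left (by linarith)]
    field_simp
  · rw [max_eq_right (by rw [sub_nonpos, one_le_div hx]; exact h), max_eq_right (by linarith)]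
    simp

/-- positive version of the cast -/
noncomputable def nu (n : ℕ) : ℝ := if n = 0 then 1 else n

lemma nu_pos (n : ℕ) : 0 < nu n := by
  unfold nu; split_ifs with h
  · exact one_pos
  · exact_mod_cast Nat.pos_of_ne_zero h

lemma ZData.perron_sum (h : ZData a Λ κ δ C0) {c x : ℝ} (hc : 1 < c) (hx : 0 < x) :
    ((zJ Λ x / x : ℝ) : ℂ) = (1 / (2 * Real.pi)) • ∫ y : ℝ,
      LSeries (LSeries.logMul^[2] fun n => (Λ n : ℂ)) (c + y * I) * (x:ℂ) ^ ((c:ℂ) + y * I) * perK (c + y * I) := by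
  have hintg : Integrable (fun n : ℕ => (Λ n * Real.log n ^ 2) * nu n ^ (-c)) Measure.count := by
    rw [integrable_count_iff]
    refine (h.summable_LL hc).norm.congr fun n => ?_
    rcases Nat.eq_zero_or_pos n with rfl | hn
    · simp [h.L_zero]
    · simp [nu, hn.ne']
  have key := perron_general Measure.count (fun n : ℕ => Λ n * Real.log n ^ 2) nu
    (by fun_prop) (by fun_prop) nu_pos hc.le hx hintg
  have hnn : ∀ n, 0 ≤ Λ n * Real.log n ^ 2 := fun n => mul_nonneg (h.L_nonneg n) (by positivity)
  have e1 : ∫ n : ℕ, (Λ n * Real.log n ^ 2) * max (1 - nu n / x) 0 ∂Measure.count = zJ Λ x / x := by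
    rw [integral_countable]
    · rw [zJ, ← tsum_div_const]
      refine tsum_congr fun n => ?_
      simp only [Measure.real, Measure.count_singleton, ENNReal.toReal_one, one_smul]
      rcases Nat.eq_zero_or_pos n with rfl | hn
      · simp [h.L_zero]
      simp only [nu, hn.ne', if_false]
      rw [mul_div_assoc]
      rw [max_scale hx]
    · rw [integrable_count_iff]
      refine summable_of_hasFiniteSupport ?_
      refine (Set.finite_le_nat ⌈x⌉₊).subset fun n hn => ?_
      by_contra hcon
      have hcon : ⌈x⌉₊ < n := not_le.1 hcon
      have hn0 : n ≠ 0 := by omega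
      have : x ≤ n := (Nat.le_ceil x).trans (by exact_mod_cast hcon.le)
      apply hn
      have : max (1 - nu n / x) 0 = 0 := max_eq_right (by
        simp only [nu, hn0, if_false]
        rw [sub_nonpos, one_le_div hx]; exact this)
      simp [this]
  rw [e1] at key
  rw [key]
  congr 1
  refine integral_congr_ae (ae_of_all _ fun y => ?_)
  simp only
  congr 2
  rw [integral_countable]
  · rw [LSeries]
    refine tsum_congr fun n => ?_
    simp only [Measure.real, Measure.count_singleton, ENNReal.toReal_one, one_smul]
    rcases Nat.eq_zero_or_pos n with rfl | hn
    · simp [h.L_zero]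
    rw [LSeries.term_of_ne_zero hn.ne', div_eq_mul_inv, ← Complex.cpow_neg]
    simp only [nu, hn.ne', if_false, Complex.ofReal_natCast]
    congr 1
    simp only [Function.iterate_succ, Function.comp, Function.iterate_zero, id, LSeries.logMul, ← Complex.natCast_log]
    push_cast; ring
  · rw [integrable_count_iff]
    refine (integrable_count_iff.1 hintg).congr fun n => ?_
    rw [norm_mul, norm_mul (_ : ℂ), norm_cpow_real (nu_pos n), Complex.norm_real, Real.norm_of_nonneg (Real.rpow_nonneg (nu_pos n).le _)]
    simp

lemma perron_main {c x : ℝ} (hc : 1 < c) (hx : 0 < x) :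
    ((zM x / x : ℝ) : ℂ) = (1 / (2 * Real.pi)) • ∫ y : ℝ,
      (2 / (((c:ℂ) + y * I) - 1) ^ 3) * (x:ℂ) ^ ((c:ℂ) + y * I) * perK (c + y * I) := by
  have hintg : Integrable (fun v : ℝ => (v ^ 2 * Real.exp v) * Real.exp v ^ (-c)) (volume.restrict (Set.Ioi 0)) := by
    refine (sq_exp_integrable (b := c - 1) (by linarith)).congr (ae_of_all _ fun v => ?_)
    simp only
    rw [← Real.exp_mul, mul_assoc, ← Real.exp_add]; ring_nf
  have key := perron_general (volume.restrict (Set.Ioi 0)) (fun v : ℝ => v ^ 2 * Real.exp v) Real.exp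
    (by fun_prop) (by fun_prop) Real.exp_pos hc.le hx hintg
  have e1 : ∫ v : ℝ in Set.Ioi 0, (v ^ 2 * Real.exp v) * max (1 - Real.exp v / x) 0 = zM x / x := by
    rw [zM, ← integral_div]
    refine integral_congr_ae (ae_of_all _ fun v => ?_)
    simp only
    rw [mul_div_assoc]
    rw [max_scale hx]
  rw [e1] at key
  rw [key]
  congr 1
  refine integral_congr_ae (ae_of_all _ fun y => ?_)
  simp only
  congr 2
  rw [← sq_exp_integral (w := (c:ℂ) + y * I - 1) (by simpa using hc)]
  refine integral_congr_ae (ae_of_all _ fun v => ?_)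
  simp only
  have hne : ((Real.exp v : ℝ) : ℂ) ≠ 0 := by exact_mod_cast (Real.exp_pos v).ne'
  rw [Complex.cpow_def_of_ne_zero hne, ← Complex.ofReal_log (Real.exp_pos v).le, Real.log_exp]
  push_cast
  rw [mul_assoc, ← Complex.exp_add]
  congr 2; ring

lemma ZData.J_bound (h : ZData a Λ κ δ C0) :
    ∃ K : ℝ, 0 < K ∧ ∀ x : ℝ, 1 ≤ Real.log x → 0 < x → |zJ Λ x - zM x| ≤ K * x ^ 2 := by
  obtain ⟨C, hC, hb⟩ := h.L_bound (ε := 1 / 30) (by norm_num) (by norm_num)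
  set g : ℝ → ℝ := fun y => C * (2 * (1 + ‖y‖) ^ (-(3/2:ℝ))) with hg
  have hgint : Integrable g := ((integrable_one_add_norm (by simp; norm_num)).const_mul 2).const_mul C
  refine ⟨1 + (1 / (2 * Real.pi)) * (Real.exp 1 * ∫ y, g y), ?_, fun x hlog hx => ?_⟩
  · have : 0 ≤ ∫ y, g y := integral_nonneg fun y => by simp only [hg, Pi.zero_apply]; positivity
    positivity
  set c := 1 + 1 / Real.log x with hc
  have hl0 : 0 < Real.log x := by linarith
  have hc1 : 1 < c := by rw [hc]; have : 0 < 1 / Real.log x := by positivity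
                         linarith
  have hc2 : c ≤ 2 := by rw [hc]; have : 1 / Real.log x ≤ 1 := by rw [div_le_one hl0]; exact hlog
                         linarith
  have hxc : x ^ c = x * Real.exp 1 := by
    rw [hc, Real.rpow_add hx, Real.rpow_one, Real.rpow_def_of_pos hx]; field_simp
  set Kf : ℝ → ℂ := fun y => (x:ℂ) ^ ((c:ℂ) + y * I) * perK (c + y * I) with hKf
  have hxne : (x:ℂ) ≠ 0 := by exact_mod_cast hx.ne'
  have hKc : Continuous Kf := by
    refine Continuous.mul ?_ (perK_cont hc1.le)
    exact Continuous.const_cpow (by fun_prop) (Or.inl hxne)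
  have hKn : ∀ y, ‖Kf y‖ ≤ x ^ c * (1 / (1 + y ^ 2)) := fun y => by
    simp only [hKf]
    rw [norm_mul, norm_cpow_real hx]
    have : ((c:ℂ) + y * I).re = c := by simp
    rw [this]
    exact mul_le_mul_of_nonneg_left (perK_norm_le hc1.le y) (by positivity)
  set F1 : ℝ → ℂ := fun y => LSeries (LSeries.logMul^[2] fun n => (Λ n : ℂ)) (c + y * I) with hF1
  set F2 : ℝ → ℂ := fun y => 2 / (((c:ℂ) + y * I) - 1) ^ 3 with hF2
  have hF1c : Continuous F1 := by
    have hd := LSeries_differentiableOn (LSeries.logMul^[2] fun n => (Λ n : ℂ))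
    refine hd.continuousOn.comp_continuous (by fun_prop) fun y => ?_
    show LSeries.abscissaOfAbsConv (LSeries.logMul^[2] fun n => (Λ n : ℂ)) < _
    rw [Function.iterate_succ, Function.comp, Function.iterate_one]
    rw [LSeries.abscissaOfAbsConv_logMul, LSeries.abscissaOfAbsConv_logMul]; exact h.abs_L (by simpa using hc1)
  have hne : ∀ y : ℝ, ((c:ℂ) + y * I) - 1 ≠ 0 := fun y h0 => by
    have := congrArg re h0; simp at this; linarith
  have hF2c : Continuous F2 := Continuous.div continuous_const (by fun_prop) fun y => pow_ne_zero 3 (hne y)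
  have hdiff : ∀ y, ‖(F1 y - F2 y) * Kf y‖ ≤ x ^ c * g y := by
    intro y
    have h1 : ‖F1 y - F2 y‖ ≤ C * (1 + |y|) ^ (1/2:ℝ) := by
      simp only [hF1, hF2]
      rw [h.LL_eq (by simpa using hc1), norm_neg]
      refine (hb _ (by simpa using hc1) (by simpa using hc2)).trans (le_of_eq ?_)
      have : ((c:ℂ) + y * I).im = y := by simp
      rw [this, zP, ← Real.rpow_natCast, ← Real.rpow_mul (by positivity)]
      norm_num
    rw [norm_mul]
    refine (mul_le_mul h1 (hKn y) (norm_nonneg _) (by positivity)).trans ?_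
    have e : (1 + |y|) ^ (1/2:ℝ) * (1 / (1 + y ^ 2)) ≤ 2 * (1 + ‖y‖) ^ (-(3/2:ℝ)) := by
      have hT : 0 < 1 + |y| := by positivity
      rw [Real.norm_eq_abs, mul_one_div, div_le_iff₀ (by positivity)]
      have e2 : (1 + |y|) ^ (1/2:ℝ) = (1 + |y|) ^ (-(3/2:ℝ)) * (1 + |y|) ^ 2 := by
        rw [← Real.rpow_natCast, ← Real.rpow_add hT]; norm_num
      rw [e2]
      have e3 : (1 + |y|) ^ 2 ≤ 2 * (1 + y ^ 2) := by
        have := sq_abs y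
        nlinarith [sq_nonneg (1 - |y|)]
      have e4 : 0 ≤ (1 + |y|) ^ (-(3/2:ℝ)) := by positivity
      nlinarith
    calc _ = x ^ c * (C * ((1 + |y|) ^ (1/2:ℝ) * (1 / (1 + y ^ 2)))) := by ring
      _ ≤ _ := by simp only [hg]; gcongr
  have iD : Integrable fun y => (F1 y - F2 y) * Kf y :=
    (hgint.const_mul (x ^ c)).mono' ((hF1c.sub hF2c).mul hKc).aestronglyMeasurable (ae_of_all _ hdiff)
  have i2 : Integrable fun y => F2 y * Kf y := by
    refine ((integrable_inv_one_add_sq.const_mul (x ^ c)).const_mul (2 / (c - 1) ^ 3)).mono'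
      (hF2c.mul hKc).aestronglyMeasurable (ae_of_all _ fun y => ?_)
    rw [norm_mul]
    have hcm : 0 < c - 1 := by linarith
    refine mul_le_mul ?_ (by simpa using hKn y) (norm_nonneg _) (by positivity)
    simp only [hF2]
    rw [norm_div, norm_pow]
    have : c - 1 ≤ ‖((c:ℂ) + y * I) - 1‖ := by
      have := (le_abs_self _).trans (Complex.abs_re_le_norm (((c:ℂ) + y * I) - 1))
      simpa using this
    simp only [Complex.norm_ofNat]
    gcongr
  have e1 := h.perron_sum hc1 hx
  have e2 := perron_main hc1 hx
  have i1 : Integrable fun y => F1 y * Kf y := (iD.add i2).congr (ae_of_all _ fun y => by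
    simp only [Pi.add_apply]; ring)
  have e3 : ((zJ Λ x / x - zM x / x : ℝ) : ℂ) = (1 / (2 * Real.pi)) • ∫ y, (F1 y - F2 y) * Kf y := by
    rw [Complex.ofReal_sub, e1, e2, ← smul_sub]
    congr 1
    simp only [mul_assoc]
    rw [← integral_sub i1 i2]
    refine integral_congr_ae (ae_of_all _ fun y => ?_)
    simp only; ring
  have e4 : |zJ Λ x / x - zM x / x| ≤ (1 / (2 * Real.pi)) * (x ^ c * ∫ y, g y) := by
    rw [← Real.norm_eq_abs, ← Complex.norm_real, e3, norm_smul, Real.norm_of_nonneg (by positivity)]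
    refine mul_le_mul_of_nonneg_left ?_ (by positivity)
    rw [← integral_const_mul]
    exact norm_integral_le_of_norm_le (hgint.const_mul _) (ae_of_all _ hdiff)
  rw [hxc] at e4
  have e5 : |zJ Λ x - zM x| = x * |zJ Λ x / x - zM x / x| := by
    rw [← abs_of_pos hx, ← abs_mul, abs_of_pos hx]; congr 1; field_simp
  rw [e5]
  calc _ ≤ x * ((1 / (2 * Real.pi)) * (x * Real.exp 1 * ∫ y, g y)) := by gcongr
    _ = ((1 / (2 * Real.pi)) * (Real.exp 1 * ∫ y, g y)) * x ^ 2 := by ring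
    _ ≤ _ := by gcongr; linarith

end ZetaPart6

section ZetaPart7
open MeasureTheory

/-- weighted summatory function -/
noncomputable def zG (Λ : ℕ → ℝ) (x : ℝ) : ℝ := ∑ n ∈ Finset.Icc 1 ⌊x⌋₊, Λ n * Real.log n ^ 2
/-- the integral of `v² eᵛ` -/
noncomputable def zI (Y : ℝ) : ℝ := (Y ^ 2 - 2 * Y + 2) * Real.exp Y - 2

lemma zI_eq (Y : ℝ) : ∫ v in (0:ℝ)..Y, v ^ 2 * Real.exp v = zI Y := by
  have hd : ∀ v ∈ Set.uIcc (0:ℝ) Y, HasDerivAt (fun v : ℝ => (v ^ 2 - 2 * v + 2) * Real.exp v)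
      (v ^ 2 * Real.exp v) v := fun v _ => by
    have h1 : HasDerivAt (fun v : ℝ => v ^ 2 - 2 * v + 2) (2 * v - 2) v := by
      have := ((hasDerivAt_pow 2 v).sub ((hasDerivAt_id v).const_mul 2)).add_const 2
      refine HasDerivAt.congr_deriv this ?_; norm_num
    have := h1.mul (Real.hasDerivAt_exp v)
    refine HasDerivAt.congr_deriv this ?_; ring
  rw [intervalIntegral.integral_eq_sub_of_hasDerivAt hd
    (Continuous.intervalIntegrable (by fun_prop) _ _)]
  simp [zI]

lemma zM_eq_int {x Y : ℝ} (hx : 0 < x) (hY : 0 ≤ Y) (h : Real.log x ≤ Y) :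
    zM x = ∫ v in (0:ℝ)..Y, v ^ 2 * Real.exp v * max (x - Real.exp v) 0 := by
  rw [zM, intervalIntegral.integral_of_le hY]
  refine setIntegral_eq_of_subset_of_forall_sdiff_eq_zero measurableSet_Ioi
    (fun v hv => hv.1) fun v hv => ?_
  have hv0 : 0 < v := hv.1
  have : Y < v := by
    by_contra hc
    exact hv.2 ⟨hv0, not_lt.1 hc⟩
  have : x ≤ Real.exp v := by
    rw [← Real.exp_log hx]; exact Real.exp_le_exp.2 (by linarith)
  rw [max_eq_right (by linarith), mul_zero]

lemma zM_diff {x h : ℝ} (hx : 1 ≤ x) (hh : 0 < h) :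
    h * zI (Real.log x) ≤ zM (x + h) - zM x ∧ zM (x + h) - zM x ≤ h * zI (Real.log (x + h)) := by
  set Y := Real.log (x + h) with hYd
  have hl : 0 ≤ Real.log x := Real.log_nonneg hx
  have hlY : Real.log x ≤ Y := Real.log_le_log (by linarith) (by linarith)
  have hY : 0 ≤ Y := hl.trans hlY
  have ci : ∀ t : ℝ, ∀ a b : ℝ, IntervalIntegrable
      (fun v : ℝ => v ^ 2 * Real.exp v * max (t - Real.exp v) 0) volume a b :=
    fun t a b => Continuous.intervalIntegrable (by fun_prop) _ _
  have cj : ∀ a b : ℝ, IntervalIntegrable (fun v : ℝ => h * (v ^ 2 * Real.exp v)) volume a b :=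
    fun a b => Continuous.intervalIntegrable (by fun_prop) _ _
  rw [zM_eq_int (x := x + h) (by linarith) hY le_rfl, zM_eq_int (x := x) (by linarith) hY hlY,
    ← intervalIntegral.integral_sub (ci _ _ _) (ci _ _ _), ← zI_eq, ← zI_eq,
    ← intervalIntegral.integral_const_mul, ← intervalIntegral.integral_const_mul]
  have key : ∀ v : ℝ, v ^ 2 * Real.exp v * max (x + h - Real.exp v) 0
      - v ^ 2 * Real.exp v * max (x - Real.exp v) 0 ≤ h * (v ^ 2 * Real.exp v) := fun v => by
    have : max (x + h - Real.exp v) 0 - max (x - Real.exp v) 0 ≤ h := by grind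
    have h0 : 0 ≤ v ^ 2 * Real.exp v := by positivity
    nlinarith
  have key2 : ∀ v : ℝ, 0 ≤ v ^ 2 * Real.exp v * max (x + h - Real.exp v) 0
      - v ^ 2 * Real.exp v * max (x - Real.exp v) 0 := fun v => by
    have : 0 ≤ max (x + h - Real.exp v) 0 - max (x - Real.exp v) 0 := by grind
    have h0 : 0 ≤ v ^ 2 * Real.exp v := by positivity
    nlinarith
  constructor
  · rw [← intervalIntegral.integral_add_adjacent_intervals (b := Real.log x)
      ((ci _ _ _).sub (ci _ _ _)) ((ci _ _ _).sub (ci _ _ _))]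
    have e1 : ∫ v in (0:ℝ)..Real.log x, h * (v ^ 2 * Real.exp v) ≤
        ∫ v in (0:ℝ)..Real.log x, (v ^ 2 * Real.exp v * max (x + h - Real.exp v) 0
        - v ^ 2 * Real.exp v * max (x - Real.exp v) 0) := by
      refine intervalIntegral.integral_mono_on hl (cj _ _) ((ci _ _ _).sub (ci _ _ _))
        fun v hv => ?_
      have : Real.exp v ≤ x := by
        rw [← Real.exp_log (show 0 < x by linarith)]; exact Real.exp_le_exp.2 hv.2
      rw [max_eq_left (by linarith), max_eq_left (by linarith)]
      linarith
    have e2 : 0 ≤ ∫ v in Real.log x..Y, (v ^ 2 * Real.exp v * max (x + h - Real.exp v) 0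
        - v ^ 2 * Real.exp v * max (x - Real.exp v) 0) :=
      intervalIntegral.integral_nonneg hlY fun v _ => key2 v
    linarith
  · exact intervalIntegral.integral_mono_on hY ((ci _ _ _).sub (ci _ _ _)) (cj _ _)
      fun v _ => key v

variable {a Λ : ℕ → ℝ} {κ δ C0 : ℝ}

lemma ZData.J_fin (_h : ZData a Λ κ δ C0) {x : ℝ} {m : ℕ} (hm : ⌊x⌋₊ ≤ m) :
    zJ Λ x = ∑ n ∈ Finset.Icc 1 m, Λ n * Real.log n ^ 2 * max (x - n) 0 := by
  rw [zJ]
  refine tsum_eq_sum fun n hn => ?_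
  rcases Nat.eq_zero_or_pos n with rfl | hp
  · simp
  have hnm : m < n := by
    by_contra hc
    exact hn (Finset.mem_Icc.2 ⟨hp, not_lt.1 hc⟩)
  have : x < n := Nat.lt_of_floor_lt (by omega)
  rw [max_eq_right (by linarith), mul_zero]

lemma ZData.J_diff (hz : ZData a Λ κ δ C0) {x h : ℝ} (hx : 1 ≤ x) (hh : 0 < h) :
    h * zG Λ x ≤ zJ Λ (x + h) - zJ Λ x ∧ zJ Λ (x + h) - zJ Λ x ≤ h * zG Λ (x + h) := by
  have hfl : ⌊x⌋₊ ≤ ⌊x + h⌋₊ := Nat.floor_le_floor (by linarith)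
  rw [hz.J_fin (x := x + h) le_rfl, hz.J_fin hfl, ← Finset.sum_sub_distrib, zG, zG, Finset.mul_sum,
    Finset.mul_sum]
  have hw : ∀ n, 0 ≤ Λ n * Real.log n ^ 2 := fun n => mul_nonneg (hz.L_nonneg n) (sq_nonneg _)
  have key : ∀ n : ℕ, 0 ≤ Λ n * Real.log n ^ 2 * max (x + h - n) 0
      - Λ n * Real.log n ^ 2 * max (x - n) 0 := fun n => by
    have : 0 ≤ max (x + h - n) 0 - max (x - n) 0 := by grind
    have h0 := hw n
    nlinarith
  constructor
  · refine (Finset.sum_le_sum fun n hn => ?_).trans (Finset.sum_le_sum_of_subset_of_nonneg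
      (Finset.Icc_subset_Icc_right hfl) fun n _ _ => key n)
    have : (n:ℝ) ≤ x := (Nat.le_floor_iff (by linarith)).1 (Finset.mem_Icc.1 hn).2
    rw [max_eq_left (by linarith), max_eq_left (by linarith)]
    linarith
  · refine Finset.sum_le_sum fun n hn => ?_
    have : max (x + h - n) 0 - max (x - n) 0 ≤ h := by grind
    have h0 := hw n
    nlinarith

lemma ZData.G_bound (hz : ZData a Λ κ δ C0) : ∃ K, 0 < K ∧ ∀ x, 2 ≤ Real.log x → 0 < x →
    |zG Λ x - x * Real.log x ^ 2| ≤ K * (x * Real.log x) := by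
  obtain ⟨K, hK, hb⟩ := hz.J_bound
  refine ⟨5 + 5 * K, by linarith, fun x hl hx => ?_⟩
  set l := Real.log x with hld
  have hl0 : 0 < l := by linarith
  have hx1 : 2 ≤ x := by
    have := Real.log_le_sub_one_of_pos hx
    linarith
  set h := x / l with hh
  have hh0 : 0 < h := by positivity
  have hhl : h * l = x := by rw [hh]; field_simp
  have hhx : h ≤ x / 2 := by nlinarith
  have hxh : Real.log (x + h) ≤ l + 1 / l := by
    have : x + h = x * (1 + 1 / l) := by rw [hh]; field_simp
    rw [this, Real.log_mul hx.ne' (by positivity)]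
    have := Real.log_le_sub_one_of_pos (show 0 < 1 + 1 / l by positivity)
    linarith
  have hxh' : l - 1 ≤ Real.log (x - h) := by
    have e : Real.log (x / 2) ≤ Real.log (x - h) := Real.log_le_log (by linarith) (by linarith)
    rw [Real.log_div hx.ne' (by norm_num)] at e
    have := Real.log_two_lt_d9
    linarith
  have hlx : l ≤ Real.log (x + h) := Real.log_le_log hx (by linarith)
  rw [abs_le]
  constructor
  · have a1 := (hz.J_diff (x := x - h) (h := h) (by linarith) hh0).2
    have a2 := (zM_diff (x := x - h) (h := h) (by linarith) hh0).1
    have a3 := abs_le.1 (hb x (by linarith) hx)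
    have a4 := abs_le.1 (hb (x - h) (by linarith) (by linarith))
    rw [sub_add_cancel] at a1 a2
    have a5 : (x - h) ^ 2 ≤ x ^ 2 := by nlinarith
    have a6 : h * zI (Real.log (x - h)) - 2 * K * x ^ 2 ≤ h * zG Λ x := by nlinarith
    have a7 : x * l ^ 2 - 5 * (x * l) ≤ zI (Real.log (x - h)) := by
      rw [zI, Real.exp_log (by linarith)]
      set Y := Real.log (x - h)
      have b1 : (l - 2) ^ 2 + 1 ≤ Y ^ 2 - 2 * Y + 2 := by nlinarith
      have b2 : ((l - 2) ^ 2 + 1) * (x - h) ≤ (Y ^ 2 - 2 * Y + 2) * (x - h) := by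
        gcongr; linarith
      have b3 : ((l - 2) ^ 2 + 1) * (x - h) = x * l ^ 2 - 5 * (x * l) + 9 * x - 5 * h := by
        have : ((l - 2) ^ 2 + 1) * (x - h) = x * l ^ 2 - 4 * (x * l) + 5 * x - (h * l) * l + 4 * (h * l) - 5 * h := by ring
        rw [this, hhl]; ring
      linarith
    have a8 : h * (x * l ^ 2 - 5 * (x * l)) - 2 * K * x ^ 2 ≤ h * zG Λ x :=
      le_trans (by gcongr) a6
    have a9 : h * (x * l ^ 2 - 5 * (x * l) - 2 * K * (x * l)) ≤ h * zG Λ x := by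
      have : h * (2 * K * (x * l)) = 2 * K * x ^ 2 := by
        rw [show h * (2 * K * (x * l)) = 2 * K * x * (h * l) by ring, hhl]; ring
      linarith
    have := le_of_mul_le_mul_left a9 hh0
    have : 0 ≤ K * (x * l) := by positivity
    linarith
  · have a1 := (hz.J_diff (x := x) (h := h) (by linarith) hh0).1
    have a2 := (zM_diff (x := x) (h := h) (by linarith) hh0).2
    have a3 := abs_le.1 (hb x (by linarith) hx)
    have a4 := abs_le.1 (hb (x + h) (by linarith) (by linarith))
    have a5 : (x + h) ^ 2 ≤ 4 * x ^ 2 := by nlinarith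
    have a6 : h * zG Λ x ≤ h * zI (Real.log (x + h)) + 5 * K * x ^ 2 := by nlinarith
    have a7 : zI (Real.log (x + h)) ≤ x * l ^ 2 + 5 * (x * l) := by
      rw [zI, Real.exp_log (by linarith)]
      set Y := Real.log (x + h)
      have b0 : l * (1 / l) = 1 := by field_simp
      have b4 : 1 / l ≤ 1 := by rw [div_le_one hl0]; linarith
      have b1 : Y ^ 2 - 2 * Y + 2 ≤ l ^ 2 + 3 := by
        have hY0 : 0 ≤ Y := by linarith
        have : Y ^ 2 ≤ (l + 1 / l) ^ 2 := by gcongr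
        have b5 : 0 < 1 / l := by positivity
        nlinarith
      have b2 : (Y ^ 2 - 2 * Y + 2) * (x + h) ≤ (l ^ 2 + 3) * (x + h) := by
        gcongr
      have b3 : (l ^ 2 + 3) * (x + h) = x * l ^ 2 + x * l + 3 * x + 3 * h := by
        have : (l ^ 2 + 3) * (x + h) = x * l ^ 2 + (h * l) * l + 3 * x + 3 * h := by ring
        rw [this, hhl]
      nlinarith
    have a8 : h * zG Λ x ≤ h * (x * l ^ 2 + 5 * (x * l)) + 5 * K * x ^ 2 :=
      le_trans a6 (by gcongr)
    have a9 : h * zG Λ x ≤ h * (x * l ^ 2 + 5 * (x * l) + 5 * K * (x * l)) := by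
      have : h * (5 * K * (x * l)) = 5 * K * x ^ 2 := by
        rw [show h * (5 * K * (x * l)) = 5 * K * x * (h * l) by ring, hhl]; ring
      linarith
    have := le_of_mul_le_mul_left a9 hh0
    linarith


/-- Chebyshev function of the data -/
noncomputable def zPsi (Λ : ℕ → ℝ) (x : ℝ) : ℝ := ∑ n ∈ Finset.Icc 1 ⌊x⌋₊, Λ n
/-- logarithmic mean -/
noncomputable def zT (Λ : ℕ → ℝ) (x : ℝ) : ℝ := ∑ n ∈ Finset.Icc 1 ⌊x⌋₊, Λ n * Real.log (x / n)

lemma mem_Icc_floor {x : ℝ} (hx : 0 ≤ x) {n : ℕ} (hn : n ∈ Finset.Icc 1 ⌊x⌋₊) :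
    1 ≤ (n : ℝ) ∧ (n : ℝ) ≤ x :=
  ⟨by exact_mod_cast (Finset.mem_Icc.1 hn).1, (Nat.le_floor_iff hx).1 (Finset.mem_Icc.1 hn).2⟩

lemma ZData.psi_triv (hz : ZData a Λ κ δ C0) {x : ℝ} (hx : 1 ≤ x) :
    zPsi Λ x ≤ (κ + C0) * x * Real.log x := by
  refine le_trans ?_ (mul_le_mul_of_nonneg_right (hz.sum_le hx) (Real.log_nonneg hx))
  rw [zPsi, Finset.sum_mul]
  refine Finset.sum_le_sum fun n hn => (hz.L_le n).trans ?_
  have := mem_Icc_floor (by linarith) hn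
  exact mul_le_mul_of_nonneg_left (Real.log_le_log (by linarith) this.2) (hz.a_nonneg n)

lemma ZData.psi_cheb (hz : ZData a Λ κ δ C0) : ∃ A, 0 < A ∧ ∀ x, 1 ≤ x → zPsi Λ x ≤ A * x := by
  obtain ⟨K, hK, hG⟩ := hz.G_bound
  have hk := hz.kpos
  have hC := hz.C0_nonneg
  refine ⟨2 * (κ + C0) + 4 + 4 * K, by positivity, fun x hx => ?_⟩
  have hx0 : 0 < x := by linarith
  rcases le_or_gt 2 (Real.log x) with hl | hl
  · set l := Real.log x with hld
    have hG' := (abs_le.1 (hG x hl hx0)).2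
    have hs1 : 1 ≤ √x := Real.one_le_sqrt.2 hx
    have hsx : √x ≤ x := by nlinarith [Real.sq_sqrt hx0.le]
    have hlog : Real.log (√x) = l / 2 := Real.log_sqrt hx0.le
    have e1 : zPsi Λ x ≤ zPsi Λ (√x) + 4 / l ^ 2 * zG Λ x := by
      have hsub : Finset.Icc 1 ⌊√x⌋₊ ⊆ Finset.Icc 1 ⌊x⌋₊ :=
        Finset.Icc_subset_Icc_right (Nat.floor_le_floor hsx)
      rw [zPsi, zPsi, zG, ← Finset.sum_sdiff hsub, add_comm, Finset.mul_sum]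
      gcongr
      refine (Finset.sum_le_sum fun n hn => ?_).trans (Finset.sum_le_sum_of_subset_of_nonneg
        (Finset.sdiff_subset) fun n _ _ => mul_nonneg (by positivity)
          (mul_nonneg (hz.L_nonneg n) (sq_nonneg _)))
      have hn1 := (Finset.mem_sdiff.1 hn)
      have hn2 : √x < n := by
        by_contra hc
        exact hn1.2 (Finset.mem_Icc.2 ⟨(Finset.mem_Icc.1 hn1.1).1, Nat.le_floor (not_lt.1 hc)⟩)
      have hn3 : l / 2 ≤ Real.log n := by
        rw [← hlog]; exact Real.log_le_log (by linarith) hn2.le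
      have : 1 ≤ 4 / l ^ 2 * Real.log n ^ 2 := by
        rw [div_mul_eq_mul_div, le_div_iff₀ (by positivity)]
        nlinarith
      have h0 := hz.L_nonneg n
      nlinarith
    have e2 := hz.psi_triv hs1
    rw [hlog] at e2
    have e3 : l / 2 ≤ √x := by
      rw [← hlog]; have := Real.log_le_sub_one_of_pos (show 0 < √x by linarith); linarith
    have e4 : (κ + C0) * √x * (l / 2) ≤ (κ + C0) * x := by
      calc _ ≤ (κ + C0) * √x * √x := by gcongr
        _ = _ := by rw [mul_assoc, Real.mul_self_sqrt hx0.le]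
    have e5 : 4 / l ^ 2 * zG Λ x ≤ (4 + 4 * K) * x := by
      rw [div_mul_eq_mul_div, div_le_iff₀ (by positivity)]
      have : x * l ≤ x * l ^ 2 := by gcongr; nlinarith
      have h5 : K * (x * l) ≤ K * (x * l ^ 2) := by gcongr
      linarith
    have : 0 ≤ (κ + C0) * x := by positivity
    linarith
  · have := hz.psi_triv hx
    have h2 : (κ + C0) * x * Real.log x ≤ (κ + C0) * x * 2 := by gcongr
    have : 0 ≤ K * x := by positivity
    linarith

/-- generic version: a nonnegative sequence with linear partial sums has linear log mean -/
lemma zT_le {c : ℕ → ℝ} (hc : ∀ n, 0 ≤ c n) {A : ℝ} (hA : 0 < A)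
    (hb : ∀ x, 1 ≤ x → zPsi c x ≤ A * x) : ∀ x, 1 ≤ x → zT c x ≤ 2 * A * x := by
  have key : ∀ k : ℕ, ∀ x : ℝ, 0 < x → x < 2 ^ k → zT c x ≤ 2 * A * x := by
    intro k
    induction k with
    | zero =>
      intro x hx hx1
      have : ⌊x⌋₊ = 0 := Nat.floor_eq_zero.2 (by simpa using hx1)
      rw [zT, this]; simp; positivity
    | succ k ih =>
      intro x hx hxk
      rcases lt_or_ge x 1 with h1 | h1
      · have : ⌊x⌋₊ = 0 := Nat.floor_eq_zero.2 (by simpa using h1)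
        rw [zT, this]; simp; positivity
      have i1 := ih (x / 2) (by linarith) (by rw [pow_succ] at hxk; linarith)
      have e : zT c x ≤ zT c (x / 2) + zPsi c x := by
        have hsub : Finset.Icc 1 ⌊x / 2⌋₊ ⊆ Finset.Icc 1 ⌊x⌋₊ :=
          Finset.Icc_subset_Icc_right (Nat.floor_le_floor (by linarith))
        rw [zT, zT, zPsi, ← Finset.sum_sdiff hsub, ← Finset.sum_sdiff hsub (f := c)]
        have hl2 := Real.log_two_lt_d9
        have f1 : ∑ n ∈ Finset.Icc 1 ⌊x⌋₊ \ Finset.Icc 1 ⌊x / 2⌋₊, c n * Real.log (x / n) ≤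
            ∑ n ∈ Finset.Icc 1 ⌊x⌋₊ \ Finset.Icc 1 ⌊x / 2⌋₊, c n := by
          refine Finset.sum_le_sum fun n hn => ?_
          have hn1 := (Finset.mem_sdiff.1 hn)
          have hm := mem_Icc_floor hx.le hn1.1
          have hn2 : x / 2 < n := by
            by_contra hc
            exact hn1.2 (Finset.mem_Icc.2 ⟨(Finset.mem_Icc.1 hn1.1).1, Nat.le_floor (not_lt.1 hc)⟩)
          have : Real.log (x / n) ≤ 1 := by
            have : x / n ≤ 2 := by rw [div_le_iff₀ (by linarith)]; linarith
            have := Real.log_le_log (by have : (0:ℝ) < n := by linarith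
                                        positivity) this
            linarith
          have h0 := hc n
          nlinarith
        have f2 : ∑ n ∈ Finset.Icc 1 ⌊x / 2⌋₊, c n * Real.log (x / n) ≤
            ∑ n ∈ Finset.Icc 1 ⌊x / 2⌋₊, c n * Real.log (x / 2 / n) +
              ∑ n ∈ Finset.Icc 1 ⌊x / 2⌋₊, c n := by
          rw [← Finset.sum_add_distrib]
          refine Finset.sum_le_sum fun n hn => ?_
          have hm := mem_Icc_floor (by linarith) hn
          have hn0 : (0:ℝ) < n := by linarith
          have : Real.log (x / n) = Real.log (x / 2 / n) + Real.log 2 := by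
            rw [← Real.log_mul (by positivity) (by norm_num)]; congr 1; field_simp
          rw [this]
          have h0 := hc n
          nlinarith
        linarith
      have := hb x h1
      linarith
  intro x hx
  obtain ⟨k, hk⟩ := pow_unbounded_of_one_lt x (show (1:ℝ) < 2 by norm_num)
  exact key k x (by linarith) hk

theorem ZData.pnt (hz : ZData a Λ κ δ C0) : ∃ C, 0 < C ∧ ∀ x, 2 ≤ x →
    |zPsi Λ x - x| ≤ C * (x / Real.log x) := by
  obtain ⟨K, hK, hG⟩ := hz.G_bound
  obtain ⟨A, hA, hAb⟩ := hz.psi_cheb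
  refine ⟨K + 4 * A + 2, by positivity, fun x hx => ?_⟩
  have hx0 : 0 < x := by linarith
  have hlp : 0 < Real.log x := Real.log_pos (by linarith)
  have hA1 := hAb x (by linarith)
  have hT := zT_le hz.L_nonneg hA hAb x (by linarith)
  have hpsi0 : 0 ≤ zPsi Λ x := Finset.sum_nonneg fun n _ => hz.L_nonneg n
  set l := Real.log x with hld
  rw [← mul_div_assoc, le_div_iff₀ hlp]
  rcases le_or_gt 2 l with hl | hl
  · have hG' := abs_le.1 (hG x hl hx0)
    rw [← hld] at hG'
    have e1 : zG Λ x ≤ zPsi Λ x * l ^ 2 := by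
      rw [zG, zPsi, Finset.sum_mul]
      refine Finset.sum_le_sum fun n hn => ?_
      have hm := mem_Icc_floor hx0.le hn
      have h1 : 0 ≤ Real.log n := Real.log_nonneg hm.1
      have h2 : Real.log n ≤ l := Real.log_le_log (by linarith) hm.2
      have h0 := hz.L_nonneg n
      gcongr
    have e2 : zPsi Λ x * l ^ 2 ≤ zG Λ x + 2 * l * zT Λ x := by
      rw [zG, zPsi, zT, Finset.sum_mul, Finset.mul_sum, ← Finset.sum_add_distrib]
      refine Finset.sum_le_sum fun n hn => ?_
      have hm := mem_Icc_floor hx0.le hn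
      have h1 : 0 ≤ Real.log n := Real.log_nonneg hm.1
      have h2 : Real.log n ≤ l := Real.log_le_log (by linarith) hm.2
      have h0 := hz.L_nonneg n
      have hn0 : (0:ℝ) < n := by linarith
      rw [Real.log_div hx0.ne' hn0.ne', ← hld]
      have : l ^ 2 ≤ Real.log n ^ 2 + 2 * l * (l - Real.log n) := by nlinarith
      nlinarith
    have e3 : 2 * l * zT Λ x ≤ 2 * l * (2 * A * x) := by gcongr
    have e4 : |zPsi Λ x - x| * l * l ≤ (K + 4 * A + 2) * x * l := by
      rw [mul_assoc, ← abs_of_pos (show 0 < l * l by positivity), ← abs_mul, abs_le]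
      have : 0 ≤ A * (x * l) := by positivity
      have : 0 ≤ x * l := by positivity
      constructor <;> nlinarith
    exact le_of_mul_le_mul_right e4 hlp
  · have e : |zPsi Λ x - x| ≤ (A + 1) * x := by
      rw [abs_le]; constructor <;> nlinarith
    calc _ ≤ (A + 1) * x * 2 := by gcongr
      _ ≤ _ := by nlinarith [mul_pos hK hx0, mul_pos hA hx0]

end ZetaPart7

section GeomPart1
open MeasureTheory NumberField.mixedEmbedding NumberField.mixedEmbedding.fundamentalCone
  NumberField.InfinitePlace NumberField.Units NumberField.Units.dirichletUnitTheorem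
open scoped nonZeroDivisors

lemma integral_exp_mul_aux {c : ℝ} (hc : c ≠ 0) {a b : ℝ} :
    ∫ x in a..b, Real.exp (c * x) = (Real.exp (c * b) - Real.exp (c * a)) / c := by
  rw [intervalIntegral.integral_comp_mul_left (fun x => Real.exp x) hc, integral_exp, smul_eq_mul]
  field_simp

variable (K : Type*) [Field K] [NumberField K]

/-- parameter box -/
def cbox (I : Set ℝ) (b c : ℝ) : Set (realSpace K) :=
  Set.univ.pi fun w => if w = w₀ then I else Set.Ico b c

/-- the subset of the mixed space described by a parameter box -/
def cX (I : Set ℝ) (b c : ℝ) : Set (mixedSpace K) :=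
  normAtAllPlaces ⁻¹' (expMapBasis '' cbox K I b c)

variable {K}

lemma mem_cbox {I : Set ℝ} {b c : ℝ} {p : realSpace K} :
    p ∈ cbox K I b c ↔ p w₀ ∈ I ∧ ∀ w, w ≠ w₀ → p w ∈ Set.Ico b c := by
  simp only [cbox, Set.mem_univ_pi]
  constructor
  · intro h
    exact ⟨by simpa using h w₀, fun w hw => by simpa [hw] using h w⟩
  · rintro ⟨h1, h2⟩ w
    by_cases hw : w = w₀
    · subst hw; simpa using h1
    · simpa [hw] using h2 w hw

lemma mem_cX {I : Set ℝ} {b c : ℝ} {x : mixedSpace K} :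
    x ∈ cX K I b c ↔ ∃ p, normAtAllPlaces x = expMapBasis p ∧ p w₀ ∈ I ∧
      ∀ w, w ≠ w₀ → p w ∈ Set.Ico b c := by
  simp only [cX, Set.mem_preimage, Set.mem_image, mem_cbox]
  constructor
  · rintro ⟨p, h1, h2⟩; exact ⟨p, h2.symm, h1⟩
  · rintro ⟨p, h1, h2⟩; exact ⟨p, h2, h1.symm⟩

lemma cX_norm {x : mixedSpace K} {p : realSpace K} (h : normAtAllPlaces x = expMapBasis p) :
    mixedEmbedding.norm x = Real.exp (p w₀) ^ Module.finrank ℚ K := by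
  rw [← norm_normAtAllPlaces, h, norm_expMapBasis]

lemma exists_param {x : mixedSpace K} (h : ∀ w, 0 < normAtPlace w x) :
    ∃ p, normAtAllPlaces x = expMapBasis p := by
  refine ⟨expMapBasis.symm (normAtAllPlaces x), ?_⟩
  refine (expMapBasis.right_inv (Set.mem_univ_pi.mpr ?_)).symm
  exact h

lemma cone_iff {x : mixedSpace K} : x ∈ fundamentalCone K ↔
    ∃ p, normAtAllPlaces x = expMapBasis p ∧ ∀ w, w ≠ w₀ → p w ∈ Set.Ico (0:ℝ) 1 := by
  constructor
  · intro hx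
    obtain ⟨p, hp⟩ := exists_param (normAtPlace_pos_of_mem hx)
    refine ⟨p, hp, ?_⟩
    rw [← logMap_expMapBasis, ← hp, logMap_normAtAllPlaces]
    exact hx.1
  · rintro ⟨p, hp, h⟩
    refine ⟨?_, ?_⟩
    · rw [← logMap_expMapBasis, ← hp, logMap_normAtAllPlaces] at h
      exact h
    · have := cX_norm hp
      have h2 : mixedEmbedding.norm x ≠ 0 := by rw [this]; positivity
      exact h2

lemma measurableSet_cbox {I : Set ℝ} (hI : MeasurableSet I) (b c : ℝ) :
    MeasurableSet (cbox K I b c) := by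
  refine MeasurableSet.univ_pi fun _ ↦ ?_
  split_ifs
  · exact hI
  · exact measurableSet_Ico

lemma measurableSet_cX {I : Set ℝ} (hI : MeasurableSet I) (b c : ℝ) :
    MeasurableSet (cX K I b c) := by
  refine MeasurableSet.preimage ?_ (continuous_normAtAllPlaces K).measurable
  exact MeasurableSet.image_of_continuousOn_injOn (measurableSet_cbox hI b c)
    (continuous_expMapBasis K).continuousOn (injective_expMapBasis K).injOn

lemma setLIntegral_cbox {I : Set ℝ} (b c : ℝ) (n : ℕ) :
    ∫⁻ (x : realSpace K) in cbox K I b c, .ofReal (Real.exp (x w₀ * n)) =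
      (∫⁻ a in I, .ofReal (Real.exp (a * n))) *
        ENNReal.ofReal (c - b) ^ (Finset.univ.erase (w₀ : InfinitePlace K)).card := by
  rw [volume_pi, cbox, Measure.restrict_pi_pi, lintegral_eq_lmarginal_univ 0,
    lmarginal_erase' _ (by fun_prop) (Finset.mem_univ w₀), if_pos rfl]
  simp_rw [Function.update_self, lmarginal, lintegral_const, Measure.pi_univ, if_neg
    (Finset.ne_of_mem_erase (Subtype.prop _)), Measure.restrict_apply_univ, Real.volume_Ico]
  simp

lemma volume_cX {I : Set ℝ} (hI : MeasurableSet I) (b c : ℝ) :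
    volume (cX K I b c) = 2 ^ nrRealPlaces K * .ofReal (2 * Real.pi) ^ nrComplexPlaces K *
      ((2 : ENNReal)⁻¹ ^ nrComplexPlaces K * ENNReal.ofReal (regulator K) * (Module.finrank ℚ K) *
      ((∫⁻ a in I, .ofReal (Real.exp (a * Module.finrank ℚ K))) *
        ENNReal.ofReal (c - b) ^ (Finset.univ.erase (w₀ : InfinitePlace K)).card)) := by
  rw [cX, volume_eq_two_pow_mul_two_pi_pow_mul_integral Set.preimage_image_preimage
    (measurableSet_cX hI b c), normAtAllPlaces_image_preimage_expMapBasis,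
    setLIntegral_expMapBasis_image (measurableSet_cbox hI b c) (by fun_prop)]
  simp_rw [ENNReal.inv_mul_cancel_right
    (Finset.prod_ne_zero_iff.mpr fun _ _ ↦ ENNReal.ofReal_ne_zero_iff.mpr (expMapBasis_pos _ _))
    (ENNReal.prod_ne_top fun _ _ ↦ ENNReal.ofReal_ne_top)]
  rw [setLIntegral_cbox]

lemma volume_cX_aux {I : Set ℝ} (hI : MeasurableSet I) {b c : ℝ} (hbc : b ≤ c) {E : ℝ}
    (hE : 0 ≤ E) (h : ∫⁻ a in I, .ofReal (Real.exp (a * Module.finrank ℚ K)) =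
      ENNReal.ofReal (E / Module.finrank ℚ K)) :
    volume (cX K I b c) = ENNReal.ofReal (2 ^ nrRealPlaces K * (2 * Real.pi) ^ nrComplexPlaces K *
      ((2 : ℝ)⁻¹ ^ nrComplexPlaces K * regulator K) * E *
      (c - b) ^ (Finset.univ.erase (w₀ : InfinitePlace K)).card) := by
  have hn0 : 0 < Module.finrank ℚ K := Module.finrank_pos
  have hreg := (regulator_pos K).le
  have hcb : 0 ≤ c - b := by linarith
  have h2 : (2 : ENNReal) = ENNReal.ofReal 2 := by simp
  have h3 : ((Module.finrank ℚ K : ℕ) : ENNReal) = ENNReal.ofReal (Module.finrank ℚ K : ℝ) := by simp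
  rw [volume_cX hI, h, h2, h3, ← ENNReal.ofReal_inv_of_pos (by norm_num),
    ← ENNReal.ofReal_pow (by positivity), ← ENNReal.ofReal_pow (by positivity),
    ← ENNReal.ofReal_pow (by positivity), ← ENNReal.ofReal_pow (by positivity),
    ← ENNReal.ofReal_mul (by positivity), ← ENNReal.ofReal_mul (by positivity),
    ← ENNReal.ofReal_mul (by positivity), ← ENNReal.ofReal_mul (by positivity),
    ← ENNReal.ofReal_mul (by positivity), ← ENNReal.ofReal_mul (by positivity)]
  congr 1
  have hnR : (0:ℝ) < Module.finrank ℚ K := by exact_mod_cast hn0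
  field_simp

/-- explicit volumes -/
lemma volume_cX_explicit : ∃ V : ℝ, 0 < V ∧ ∃ r : ℕ, ∀ b c : ℝ, b ≤ c →
    (∀ a₂ : ℝ, volume (cX K (Set.Iic a₂) b c) =
      ENNReal.ofReal (V * Real.exp a₂ ^ (Module.finrank ℚ K) * (c - b) ^ r)) ∧
    (∀ a₁ a₂ : ℝ, a₁ ≤ a₂ → volume (cX K (Set.Ioc a₁ a₂) b c) =
      ENNReal.ofReal (V * (Real.exp a₂ ^ (Module.finrank ℚ K) - Real.exp a₁ ^ (Module.finrank ℚ K))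
        * (c - b) ^ r)) := by
  have hn0 : 0 < Module.finrank ℚ K := Module.finrank_pos
  have hnR : (0:ℝ) < Module.finrank ℚ K := by exact_mod_cast hn0
  have e0 : ∀ a : ℝ, Real.exp a ^ (Module.finrank ℚ K) = Real.exp (Module.finrank ℚ K * a) :=
    fun a => by rw [Real.exp_nat_mul]
  refine ⟨2 ^ nrRealPlaces K * (2 * Real.pi) ^ nrComplexPlaces K *
    ((2 : ℝ)⁻¹ ^ nrComplexPlaces K * regulator K), ?_,
    (Finset.univ.erase (w₀ : InfinitePlace K)).card, fun b c hbc => ⟨fun a₂ => ?_, fun a₁ a₂ h12 => ?_⟩⟩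
  · have := regulator_pos K
    positivity
  · refine volume_cX_aux measurableSet_Iic hbc (by positivity) ?_
    simp_rw [mul_comm _ (Module.finrank ℚ K : ℝ)]
    rw [← ofReal_integral_eq_lintegral_ofReal (integrableOn_exp_mul_Iic hnR _)
        (ae_of_all _ fun _ => (Real.exp_pos _).le), integral_exp_mul_Iic hnR, e0]
  · refine volume_cX_aux measurableSet_Ioc hbc ?_ ?_
    · have : Real.exp a₁ ^ Module.finrank ℚ K ≤ Real.exp a₂ ^ Module.finrank ℚ K := by gcongr
      linarith
    simp_rw [mul_comm _ (Module.finrank ℚ K : ℝ)]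
    rw [← ofReal_integral_eq_lintegral_ofReal ((integrableOn_exp_mul_Iic hnR a₂).mono_set
        (fun x hx => hx.2))
        (ae_of_all _ fun _ => (Real.exp_pos _).le), ← intervalIntegral.integral_of_le h12,
        integral_exp_mul_aux hnR.ne', e0, e0]

end GeomPart1

section GeomPart2
open MeasureTheory NumberField.mixedEmbedding NumberField.mixedEmbedding.fundamentalCone
  NumberField.InfinitePlace NumberField.Units NumberField.Units.dirichletUnitTheorem
open scoped nonZeroDivisors Pointwise

lemma lattice_upper {E : Type*} [NormedAddCommGroup E] [NormedSpace ℝ E] [MeasurableSpace E]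
    [BorelSpace E] (μ : Measure E) [μ.IsAddHaarMeasure] (L : Submodule ℤ E) {D : Set E}
    (hD : IsAddFundamentalDomain L D μ) (F : Finset L) (A : Set E)
    (h : ∀ g ∈ F, ∀ d ∈ D, (g : E) + d ∈ A) : (F.card : ENNReal) * μ D ≤ μ A := by
  have : VAddInvariantMeasure L E μ := ⟨fun g s _ => measure_preimage_add μ (g : E) s⟩
  have h1 : μ (⋃ g ∈ F, g +ᵥ D) = ∑ g ∈ F, μ (g +ᵥ D) := by
    apply measure_biUnion_finset₀
    · intro a _ b _ hab
      exact hD.aedisjoint hab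
    · intro b _
      exact hD.nullMeasurableSet_vadd b
  have h2 : ∀ g : L, μ (g +ᵥ D) = μ D := fun g => measure_vadd μ g D
  simp only [h2, Finset.sum_const, nsmul_eq_mul] at h1
  rw [← h1]
  apply measure_mono
  intro x hx
  simp only [Set.mem_iUnion] at hx
  obtain ⟨g, hg, d, hd, rfl⟩ := hx
  exact h g hg d hd

lemma lattice_lower {E : Type*} [NormedAddCommGroup E] [NormedSpace ℝ E] [MeasurableSpace E]
    [BorelSpace E] (μ : Measure E) [μ.IsAddHaarMeasure] (L : Submodule ℤ E) {D : Set E}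
    (hD : IsAddFundamentalDomain L D μ) (F : Finset L) (A : Set E)
    (h : ∀ g : L, ∀ d ∈ D, (g : E) + d ∈ A → g ∈ F) : μ A ≤ (F.card : ENNReal) * μ D := by
  have : VAddInvariantMeasure L E μ := ⟨fun g s _ => measure_preimage_add μ (g : E) s⟩
  have h2 : ∀ g : L, μ (g +ᵥ D) = μ D := fun g => measure_vadd μ g D
  have h1 : μ (⋃ g ∈ F, g +ᵥ D) ≤ ∑ g ∈ F, μ (g +ᵥ D) := measure_biUnion_finset_le _ _
  simp only [h2, Finset.sum_const, nsmul_eq_mul] at h1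
  refine le_trans (measure_mono_ae ?_) h1
  filter_upwards [hD.ae_covers] with x hx hxA
  obtain ⟨g, hg⟩ := hx
  have e : ((-g : L) : E) + (g +ᵥ x) = x := by
    change ((-g : L) : E) + ((g : E) + x) = x
    simp
  have : (-g) ∈ F := h (-g) (g +ᵥ x) hg (by rw [e]; exact hxA)
  change x ∈ ⋃ g ∈ F, g +ᵥ D
  simp only [Set.mem_iUnion]
  exact ⟨-g, this, g +ᵥ x, hg, e⟩

variable {K : Type*} [Field K] [NumberField K]

lemma normAtPlace_le_norm (w : InfinitePlace K) (x : mixedSpace K) : normAtPlace w x ≤ ‖x‖ := by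
  rw [norm_eq_sup'_normAtPlace]
  exact Finset.le_sup' (fun w => normAtPlace w x) (Finset.mem_univ w)

lemma abs_normAtPlace_sub (w : InfinitePlace K) (x y : mixedSpace K) :
    |normAtPlace w x - normAtPlace w y| ≤ ‖x - y‖ := by
  have h1 := normAtPlace_add_le w (x - y) y
  have h2 := normAtPlace_add_le w (y - x) x
  have h3 := normAtPlace_le_norm w (x - y)
  have h4 := normAtPlace_le_norm w (y - x)
  rw [norm_sub_rev] at h4
  simp only [sub_add_cancel] at h1 h2
  rw [abs_le]; constructor <;> linarith

lemma expMapBasis_lower : ∃ c : ℝ, 0 < c ∧ ∀ p : realSpace K,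
    (∀ w, w ≠ w₀ → p w ∈ Set.Icc (-1:ℝ) 2) → ∀ w, c * Real.exp (p w₀) ≤ expMapBasis p w := by
  have hc : IsCompact (Set.univ.pi fun _ : InfinitePlace K => Set.Icc (-1:ℝ) 2) :=
    isCompact_univ_pi fun _ => isCompact_Icc
  have hex : ∀ w : InfinitePlace K, ∃ c : ℝ, 0 < c ∧
      ∀ p ∈ (Set.univ.pi fun _ : InfinitePlace K => Set.Icc (-1:ℝ) 2), c ≤ expMapBasis p w := by
    intro w
    obtain ⟨p, hp, hmin⟩ := hc.exists_isMinOn (f := fun p : realSpace K => expMapBasis p w)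
      ⟨fun _ => 0, Set.mem_univ_pi.mpr fun _ => by simp⟩
      (((continuous_apply w).comp (continuous_expMapBasis K)).continuousOn)
    exact ⟨expMapBasis p w, expMapBasis_pos p w, fun q hq => hmin hq⟩
  choose c hc0 hc1 using hex
  obtain ⟨w1, hw1⟩ := Finite.exists_min c
  refine ⟨c w1, hc0 w1, fun p hp w => ?_⟩
  rw [expMapBasis_apply'' p, Pi.smul_apply, smul_eq_mul, mul_comm]
  gcongr
  refine (hw1 w).trans (hc1 w _ ?_)
  rw [Set.mem_univ_pi]
  intro i
  split_ifs with h
  · simp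
  · exact hp i h

lemma abs_log_sub_le {a b ρ : ℝ} (hb : 0 < b) (h : |a - b| ≤ ρ) (h2 : 2 * ρ ≤ b) :
    0 < a ∧ |Real.log a - Real.log b| ≤ 2 * ρ / b := by
  have ⟨h3, h4⟩ := abs_le.mp h
  have ha : b / 2 ≤ a := by linarith
  have ha0 : 0 < a := by linarith
  have hρ : 0 ≤ ρ := (abs_nonneg _).trans h
  refine ⟨ha0, ?_⟩
  rw [abs_le]
  constructor
  · have := Real.log_le_sub_one_of_pos (div_pos hb ha0)
    rw [Real.log_div hb.ne' ha0.ne'] at this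
    have h5 : b / a - 1 ≤ 2 * ρ / b := by
      rw [div_sub_one ha0.ne', div_le_div_iff₀ ha0 hb]
      nlinarith
    linarith
  · have := Real.log_le_sub_one_of_pos (div_pos ha0 hb)
    rw [Real.log_div ha0.ne' hb.ne'] at this
    have h5 : a / b - 1 ≤ 2 * ρ / b := by
      rw [div_sub_one hb.ne']; gcongr; linarith
    linarith

lemma perturb (ρ : ℝ) (hρ : 0 < ρ) : ∃ M : ℝ, 0 < M ∧ ∀ p : realSpace K,
    (∀ w, w ≠ w₀ → p w ∈ Set.Icc (-1:ℝ) 2) → M ≤ Real.exp (p w₀) → ∀ x y : mixedSpace K,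
    normAtAllPlaces y = expMapBasis p → ‖x - y‖ ≤ ρ →
    ∃ p' : realSpace K, normAtAllPlaces x = expMapBasis p' ∧
      ∀ w, |p' w - p w| ≤ M * Real.exp (-(p w₀)) := by
  obtain ⟨c, hc, hlow⟩ := expMapBasis_lower (K := K)
  set Lm : realSpace K →L[ℝ] realSpace K :=
    LinearMap.toContinuousLinearMap ((completeBasis K).equivFun : realSpace K →ₗ[ℝ] _) with hLm
  set A := ‖Lm‖ with hA
  have hA0 : 0 ≤ A := norm_nonneg _
  refine ⟨2 * ρ / c + A * (2 * (2 * ρ / c)), by positivity, ?_⟩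
  intro p hp hM x y hy hxy
  have hE := Real.exp_pos (p w₀)
  have hρc : 2 * ρ / c ≤ Real.exp (p w₀) := by
    have : 0 ≤ A * (2 * (2 * ρ / c)) := by positivity
    linarith
  have hρc' : 2 * ρ ≤ c * Real.exp (p w₀) := by rwa [div_le_iff₀' hc] at hρc
  have hyw : ∀ w, normAtPlace w y = expMapBasis p w := fun w => by
    rw [← hy, normAtAllPlaces_apply]
  have key : ∀ w, 0 < normAtPlace w x ∧
      |Real.log (normAtPlace w x) - Real.log (normAtPlace w y)| ≤
        2 * ρ / c * Real.exp (-(p w₀)) := by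
    intro w
    have h1 : c * Real.exp (p w₀) ≤ normAtPlace w y := by rw [hyw]; exact hlow p hp w
    have h0 : 0 < normAtPlace w y := lt_of_lt_of_le (by positivity) h1
    obtain ⟨h2, h3⟩ := abs_log_sub_le h0 ((abs_normAtPlace_sub w x y).trans hxy) (hρc'.trans h1)
    refine ⟨h2, h3.trans ?_⟩
    rw [Real.exp_neg, ← div_eq_mul_inv, div_div]
    gcongr
  obtain ⟨p', hp'⟩ := exists_param (fun w => (key w).1)
  refine ⟨p', hp', ?_⟩
  have inv : ∀ q : realSpace K, q = Lm (expMap.symm (expMapBasis q)) := by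
    intro q
    rw [expMapBasis_apply, expMap.left_inv (by rw [expMap_source]; exact Set.mem_univ _)]
    exact (LinearEquiv.apply_symm_apply _ _).symm
  have hdiff : p' - p = Lm (expMap.symm (normAtAllPlaces x) - expMap.symm (normAtAllPlaces y)) := by
    rw [map_sub, hp', hy, ← inv, ← inv]
  have hnorm : ‖expMap.symm (normAtAllPlaces x) - expMap.symm (normAtAllPlaces y)‖ ≤
      2 * (2 * ρ / c * Real.exp (-(p w₀))) := by
    rw [pi_norm_le_iff_of_nonneg (by positivity)]
    intro w
    rw [Pi.sub_apply, expMap_symm_apply, expMap_symm_apply, normAtAllPlaces_apply,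
      normAtAllPlaces_apply, ← mul_sub, Real.norm_eq_abs, abs_mul]
    have hm : |(w.mult : ℝ)| ≤ 2 := by
      rw [abs_of_nonneg (by positivity)]
      unfold InfinitePlace.mult
      split_ifs <;> norm_num
    gcongr
    exact (key w).2
  intro w
  have h5 : |p' w - p w| ≤ ‖p' - p‖ := by
    have := norm_le_pi_norm (p' - p) w
    simpa using this
  refine h5.trans ?_
  rw [hdiff]
  refine (Lm.le_opNorm _).trans ?_
  rw [← hA]
  calc A * _ ≤ A * (2 * (2 * ρ / c * Real.exp (-(p w₀)))) := by gcongr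
    _ ≤ _ := by
      have : 0 ≤ 2 * ρ / c * Real.exp (-(p w₀)) := by positivity
      linarith
end GeomPart2

section GeomPart3
open MeasureTheory NumberField.mixedEmbedding NumberField.mixedEmbedding.fundamentalCone
  NumberField.InfinitePlace NumberField.Units NumberField.Units.dirichletUnitTheorem
open scoped nonZeroDivisors Pointwise
variable {K : Type*} [Field K] [NumberField K]

lemma bounded_cone (T : ℝ) : Bornology.IsBounded
    {x : mixedSpace K | x ∈ fundamentalCone K ∧
      mixedEmbedding.norm x ≤ Real.exp T ^ Module.finrank ℚ K} := by
  refine ((isBounded_normLeOne K).smul₀ (Real.exp T)).subset ?_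
  intro x hx
  rw [Set.mem_smul_set_iff_inv_smul_mem₀ (Real.exp_pos T).ne', mem_normLeOne]
  refine ⟨(smul_mem_iff_mem (inv_ne_zero (Real.exp_pos T).ne')).mpr hx.1, ?_⟩
  rw [mixedEmbedding.norm_smul, abs_of_pos (inv_pos.mpr (Real.exp_pos T)), inv_pow,
    inv_mul_le_iff₀ (by positivity), mul_one]
  exact hx.2

lemma finite_cone_lattice (J : (Ideal (𝓞 K))⁰) (T : ℝ) :
    {g : idealLattice K (FractionalIdeal.mk0 K J) | (g : mixedSpace K) ∈ fundamentalCone K ∧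
      mixedEmbedding.norm (g : mixedSpace K) ≤ Real.exp T ^ Module.finrank ℚ K}.Finite := by
  have hdis : IsDiscrete ((idealLattice K (FractionalIdeal.mk0 K J) : Submodule ℤ (mixedSpace K)) :
      Set (mixedSpace K)) := ⟨inferInstanceAs
        (DiscreteTopology (idealLattice K (FractionalIdeal.mk0 K J)))⟩
  have hclosed : IsClosed ((idealLattice K (FractionalIdeal.mk0 K J) :
      Submodule ℤ (mixedSpace K)) : Set (mixedSpace K)) := by
    have : DiscreteTopology ((idealLattice K (FractionalIdeal.mk0 K J)).toAddSubgroup) :=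
      inferInstanceAs (DiscreteTopology (idealLattice K (FractionalIdeal.mk0 K J)))
    exact AddSubgroup.isClosed_of_discrete
      (H := (idealLattice K (FractionalIdeal.mk0 K J)).toAddSubgroup)
  have := Metric.finite_isBounded_inter_isClosed hdis (bounded_cone (K := K) T) hclosed
  refine Set.Finite.of_finite_image (f := Subtype.val) (this.subset ?_) Subtype.val_injective.injOn
  rintro _ ⟨g, hg, rfl⟩
  exact ⟨hg, g.2⟩

lemma pow_exp_log {s : ℝ} (hs : 0 < s) (n : ℕ) (hn : 0 < n) :
    Real.exp (Real.log s / n) ^ n = s := by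
  rw [← Real.exp_nat_mul, mul_div_cancel₀ _ (by positivity), Real.exp_log hs]

/-- the finset of lattice points in the cone with norm at most `exp T ^ n`. -/
noncomputable def conePts (J : (Ideal (𝓞 K))⁰) (T : ℝ) :
    Finset (idealLattice K (FractionalIdeal.mk0 K J)) := (finite_cone_lattice J T).toFinset

lemma mem_conePts {J : (Ideal (𝓞 K))⁰} {T : ℝ} {g : idealLattice K (FractionalIdeal.mk0 K J)} :
    g ∈ conePts J T ↔ (g : mixedSpace K) ∈ fundamentalCone K ∧
      mixedEmbedding.norm (g : mixedSpace K) ≤ Real.exp T ^ Module.finrank ℚ K := by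
  simp [conePts]

lemma card_conePts (J : (Ideal (𝓞 K))⁰) (T : ℝ) :
    Nat.card {a : idealSet K J // mixedEmbedding.norm (a : mixedSpace K) ≤
      Real.exp T ^ Module.finrank ℚ K} = (conePts J T).card := by
  have e : {a : idealSet K J // mixedEmbedding.norm (a : mixedSpace K) ≤
      Real.exp T ^ Module.finrank ℚ K} ≃ {g // g ∈ conePts J T} :=
    { toFun := fun a => ⟨⟨a.1.1, a.1.2.2⟩, mem_conePts.mpr ⟨a.1.2.1, a.2⟩⟩
      invFun := fun g => ⟨⟨g.1.1, (mem_conePts.mp g.2).1, g.1.2⟩, (mem_conePts.mp g.2).2⟩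
      left_inv := fun _ => rfl
      right_inv := fun _ => rfl }
  exact (Nat.card_congr e).trans (Nat.card_eq_fintype_card.trans (Fintype.card_coe _))

lemma mem_conePts_of {J : (Ideal (𝓞 K))⁰} {T : ℝ} {g : idealLattice K (FractionalIdeal.mk0 K J)}
    {p : realSpace K} (hp : normAtAllPlaces (g : mixedSpace K) = expMapBasis p) (h0 : p w₀ ≤ T)
    (h : ∀ w, w ≠ w₀ → p w ∈ Set.Ico (0:ℝ) 1) : g ∈ conePts J T := by
  rw [mem_conePts]
  refine ⟨cone_iff.mpr ⟨p, hp, h⟩, ?_⟩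
  rw [cX_norm hp]
  gcongr

lemma exp_pow_le_imp {a b : ℝ} {n : ℕ} (hn : n ≠ 0) (h : Real.exp a ^ n ≤ Real.exp b ^ n) : a ≤ b := by
  have := le_of_pow_le_pow_left₀ hn (Real.exp_pos b).le h
  exact Real.exp_le_exp.mp this

/-- Two-sided volume estimates for lattice points. -/
lemma conePts_volume (J : (Ideal (𝓞 K))⁰) : ∃ V v M : ℝ, 0 < V ∧ 0 < v ∧ 0 < M ∧ ∃ r : ℕ,
    ∀ T : ℝ, M * Real.exp (-(T/2)) ≤ 1/4 →
      ((conePts J T).card - (conePts J (T/2)).card : ℝ) * v ≤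
        V * Real.exp (T + M * Real.exp (-(T/2))) ^ Module.finrank ℚ K *
          (1 + 2 * (M * Real.exp (-(T/2)))) ^ r ∧
      V * (Real.exp (T - M * Real.exp (-(T/2))) ^ Module.finrank ℚ K -
        Real.exp (T/2) ^ Module.finrank ℚ K) * (1 - 2 * (M * Real.exp (-(T/2)))) ^ r ≤
        (conePts J T).card * v := by
  obtain ⟨V, hV, r, hvol⟩ := volume_cX_explicit (K := K)
  set L := idealLattice K (FractionalIdeal.mk0 K J) with hL
  set D := ZSpan.fundamentalDomain (fractionalIdealLatticeBasis K (FractionalIdeal.mk0 K J)) with hDdef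
  have hD : IsAddFundamentalDomain L D volume :=
    fundamentalDomain_idealLattice K (FractionalIdeal.mk0 K J)
  have hDb : Bornology.IsBounded D := ZSpan.fundamentalDomain_isBounded _
  obtain ⟨ρ, hρ, hDρ⟩ := hDb.exists_pos_norm_le
  obtain ⟨M, hM, hpert⟩ := perturb (K := K) ρ hρ
  have hvD : volume D ≠ 0 := ZSpan.measure_fundamentalDomain_ne_zero _
  have hvD' : volume D ≠ ⊤ := hDb.measure_lt_top.ne
  have hn0 : Module.finrank ℚ K ≠ 0 := Module.finrank_pos.ne'
  refine ⟨V, (volume D).toReal, M, hV, ENNReal.toReal_pos hvD hvD', hM, r, fun T hη => ?_⟩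
  set η := M * Real.exp (-(T/2)) with hηdef
  have hη0 : 0 < η := by positivity
  have hMT : M ≤ Real.exp (T/2) := by
    have : M * Real.exp (-(T/2)) * Real.exp (T/2) = M := by
      rw [mul_assoc, ← Real.exp_add]; simp
    have h2 := Real.exp_pos (T/2)
    nlinarith
  have hmono : ∀ a, T/2 ≤ a → M * Real.exp (-a) ≤ η := fun a ha => by
    rw [hηdef]; gcongr
  have hmono2 : ∀ a, T/2 ≤ a → M ≤ Real.exp a := fun a ha =>
    hMT.trans (Real.exp_le_exp.mpr ha)
  constructor
  · have hup := lattice_upper (volume : Measure (mixedSpace K)) L hD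
      (conePts J T \ conePts J (T/2)) (cX K (Set.Iic (T + η)) (-η) (1 + η)) (by
        intro g hg d hd
        rw [Finset.mem_sdiff] at hg
        obtain ⟨hg1, hg2⟩ := hg
        rw [mem_conePts] at hg1
        obtain ⟨p, hp, hpI⟩ := cone_iff.mp hg1.1
        have hpT : p w₀ ≤ T := by
          have := hg1.2
          rw [cX_norm hp] at this
          exact exp_pow_le_imp hn0 this
        have hpT2 : T/2 ≤ p w₀ := by
          by_contra hcon
          exact hg2 (mem_conePts_of hp (by linarith) hpI)
        obtain ⟨p', hp', hclose⟩ := hpert p (fun w hw => by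
            have := hpI w hw; exact ⟨by linarith [this.1], by linarith [this.2]⟩)
          (hmono2 _ hpT2) ((g : mixedSpace K) + d) g hp (by simpa using hDρ d hd)
        have hcl : ∀ w, |p' w - p w| ≤ η := fun w => (hclose w).trans (hmono _ hpT2)
        rw [mem_cX]
        refine ⟨p', hp', ?_, fun w hw => ?_⟩
        · have := (abs_le.mp (hcl w₀)).2
          exact Set.mem_Iic.mpr (by linarith)
        · have h1 := abs_le.mp (hcl w)
          have h2 := hpI w hw
          exact ⟨by linarith [h2.1], by linarith [h2.2]⟩)
    rw [(hvol (-η) (1 + η) (by linarith)).1] at hup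
    have h3 := ENNReal.toReal_mono ENNReal.ofReal_ne_top hup
    rw [ENNReal.toReal_mul, ENNReal.toReal_natCast, ENNReal.toReal_ofReal (by
      have : 0 ≤ 1 + η - -η := by linarith
      positivity)] at h3
    have hcard : ((conePts J T).card - (conePts J (T/2)).card : ℝ) ≤
        ((conePts J T \ conePts J (T/2)).card : ℝ) := by
      have := Finset.le_card_sdiff (conePts J (T/2)) (conePts J T)
      have h' : (conePts J T).card ≤ (conePts J T \ conePts J (T/2)).card + (conePts J (T/2)).card := by
        omega
      have h'' : ((conePts J T).card : ℝ) ≤ (conePts J T \ conePts J (T/2)).card + (conePts J (T/2)).card := by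
        exact_mod_cast h'
      linarith
    calc _ ≤ ((conePts J T \ conePts J (T/2)).card : ℝ) * (volume D).toReal := by gcongr
      _ ≤ _ := h3
      _ = _ := by ring
  · by_cases hT : T/2 ≤ T - η
    swap
    · have h1 : Real.exp (T - η) ^ Module.finrank ℚ K ≤ Real.exp (T/2) ^ Module.finrank ℚ K := by
        gcongr; linarith
      have h2 : 0 ≤ (1 - 2 * η) ^ r := pow_nonneg (by linarith) _
      have h3 : V * (Real.exp (T - η) ^ Module.finrank ℚ K - Real.exp (T/2) ^ Module.finrank ℚ K) ≤ 0 :=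
        mul_nonpos_of_nonneg_of_nonpos hV.le (by linarith)
      have h4 : V * (Real.exp (T - η) ^ Module.finrank ℚ K - Real.exp (T/2) ^ Module.finrank ℚ K) *
        (1 - 2 * η) ^ r ≤ 0 := mul_nonpos_of_nonpos_of_nonneg h3 h2
      exact h4.trans (by positivity)
    have hlo := lattice_lower (volume : Measure (mixedSpace K)) L hD
      (conePts J T) (cX K (Set.Ioc (T/2) (T - η)) η (1 - η)) (by
        intro g d hd hgd
        obtain ⟨p, hp, hp0, hpI⟩ := mem_cX.mp hgd
        have hpT2 : T/2 ≤ p w₀ := hp0.1.le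
        obtain ⟨p', hp', hclose⟩ := hpert p (fun w hw => by
            have := hpI w hw; exact ⟨by linarith [this.1], by linarith [this.2]⟩)
          (hmono2 _ hpT2) g ((g : mixedSpace K) + d) hp (by simpa using hDρ d hd)
        have hcl : ∀ w, |p' w - p w| ≤ η := fun w => (hclose w).trans (hmono _ hpT2)
        refine mem_conePts_of hp' ?_ fun w hw => ?_
        · have := (abs_le.mp (hcl w₀)).2
          linarith [hp0.2]
        · have h1 := abs_le.mp (hcl w)
          have h2 := hpI w hw
          exact ⟨by linarith [h2.1], by linarith [h2.2]⟩)
    rw [(hvol η (1 - η) (by linarith)).2 _ _ hT] at hlo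
    have h3 := ENNReal.toReal_mono (ENNReal.mul_ne_top (ENNReal.natCast_ne_top _) hvD') hlo
    rw [ENNReal.toReal_mul, ENNReal.toReal_natCast, ENNReal.toReal_ofReal (by
      have h1 : Real.exp (T/2) ^ Module.finrank ℚ K ≤ Real.exp (T - η) ^ Module.finrank ℚ K := by
        gcongr
      have h2 : 0 ≤ (1 - η - η) ^ r := pow_nonneg (by linarith) _
      have : 0 ≤ Real.exp (T - η) ^ Module.finrank ℚ K - Real.exp (T/2) ^ Module.finrank ℚ K := by
        linarith
      positivity)] at h3
    calc _ = V * (Real.exp (T - η) ^ Module.finrank ℚ K - Real.exp (T/2) ^ Module.finrank ℚ K) *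
        (1 - η - η) ^ r := by ring
      _ ≤ _ := h3
end GeomPart3

section GeomPart4
open MeasureTheory NumberField.mixedEmbedding NumberField.mixedEmbedding.fundamentalCone
  NumberField.InfinitePlace NumberField.Units NumberField.Units.dirichletUnitTheorem
open scoped nonZeroDivisors Pointwise
variable {K : Type*} [Field K] [NumberField K]

lemma finite_ideals_le (s : ℝ) :
    Finite {I : (Ideal (𝓞 K))⁰ // (Ideal.absNorm (I : Ideal (𝓞 K)) : ℝ) ≤ s} := by
  have := Ideal.finite_setOfPred_absNorm_le₀ (S := 𝓞 K) ⌊s⌋₊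
  refine Set.Finite.subset this ?_
  intro I hI
  exact Nat.le_floor hI

lemma card_ideals_le_linear : ∃ C : ℝ, 0 < C ∧ ∀ s : ℝ, 1 ≤ s →
    (Nat.card {I : (Ideal (𝓞 K))⁰ // (Ideal.absNorm (I : Ideal (𝓞 K)) : ℝ) ≤ s} : ℝ) ≤ C * s := by
  obtain h := (NumberField.Ideal.tendsto_norm_le_div_atTop₀ K)
  have h2 := h.eventually (eventually_lt_nhds (lt_add_one _))
  obtain ⟨s0, hs0⟩ := Filter.eventually_atTop.mp h2
  set κ := (2 ^ nrRealPlaces K * (2 * Real.pi) ^ nrComplexPlaces K * regulator K * classNumber K) /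
            (torsionOrder K * Real.sqrt |(discr K : ℝ)|)
  set S := max s0 1
  refine ⟨|κ + 1| + Nat.card {I : (Ideal (𝓞 K))⁰ // (Ideal.absNorm (I : Ideal (𝓞 K)) : ℝ) ≤ S} + 1,
    by positivity, fun s hs => ?_⟩
  by_cases hsS : S ≤ s
  · have h3 := hs0 s ((le_max_left _ _).trans hsS)
    rw [div_lt_iff₀ (by linarith)] at h3
    refine h3.le.trans ?_
    gcongr
    have := le_abs_self (κ + 1)
    have h5 : (0:ℝ) ≤ Nat.card {I : (Ideal (𝓞 K))⁰ // (Ideal.absNorm (I : Ideal (𝓞 K)) : ℝ) ≤ S} := by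
      positivity
    linarith
  · have hmono : Nat.card {I : (Ideal (𝓞 K))⁰ // (Ideal.absNorm (I : Ideal (𝓞 K)) : ℝ) ≤ s} ≤
        Nat.card {I : (Ideal (𝓞 K))⁰ // (Ideal.absNorm (I : Ideal (𝓞 K)) : ℝ) ≤ S} := by
      have := finite_ideals_le (K := K) S
      exact Nat.card_le_card_of_injective
        (fun I : {I : (Ideal (𝓞 K))⁰ // (Ideal.absNorm (I : Ideal (𝓞 K)) : ℝ) ≤ s} =>
          (⟨I.1, I.2.trans (by linarith)⟩ :
            {I : (Ideal (𝓞 K))⁰ // (Ideal.absNorm (I : Ideal (𝓞 K)) : ℝ) ≤ S}))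
        (fun a b hab => by
          apply Subtype.ext
          have := congrArg Subtype.val hab
          exact this)
    have hm : (Nat.card {I : (Ideal (𝓞 K))⁰ // (Ideal.absNorm (I : Ideal (𝓞 K)) : ℝ) ≤ s} : ℝ) ≤
        Nat.card {I : (Ideal (𝓞 K))⁰ // (Ideal.absNorm (I : Ideal (𝓞 K)) : ℝ) ≤ S} := by
      exact_mod_cast hmono
    refine hm.trans ?_
    set Q := (Nat.card {I : (Ideal (𝓞 K))⁰ // (Ideal.absNorm (I : Ideal (𝓞 K)) : ℝ) ≤ S} : ℝ)
    have hQ : 0 ≤ Q := by positivity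
    have := abs_nonneg (κ + 1)
    nlinarith

lemma conePts_linear (J : (Ideal (𝓞 K))⁰) : ∃ C : ℝ, 0 < C ∧ ∀ T : ℝ, 0 ≤ T →
    ((conePts J T).card : ℝ) ≤ C * Real.exp T ^ Module.finrank ℚ K := by
  obtain ⟨C, hC, h⟩ := card_ideals_le_linear (K := K)
  have htor : 0 < torsionOrder K := Nat.pos_of_ne_zero (torsionOrder_ne_zero K)
  refine ⟨C * torsionOrder K, by positivity, fun T hT => ?_⟩
  have h1 : 1 ≤ Real.exp T ^ Module.finrank ℚ K := one_le_pow₀ (Real.one_le_exp hT)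
  rw [← card_conePts, ← card_isPrincipal_dvd_norm_le, Nat.cast_mul]
  have h2 : Nat.card {I : (Ideal (𝓞 K))⁰ // (J : Ideal (𝓞 K)) ∣ I ∧
      Submodule.IsPrincipal (I : Ideal (𝓞 K)) ∧
      (Ideal.absNorm (I : Ideal (𝓞 K)) : ℝ) ≤ Real.exp T ^ Module.finrank ℚ K} ≤
      Nat.card {I : (Ideal (𝓞 K))⁰ // (Ideal.absNorm (I : Ideal (𝓞 K)) : ℝ) ≤
        Real.exp T ^ Module.finrank ℚ K} := by
    have := finite_ideals_le (K := K) (Real.exp T ^ Module.finrank ℚ K)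
    exact Nat.card_le_card_of_injective
        (fun I : {I : (Ideal (𝓞 K))⁰ // (J : Ideal (𝓞 K)) ∣ I ∧
      Submodule.IsPrincipal (I : Ideal (𝓞 K)) ∧
      (Ideal.absNorm (I : Ideal (𝓞 K)) : ℝ) ≤ Real.exp T ^ Module.finrank ℚ K} =>
          (⟨I.1, I.2.2.2⟩ :
            {I : (Ideal (𝓞 K))⁰ // (Ideal.absNorm (I : Ideal (𝓞 K)) : ℝ) ≤
              Real.exp T ^ Module.finrank ℚ K}))
        (fun a b hab => by
          apply Subtype.ext
          have := congrArg Subtype.val hab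
          exact this)
  have h3 := h _ h1
  calc _ ≤ (C * Real.exp T ^ Module.finrank ℚ K) * (torsionOrder K : ℝ) := by
        gcongr
        refine le_trans ?_ h3
        exact_mod_cast h2
    _ = _ := by ring

set_option maxHeartbeats 800000 in
lemma conePts_asymp (J : (Ideal (𝓞 K))⁰) : ∃ κ C : ℝ, 0 < κ ∧ 0 < C ∧ ∀ T : ℝ, 0 ≤ T →
    |((conePts J T).card : ℝ) - κ * Real.exp T ^ Module.finrank ℚ K| ≤
      C * (Real.exp T ^ Module.finrank ℚ K * Real.exp (-(T/2))) := by
  obtain ⟨V, v, M, hV, hv, hM, r, hvol⟩ := conePts_volume J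
  obtain ⟨C1, hC1, hlin⟩ := conePts_linear J
  set n := Module.finrank ℚ K with hn
  have hn1 : 1 ≤ n := Module.finrank_pos
  set q : ℝ := n + 2 * r with hq
  have hq0 : 0 < q := by
    have : (1:ℝ) ≤ n := by exact_mod_cast hn1
    positivity
  refine ⟨V / v, (C1 + V / v) * (4 * M) + C1 + V / v * (q * Real.exp q * M) + V / v,
    by positivity, by positivity, fun T hT => ?_⟩
  set S := Real.exp T ^ n with hS
  set E := Real.exp (-(T/2)) with hE
  have hS0 : 0 < S := by positivity
  have hE0 : 0 < E := Real.exp_pos _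
  have hhalf : Real.exp (T/2) ^ n ≤ S * E := by
    rw [hS, hE, ← Real.exp_nat_mul, ← Real.exp_nat_mul, ← Real.exp_add]
    apply Real.exp_le_exp.mpr
    have : (1:ℝ) ≤ n := by exact_mod_cast hn1
    nlinarith
  have hcard0 : (0:ℝ) ≤ (conePts J T).card := by positivity
  have hVv : 0 < V / v := by positivity
  have hSE : 0 < S * E := by positivity
  have hl := hlin T hT
  have hl2 := hlin (T/2) (by linarith)
  rw [← hS] at hl
  have p1 : 0 ≤ C1 * (S * E) := by positivity
  have p2 : 0 ≤ V / v * (q * Real.exp q * M) * (S * E) := by positivity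
  have p3 : 0 ≤ V / v * (S * E) := by positivity
  have p4 : 0 ≤ (C1 + V / v) * (4 * M) * (S * E) := by positivity
  by_cases hη : M * E ≤ 1/4
  swap
  · push Not at hη
    have h4 : S ≤ 4 * M * (S * E) := by nlinarith
    have h5 : (C1 + V / v) * S ≤ (C1 + V / v) * (4 * M * (S * E)) := by gcongr
    rw [abs_le]
    constructor <;> nlinarith
  obtain ⟨hup, hlo⟩ := hvol T hη
  rw [← hE] at hup hlo
  set η := M * E with hηdef
  have hη0 : 0 < η := by positivity
  have eS : ∀ x : ℝ, Real.exp (T + x) ^ n = S * Real.exp (n * x) := fun x => by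
    rw [hS, Real.exp_add, mul_pow, Real.exp_nat_mul x]
  rw [eS] at hup
  rw [sub_eq_add_neg T, eS] at hlo
  -- upper
  have hexp : Real.exp (n * η) * (1 + 2 * η) ^ r ≤ 1 + q * Real.exp q * η := by
    have h1 : (1 + 2 * η) ^ r ≤ Real.exp (r * (2 * η)) := by
      rw [Real.exp_nat_mul]
      gcongr
      linarith [Real.add_one_le_exp (2 * η)]
    have h2 : Real.exp (n * η) * (1 + 2 * η) ^ r ≤ Real.exp (q * η) := by
      calc _ ≤ Real.exp (n * η) * Real.exp (r * (2 * η)) := by gcongr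
        _ = _ := by rw [← Real.exp_add, hq]; ring_nf
    have h3 : Real.exp (q * η) ≤ 1 + q * η * Real.exp (q * η) := by
      have h4 := Real.add_one_le_exp (-(q * η))
      rw [Real.exp_neg] at h4
      have h5 := Real.exp_pos (q * η)
      have h6 := mul_le_mul_of_nonneg_right h4 h5.le
      rw [inv_mul_cancel₀ h5.ne'] at h6
      linarith
    have h4 : Real.exp (q * η) ≤ Real.exp q := Real.exp_le_exp.mpr (by nlinarith)
    calc _ ≤ _ := h2
      _ ≤ _ := h3
      _ ≤ 1 + q * η * Real.exp q := by gcongr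
      _ = _ := by ring
  have hupper : ((conePts J T).card : ℝ) ≤ C1 * (S * E) + V / v * (S * (1 + q * Real.exp q * η)) := by
    have h1 : ((conePts J T).card - (conePts J (T/2)).card : ℝ) * v ≤
        V * (S * (1 + q * Real.exp q * η)) := by
      refine hup.trans ?_
      calc _ = V * (S * (Real.exp (n * η) * (1 + 2 * η) ^ r)) := by ring
        _ ≤ _ := by gcongr
    rw [← le_div_iff₀ hv] at h1
    have h2 : ((conePts J (T/2)).card : ℝ) ≤ C1 * (S * E) := by
      refine hl2.trans ?_; gcongr
    have h3 : V * (S * (1 + q * Real.exp q * η)) / v = V / v * (S * (1 + q * Real.exp q * η)) := by ring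
    linarith
  have hlower : V / v * (S * (1 - q * η)) - V / v * (S * E) ≤ ((conePts J T).card : ℝ) := by
    have a1 : 1 - n * η ≤ Real.exp (n * -η) := by
      have := Real.add_one_le_exp ((n:ℝ) * -η); linarith
    have a2 : Real.exp (n * -η) ≤ 1 := Real.exp_le_one_iff.mpr (by
      have : (0:ℝ) ≤ n := by positivity
      nlinarith)
    have b1 : 1 - r * (2 * η) ≤ (1 - 2 * η) ^ r := by
      have := one_add_mul_le_pow (a := -(2 * η)) (by linarith) r
      calc _ = 1 + r * -(2 * η) := by ring
        _ ≤ _ := this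
        _ = _ := by ring
    have b2 : (1 - 2 * η) ^ r ≤ 1 := pow_le_one₀ (by linarith) (by linarith)
    have b3 : 0 ≤ (1 - 2 * η) ^ r := pow_nonneg (by linarith) _
    have ab : 1 - q * η ≤ Real.exp (n * -η) * (1 - 2 * η) ^ r := by
      have m := mul_nonneg (sub_nonneg.mpr a2) (sub_nonneg.mpr b2)
      rw [hq]; linarith
    have h1 : V * (S * (1 - q * η)) - V * (S * E) ≤ ((conePts J T).card : ℝ) * v := by
      refine le_trans ?_ hlo
      have c1 : S * (1 - q * η) ≤ S * (Real.exp (n * -η) * (1 - 2 * η) ^ r) := by gcongr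
      have c2 : Real.exp (T/2) ^ n * (1 - 2 * η) ^ r ≤ S * E := by
        calc _ ≤ Real.exp (T/2) ^ n * 1 := by gcongr
          _ ≤ _ := by linarith
      have c3 := mul_le_mul_of_nonneg_left c1 hV.le
      have c4 := mul_le_mul_of_nonneg_left c2 hV.le
      linarith
    rw [← div_le_iff₀ hv] at h1
    have : (V * (S * (1 - q * η)) - V * (S * E)) / v = V / v * (S * (1 - q * η)) - V / v * (S * E) := by
      ring
    linarith
  have heq : S * η = M * (S * E) := by rw [hηdef]; ring
  have hq1 : q ≤ q * Real.exp q := le_mul_of_one_le_right hq0.le (Real.one_le_exp hq0.le)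
  have u1 : V / v * (S * (1 + q * Real.exp q * η)) =
      V / v * S + V / v * (q * Real.exp q * M) * (S * E) := by
    rw [hηdef]; ring
  have u2 : V / v * (S * (1 - q * η)) ≥ V / v * S - V / v * (q * Real.exp q * M) * (S * E) := by
    have : V / v * (S * (1 - q * η)) = V / v * S - V / v * (q * M) * (S * E) := by
      rw [hηdef]; ring
    rw [this]
    have : V / v * (q * M) * (S * E) ≤ V / v * (q * Real.exp q * M) * (S * E) := by gcongr
    linarith
  rw [abs_le]
  constructor <;> linarith
end GeomPart4

section GeomPart5
open MeasureTheory NumberField.mixedEmbedding NumberField.mixedEmbedding.fundamentalCone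
  NumberField.InfinitePlace NumberField.Units NumberField.Units.dirichletUnitTheorem
open scoped nonZeroDivisors Pointwise
variable {K : Type*} [Field K] [NumberField K]

lemma card_class_aux {C : ClassGroup (𝓞 K)} {J : (Ideal (𝓞 K))⁰} (s : ℝ)
    (hJ : ClassGroup.mk0 J = C⁻¹) :
    Nat.card {I : (Ideal (𝓞 K))⁰ // (Ideal.absNorm (I : Ideal (𝓞 K)) : ℝ) ≤ s ∧
        ClassGroup.mk0 I = C}
      = Nat.card {I : (Ideal (𝓞 K))⁰ // (J : Ideal (𝓞 K)) ∣ I ∧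
        Submodule.IsPrincipal (I : Ideal (𝓞 K)) ∧
        (Ideal.absNorm (I : Ideal (𝓞 K)) : ℝ) ≤ s * Ideal.absNorm (J : Ideal (𝓞 K))} := by
  simp_rw [← nonZeroDivisors_dvd_iff_dvd_coe]
  refine Nat.card_congr ?_
  refine ((Equiv.dvd J).subtypeEquiv fun I ↦ ?_).trans
    (Equiv.subtypeSubtypeEquivSubtypeInter (fun I : (Ideal (𝓞 K))⁰ ↦ J ∣ I) _)
  rw [← ClassGroup.mk0_eq_one_iff (SetLike.coe_mem _)]
  simp_rw [Equiv.dvd_apply, Submonoid.coe_mul, ← Submonoid.mul_def, _root_.map_mul, hJ,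
    inv_mul_eq_one, Nat.cast_mul, mul_comm s, eq_comm, and_comm, and_congr_left_iff]
  exact fun _ ↦
    (mul_le_mul_iff_of_pos_left (Nat.cast_pos.mpr (Ideal.absNorm_pos_of_nonZeroDivisors J))).symm

lemma card_class_asymp (C : ClassGroup (𝓞 K)) : ∃ κ C0 : ℝ, 0 < κ ∧ 0 < C0 ∧ ∀ s : ℝ, 1 ≤ s →
    |(Nat.card {I : (Ideal (𝓞 K))⁰ // (Ideal.absNorm (I : Ideal (𝓞 K)) : ℝ) ≤ s ∧
        ClassGroup.mk0 I = C} : ℝ) - κ * s| ≤ C0 * s ^ (1 - 1 / (2 * (Module.finrank ℚ K : ℝ))) := by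
  obtain ⟨J, hJ⟩ := ClassGroup.mk0_surjective C⁻¹
  obtain ⟨κ, C0, hκ, hC0, h⟩ := conePts_asymp J
  have htor : (0:ℝ) < torsionOrder K := by
    exact_mod_cast Nat.pos_of_ne_zero (torsionOrder_ne_zero K)
  have hJ1 : (1:ℝ) ≤ Ideal.absNorm (J : Ideal (𝓞 K)) := by
    exact_mod_cast Ideal.absNorm_pos_of_nonZeroDivisors J
  set j : ℝ := (Ideal.absNorm (J : Ideal (𝓞 K)) : ℝ) with hj
  have hn : 0 < Module.finrank ℚ K := Module.finrank_pos
  set n := Module.finrank ℚ K with hndef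
  have hnR : (0:ℝ) < n := by exact_mod_cast hn
  refine ⟨κ * j / torsionOrder K, C0 * j ^ (1 - 1 / (2 * (n : ℝ))) / torsionOrder K,
    by positivity, by positivity, fun s hs => ?_⟩
  have hsj : 1 ≤ s * j := one_le_mul_of_one_le_of_one_le hs hJ1
  have hT : 0 ≤ Real.log (s * j) / n := div_nonneg (Real.log_nonneg hsj) hnR.le
  have h1 := h _ hT
  have e1 : Real.exp (Real.log (s * j) / n) ^ n = s * j := pow_exp_log (by linarith) n hn
  have e2 := card_conePts J (Real.log (s * j) / n)
  rw [← hndef, e1] at e2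
  rw [← e2, e1, ← card_isPrincipal_dvd_norm_le, ← card_class_aux s hJ] at h1
  have e3 : s * j * Real.exp (-(Real.log (s * j) / n / 2)) =
      j ^ (1 - 1 / (2 * (n : ℝ))) * s ^ (1 - 1 / (2 * (n : ℝ))) := by
    rw [← Real.mul_rpow (by linarith) (by linarith), mul_comm j s, Real.rpow_sub (by linarith),
      Real.rpow_one, Real.rpow_def_of_pos (by linarith : 0 < s * j), Real.exp_neg, ← div_eq_mul_inv]
    congr 2
    field_simp
  rw [e3, Nat.cast_mul] at h1
  set Q : ℝ := (Nat.card {I : (Ideal (𝓞 K))⁰ // (Ideal.absNorm (I : Ideal (𝓞 K)) : ℝ) ≤ s ∧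
        ClassGroup.mk0 I = C} : ℝ)
  have e4 : Q - κ * j / torsionOrder K * s = (Q * torsionOrder K - κ * (s * j)) / torsionOrder K := by
    field_simp
  rw [e4, abs_div, abs_of_pos htor, div_le_iff₀ htor]
  refine h1.trans (le_of_eq ?_)
  field_simp

theorem card_ideals_asymp : ∃ κ C0 : ℝ, 0 < κ ∧ 0 < C0 ∧ ∀ s : ℝ, 1 ≤ s →
    |(Nat.card {I : (Ideal (𝓞 K))⁰ // (Ideal.absNorm (I : Ideal (𝓞 K)) : ℝ) ≤ s} : ℝ) - κ * s|
      ≤ C0 * s ^ (1 - 1 / (2 * (Module.finrank ℚ K : ℝ))) := by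
  choose κ C0 hκ hC0 h using card_class_asymp (K := K)
  refine ⟨∑ C, κ C, ∑ C, C0 C, Finset.sum_pos (fun C _ => hκ C) ⟨1, Finset.mem_univ _⟩,
    Finset.sum_pos (fun C _ => hC0 C) ⟨1, Finset.mem_univ _⟩, fun s hs => ?_⟩
  have hsum : (Nat.card {I : (Ideal (𝓞 K))⁰ // (Ideal.absNorm (I : Ideal (𝓞 K)) : ℝ) ≤ s} : ℝ) =
      ∑ C, (Nat.card {I : (Ideal (𝓞 K))⁰ // (Ideal.absNorm (I : Ideal (𝓞 K)) : ℝ) ≤ s ∧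
        ClassGroup.mk0 I = C} : ℝ) := by
    have := finite_ideals_le (K := K) s
    have : Fintype {I : (Ideal (𝓞 K))⁰ // (Ideal.absNorm (I : Ideal (𝓞 K)) : ℝ) ≤ s} :=
      Fintype.ofFinite _
    let e := fun C : ClassGroup (𝓞 K) ↦ Equiv.subtypeSubtypeEquivSubtypeInter
      (fun I : (Ideal (𝓞 K))⁰ ↦ (Ideal.absNorm I.1 : ℝ) ≤ s) (fun I ↦ ClassGroup.mk0 I = C)
    simp_rw [← Nat.card_congr (e _), Nat.card_eq_fintype_card, Fintype.subtype_card]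
    rw [Fintype.card, Finset.card_eq_sum_card_fiberwise (f := fun I ↦ ClassGroup.mk0 I.1)
      (t := Finset.univ) (fun _ _ ↦ Finset.mem_univ _), Nat.cast_sum]
  rw [hsum, Finset.sum_mul, ← Finset.sum_sub_distrib, Finset.sum_mul]
  exact (Finset.abs_sum_le_sum_abs _ _).trans (Finset.sum_le_sum fun C _ => h C s hs)
end GeomPart5

section IdealPart1
open UniqueFactorizationMonoid
open scoped nonZeroDivisors
variable (K : Type*) [Field K] [NumberField K]

/-- nonzero ideals of norm `n` -/
noncomputable def idn (n : ℕ) : Finset (Ideal (𝓞 K)) :=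
  if n = 0 then ∅ else (Ideal.finite_setOfPred_absNorm_eq (S := 𝓞 K) n).toFinset

/-- nonzero ideals of norm at most `x` -/
noncomputable def idle (x : ℝ) : Finset (Ideal (𝓞 K)) :=
  ((Ideal.finite_setOfPred_absNorm_le (S := 𝓞 K) ⌊x⌋₊).toFinset).filter (fun I => I ≠ ⊥)

variable {K}
lemma mem_idn {n : ℕ} {I : Ideal (𝓞 K)} : I ∈ idn K n ↔ Ideal.absNorm I = n ∧ n ≠ 0 := by
  unfold idn
  split_ifs with h <;> simp [h]

lemma mem_idle {x : ℝ} (hx : 0 ≤ x) {I : Ideal (𝓞 K)} :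
    I ∈ idle K x ↔ I ≠ ⊥ ∧ (Ideal.absNorm I : ℝ) ≤ x := by
  simp [idle, Nat.le_floor_iff hx, and_comm]

lemma absNorm_ge_one {I : Ideal (𝓞 K)} (h : I ≠ ⊥) : 1 ≤ Ideal.absNorm I :=
  Nat.one_le_iff_ne_zero.mpr (fun h0 => h (Ideal.absNorm_eq_zero_iff.mp h0))

lemma ne_bot_of_mem_idn {n : ℕ} {I : Ideal (𝓞 K)} (h : I ∈ idn K n) : I ≠ ⊥ := by
  rw [mem_idn] at h
  rintro rfl
  simp at h
  omega

lemma sum_idle {x : ℝ} (hx : 0 ≤ x) (f : Ideal (𝓞 K) → ℝ) :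
    ∑ I ∈ idle K x, f I = ∑ n ∈ Finset.Icc 1 ⌊x⌋₊, ∑ I ∈ idn K n, f I := by
  rw [← Finset.sum_fiberwise_of_maps_to (g := fun I => Ideal.absNorm I) (t := Finset.Icc 1 ⌊x⌋₊)]
  · refine Finset.sum_congr rfl fun n hn => Finset.sum_congr ?_ fun _ _ => rfl
    ext I
    rw [Finset.mem_Icc] at hn
    rw [Finset.mem_filter, mem_idle hx, mem_idn]
    constructor
    · rintro ⟨_, h⟩; exact ⟨h, by omega⟩
    · rintro ⟨rfl, h⟩
      exact ⟨⟨fun h0 => by simp [h0] at h, (Nat.le_floor_iff hx).mp hn.2⟩, rfl⟩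
  · intro I hI
    rw [mem_idle hx] at hI
    rw [Finset.mem_Icc]
    exact ⟨absNorm_ge_one hI.1, (Nat.le_floor_iff hx).mpr hI.2⟩

/-- von Mangoldt function on ideals -/
noncomputable def vm (Q : Ideal (𝓞 K)) : ℝ :=
  if h : IsPrimePow Q then Real.log (Ideal.absNorm h.choose) else 0

lemma vm_nonneg (Q : Ideal (𝓞 K)) : 0 ≤ vm Q := by
  unfold vm
  split_ifs
  · exact Real.log_natCast_nonneg _
  · exact le_rfl

lemma prime_eq_of_dvd {p q : Ideal (𝓞 K)} (hp : Prime p) (hq : Prime q) (h : p ∣ q) : p = q :=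
  associated_iff_eq.mp (hp.associated_of_dvd hq h)

lemma vm_pow {p : Ideal (𝓞 K)} (hp : Prime p) {k : ℕ} (hk : 0 < k) :
    vm (p ^ k) = Real.log (Ideal.absNorm p) := by
  have h : IsPrimePow (p ^ k) := ⟨p, k, hp, hk, rfl⟩
  unfold vm
  rw [dif_pos h]
  obtain ⟨k', hq, hk', he⟩ := h.choose_spec
  have : h.choose ∣ p ^ k := by
    conv_rhs => rw [← he]
    exact dvd_pow_self _ hk'.ne'
  rw [prime_eq_of_dvd hq hp (hq.dvd_of_dvd_pow this)]

lemma vm_prime {p : Ideal (𝓞 K)} (hp : Prime p) : vm p = Real.log (Ideal.absNorm p) := by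
  simpa using vm_pow hp one_pos

lemma finite_divisors {A : Ideal (𝓞 K)} (hA : A ≠ ⊥) : {Q | Q ∣ A}.Finite := by
  have := UniqueFactorizationMonoid.fintypeSubtypeDvd A hA
  exact Set.finite_coe_iff.mp (inferInstanceAs (Finite {Q // Q ∣ A}))

lemma pow_dvd_iff_le_count {A p : Ideal (𝓞 K)} (hA : A ≠ ⊥) (hp : Prime p) (k : ℕ) :
    p ^ k ∣ A ↔ k ≤ Multiset.count p (normalizedFactors A) := by
  rw [pow_dvd_iff_le_emultiplicity,
    emultiplicity_eq_count_normalizedFactors hp.irreducible hA, normalize_eq, Nat.cast_le]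

lemma log_absNorm {A : Ideal (𝓞 K)} (hA : A ≠ ⊥) : Real.log (Ideal.absNorm A) =
    ∑ p ∈ (normalizedFactors A).toFinset,
      (Multiset.count p (normalizedFactors A) : ℝ) * Real.log (Ideal.absNorm p) := by
  have h1 : Ideal.absNorm A = ∏ p ∈ (normalizedFactors A).toFinset,
      (Ideal.absNorm p) ^ Multiset.count p (normalizedFactors A) := by
    conv_lhs => rw [← normalize_eq A, ← prod_normalizedFactors_eq hA,
      Finset.prod_multiset_count, map_prod]
    simp
  rw [h1, Nat.cast_prod, Real.log_prod]
  · refine Finset.sum_congr rfl fun p _ => ?_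
    rw [Nat.cast_pow, Real.log_pow]
  · intro p hp
    rw [Multiset.mem_toFinset] at hp
    have := (prime_of_normalized_factor p hp).ne_zero
    have h2 := absNorm_ge_one this
    have : Ideal.absNorm p ≠ 0 := by omega
    positivity

lemma prime_absNorm {p : Ideal (𝓞 K)} (hp : Prime p) : 2 ≤ Ideal.absNorm p := by
  have h1 := absNorm_ge_one hp.ne_zero
  have h2 : Ideal.absNorm p ≠ 1 := by
    rw [Ne, Ideal.absNorm_eq_one_iff]
    intro h
    exact hp.not_isUnit (Ideal.isUnit_iff.mpr h)
  omega

lemma pow_inj_prime {p q : Ideal (𝓞 K)} (hp : Prime p) (hq : Prime q) {k l : ℕ} (hk : 0 < k)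
    (h : p ^ k = q ^ l) : p = q ∧ k = l := by
  have h1 : p ∣ q := by
    apply hp.dvd_of_dvd_pow (n := l)
    rw [← h]; exact dvd_pow_self _ hk.ne'
  have h2 := prime_eq_of_dvd hp hq h1
  refine ⟨h2, ?_⟩
  subst h2
  have h3 := congrArg Ideal.absNorm h
  rw [map_pow, map_pow] at h3
  exact Nat.pow_right_injective (prime_absNorm hp) h3

lemma sum_vm_divisors {A : Ideal (𝓞 K)} (hA : A ≠ ⊥) :
    ∑ Q ∈ (finite_divisors hA).toFinset, vm Q = Real.log (Ideal.absNorm A) := by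
  rw [log_absNorm hA]
  have e : ∀ p ∈ (normalizedFactors A).toFinset,
      (Multiset.count p (normalizedFactors A) : ℝ) * Real.log (Ideal.absNorm p) =
      ∑ k ∈ Finset.Icc 1 (Multiset.count p (normalizedFactors A)), Real.log (Ideal.absNorm p) := by
    intro p _; simp
  rw [Finset.sum_congr rfl e, Finset.sum_sigma']
  symm
  refine Finset.sum_of_injOn (fun x => x.1 ^ x.2) ?_ ?_ ?_ ?_
  · rintro ⟨p, k⟩ hx ⟨q, l⟩ hy hxy
    simp only [Finset.coe_sigma, Set.mem_sigma_iff, Finset.mem_coe, Multiset.mem_toFinset,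
      Finset.mem_Icc] at hx hy
    obtain ⟨h1, h2⟩ := pow_inj_prime (prime_of_normalized_factor p hx.1)
      (prime_of_normalized_factor q hy.1) hx.2.1 hxy
    subst h1; subst h2; rfl
  · rintro ⟨p, k⟩ hx
    simp only [Finset.coe_sigma, Set.mem_sigma_iff, Finset.mem_coe, Multiset.mem_toFinset,
      Finset.mem_Icc] at hx
    simp only [Set.Finite.coe_toFinset]
    exact (pow_dvd_iff_le_count hA (prime_of_normalized_factor p hx.1) k).mpr hx.2.2
  · intro Q hQ hnot
    unfold vm
    rw [dif_neg]
    rintro ⟨p, k, hp, hk, rfl⟩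
    apply hnot
    have hQ' : p ^ k ∣ A := by simpa using hQ
    have hk2 := (pow_dvd_iff_le_count hA hp k).mp hQ'
    refine ⟨⟨p, k⟩, ?_, rfl⟩
    simp only [Finset.coe_sigma, Set.mem_sigma_iff, Finset.mem_coe, Multiset.mem_toFinset,
      Finset.mem_Icc]
    refine ⟨?_, hk, hk2⟩
    exact Multiset.count_pos.mp (lt_of_lt_of_le hk hk2)
  · rintro ⟨p, k⟩ hx
    simp only [Finset.mem_sigma, Multiset.mem_toFinset, Finset.mem_Icc] at hx
    exact (vm_pow (prime_of_normalized_factor p hx.1) hx.2.1).symm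

variable (K) in
/-- number of ideals of norm `n` -/
noncomputable def aK (n : ℕ) : ℝ := (idn K n).card

variable (K) in
/-- von Mangoldt coefficients -/
noncomputable def LK (n : ℕ) : ℝ := ∑ Q ∈ idn K n, vm Q

lemma conv_K (n : ℕ) (hn : 1 ≤ n) :
    ∑ p ∈ n.divisorsAntidiagonal, aK K p.1 * LK K p.2 = aK K n * Real.log n := by
  have h1 : aK K n * Real.log n = ∑ A ∈ (idn K n).attach,
      ∑ Q ∈ (finite_divisors (ne_bot_of_mem_idn A.2)).toFinset, vm Q := by
    have : ∀ A ∈ (idn K n).attach,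
      ∑ Q ∈ (finite_divisors (ne_bot_of_mem_idn A.2)).toFinset, vm Q = Real.log n := by
      intro A _
      rw [sum_vm_divisors (ne_bot_of_mem_idn A.2), (mem_idn.mp A.2).1]
    rw [Finset.sum_congr rfl this]
    simp [aK]
  rw [h1]
  have h2 : ∀ p ∈ n.divisorsAntidiagonal, aK K p.1 * LK K p.2 =
      ∑ x ∈ idn K p.1 ×ˢ idn K p.2, vm x.2 := by
    intro p _
    rw [Finset.sum_product]
    simp [aK, LK]
  rw [Finset.sum_congr rfl h2, Finset.sum_sigma', Finset.sum_sigma']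
  refine Finset.sum_bij (fun x hx => ⟨⟨x.2.1 * x.2.2, ?_⟩, x.2.2⟩) ?_ ?_ ?_ ?_
  · simp only [Finset.mem_sigma, Nat.mem_divisorsAntidiagonal, Finset.mem_product, mem_idn] at hx
    rw [mem_idn, map_mul, hx.2.1.1, hx.2.2.1]
    exact hx.1
  · intro x hx
    simp
  · rintro ⟨⟨d, e⟩, ⟨B, Q⟩⟩ hx ⟨⟨d', e'⟩, ⟨B', Q'⟩⟩ hx' h
    simp only [Finset.mem_sigma, Nat.mem_divisorsAntidiagonal, Finset.mem_product] at hx hx'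
    simp only [Sigma.mk.injEq, Subtype.mk.injEq, heq_eq_eq] at h
    obtain ⟨h1, rfl⟩ := h
    have h2 : B = B' := mul_right_cancel₀ (ne_bot_of_mem_idn hx.2.2) h1
    subst h2
    have e1 := (mem_idn.mp hx.2.1).1.symm.trans (mem_idn.mp hx'.2.1).1
    have e2 := (mem_idn.mp hx.2.2).1.symm.trans (mem_idn.mp hx'.2.2).1
    subst e1; subst e2; rfl
  · rintro ⟨⟨A, hA⟩, Q⟩ hx
    simp only [Finset.mem_sigma, Finset.mem_attach, Set.Finite.mem_toFinset, true_and] at hx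
    obtain ⟨B, hB⟩ := (show Q ∣ A from hx)
    have hA' := mem_idn.mp hA
    have hAN : Ideal.absNorm Q * Ideal.absNorm B = n := by rw [← map_mul, ← hB, hA'.1]
    have hQ0 : Ideal.absNorm Q ≠ 0 := fun h => hA'.2 (by rw [← hAN, h, zero_mul])
    have hB0 : Ideal.absNorm B ≠ 0 := fun h => hA'.2 (by rw [← hAN, h, mul_zero])
    refine ⟨⟨(Ideal.absNorm B, Ideal.absNorm Q), (B, Q)⟩, ?_, ?_⟩
    · simp only [Finset.mem_sigma, Nat.mem_divisorsAntidiagonal, Finset.mem_product, mem_idn]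
      exact ⟨⟨by rw [mul_comm]; exact hAN, hA'.2⟩, ⟨trivial, hB0⟩, ⟨trivial, hQ0⟩⟩
    · simp [hB, mul_comm]
  · intro x hx; rfl

lemma count_K {x : ℝ} (hx : 0 ≤ x) : ∑ k ∈ Finset.Icc 1 ⌊x⌋₊, aK K k =
    (Nat.card {I : (Ideal (𝓞 K))⁰ // (Ideal.absNorm (I : Ideal (𝓞 K)) : ℝ) ≤ x} : ℝ) := by
  have h := sum_idle (K := K) hx (fun _ => 1)
  simp only [Finset.sum_const, nsmul_eq_mul, mul_one] at h
  rw [show ∑ k ∈ Finset.Icc 1 ⌊x⌋₊, aK K k = ∑ k ∈ Finset.Icc 1 ⌊x⌋₊, ((idn K k).card : ℝ) from rfl,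
    ← h]
  have e : {I : (Ideal (𝓞 K))⁰ // (Ideal.absNorm (I : Ideal (𝓞 K)) : ℝ) ≤ x} ≃ {I // I ∈ idle K x} :=
    { toFun := fun I => ⟨I.1.1, (mem_idle hx).mpr ⟨nonZeroDivisors.ne_zero I.1.2, I.2⟩⟩
      invFun := fun I => ⟨⟨I.1, mem_nonZeroDivisors_of_ne_zero ((mem_idle hx).mp I.2).1⟩,
        ((mem_idle hx).mp I.2).2⟩
      left_inv := fun _ => rfl
      right_inv := fun _ => rfl }
  rw [Nat.card_congr e, Nat.card_eq_fintype_card, Fintype.card_coe]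

variable (K) in
theorem zdata_K : ∃ κ δ C0 : ℝ, ZData (aK K) (LK K) κ δ C0 := by
  obtain ⟨κ, C0, hκ, hC0, h⟩ := card_ideals_asymp (K := K)
  have hn : (1:ℝ) ≤ Module.finrank ℚ K := by exact_mod_cast (Module.finrank_pos (R := ℚ) (M := K))
  have h1 : idn K 1 = {⊤} := by
    ext I; rw [mem_idn]; simp
  refine ⟨κ, 1 / (2 * (Module.finrank ℚ K : ℝ)), C0, ?_⟩
  refine ⟨fun n => by unfold aK; positivity, fun n => Finset.sum_nonneg fun _ _ => vm_nonneg _,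
    by simp [aK, idn], by simp [aK, h1], by simp [LK, idn], ?_, conv_K, hκ, by positivity, ?_, ?_⟩
  · rw [LK, h1, Finset.sum_singleton, vm, dif_neg]
    rintro ⟨p, k, hp, hk, he⟩
    apply hp.not_isUnit
    refine isUnit_of_dvd_one ?_
    rw [Ideal.one_eq_top, ← he]
    exact dvd_pow_self _ hk.ne'
  · rw [div_lt_one (by positivity)]; linarith
  · intro x hx
    rw [count_K (by linarith)]
    exact h x hx
end IdealPart1

section IdealPart2
open UniqueFactorizationMonoid
open scoped nonZeroDivisors
variable (K : Type*) [Field K] [NumberField K]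

/-- number of prime ideals of norm `n` -/
noncomputable def cK (n : ℕ) : ℝ := ((idn K n).filter Prime).card

/-- Chebyshev coefficients -/
noncomputable def tK (n : ℕ) : ℝ := cK K n * Real.log n

lemma cK_nonneg (n : ℕ) : 0 ≤ cK K n := by unfold cK; positivity
lemma tK_nonneg (n : ℕ) : 0 ≤ tK K n := mul_nonneg (cK_nonneg K n) (Real.log_natCast_nonneg n)

lemma tK_eq (n : ℕ) : tK K n = ∑ Q ∈ (idn K n).filter Prime, vm Q := by
  have : ∀ Q ∈ (idn K n).filter Prime, vm Q = Real.log n := by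
    intro Q hQ
    rw [Finset.mem_filter] at hQ
    rw [vm_prime hQ.2, (mem_idn.mp hQ.1).1]
  rw [Finset.sum_congr rfl this]
  simp [tK, cK]

lemma psi_sub_theta {x : ℝ} (hx : 0 ≤ x) : zPsi (LK K) x - zPsi (tK K) x =
    ∑ Q ∈ (idle K x).filter (fun Q => ¬ Prime Q), vm Q := by
  rw [Finset.sum_filter, sum_idle hx]
  unfold zPsi
  rw [← Finset.sum_sub_distrib]
  refine Finset.sum_congr rfl fun n _ => ?_
  rw [tK_eq, LK, Finset.sum_filter, ← Finset.sum_sub_distrib]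
  refine Finset.sum_congr rfl fun Q _ => ?_
  by_cases h : Prime Q <;> simp [h]

lemma card_idle_le : ∃ C : ℝ, 0 < C ∧ ∀ x : ℝ, 1 ≤ x → ((idle K x).card : ℝ) ≤ C * x := by
  obtain ⟨κ, δ, C0, h⟩ := zdata_K K
  refine ⟨κ + C0, by have := h.kpos; have := h.C0_nonneg; positivity, fun x hx => ?_⟩
  have h2 := h.sum_le hx
  have h3 := sum_idle (K := K) (by linarith : 0 ≤ x) (fun _ => 1)
  simp only [Finset.sum_const, nsmul_eq_mul, mul_one] at h3
  rw [h3]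
  exact h2

lemma psi_sub_theta_le : ∃ C : ℝ, 0 < C ∧ ∀ x : ℝ, 2 ≤ x →
    zPsi (LK K) x - zPsi (tK K) x ≤ C * (x / Real.log x) := by
  obtain ⟨C, hC, hcard⟩ := card_idle_le K
  refine ⟨C * 2 * 216, by positivity, fun x hx => ?_⟩
  have hx0 : 0 ≤ x := by linarith
  have hl : 0 < Real.log x := Real.log_pos (by linarith)
  have hsq : 1 ≤ Real.sqrt x := Real.one_le_sqrt.mpr (by linarith)
  have hl2 : 1/2 ≤ Real.log 2 := by have := Real.log_two_gt_d9; linarith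
  rw [psi_sub_theta K hx0]
  have hb : ∑ Q ∈ (idle K x).filter (fun Q => ¬ Prime Q), vm Q ≤
      ∑ y ∈ idle K (Real.sqrt x) ×ˢ Finset.Icc 1 ⌊2 * Real.log x⌋₊, Real.log x := by
    have h1 : ∑ Q ∈ (idle K x).filter (fun Q => ¬ Prime Q), vm Q ≤
        ∑ Q ∈ (idle K (Real.sqrt x) ×ˢ Finset.Icc 1 ⌊2 * Real.log x⌋₊).image
          (fun y => y.1 ^ y.2), Real.log x := by
      refine (Finset.sum_subset_zero_on_sdiff (s₁ := ((idle K x).filter (fun Q => ¬ Prime Q)).filter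
        IsPrimePow) (Finset.filter_subset _ _) ?_ (fun _ _ => rfl)).symm.le.trans ?_
      · intro Q hQ
        rw [Finset.mem_sdiff, Finset.mem_filter (p := IsPrimePow)] at hQ
        have : ¬ IsPrimePow Q := fun h => hQ.2 ⟨hQ.1, h⟩
        rw [vm, dif_neg this]
      · refine (Finset.sum_le_sum (g := fun _ => Real.log x) ?_).trans ?_
        · intro Q hQ
          rw [Finset.mem_filter, Finset.mem_filter, mem_idle hx0] at hQ
          obtain ⟨⟨⟨h0, hN⟩, hnp⟩, p, k, hp, hk, rfl⟩ := hQ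
          rw [vm_pow hp hk]
          have h2 := prime_absNorm hp
          apply Real.log_le_log (by positivity)
          refine le_trans ?_ hN
          rw [map_pow]
          exact_mod_cast Nat.le_self_pow hk.ne' _
        · refine Finset.sum_le_sum_of_subset_of_nonneg ?_ (fun _ _ _ => hl.le)
          intro Q hQ
          rw [Finset.mem_filter, Finset.mem_filter, mem_idle hx0] at hQ
          obtain ⟨⟨⟨h0, hN⟩, hnp⟩, p, k, hp, hk, rfl⟩ := hQ
          rw [Finset.mem_image]
          refine ⟨(p, k), ?_, rfl⟩
          rw [Finset.mem_product, mem_idle (by positivity), Finset.mem_Icc]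
          have hk2 : 2 ≤ k := by
            by_contra hcon
            have : k = 1 := by omega
            subst this
            exact hnp (by simpa using hp)
          have h2 := prime_absNorm hp
          have h2' : (2:ℝ) ≤ Ideal.absNorm p := by exact_mod_cast h2
          rw [map_pow, Nat.cast_pow] at hN
          refine ⟨⟨hp.ne_zero, ?_⟩, hk, ?_⟩
          · apply Real.le_sqrt_of_sq_le
            exact (pow_le_pow_right₀ (by linarith) hk2).trans hN
          · apply Nat.le_floor
            have h3 : (2:ℝ) ^ k ≤ x := (pow_le_pow_left₀ (by norm_num) h2' k).trans hN
            have h4 := Real.log_le_log (by positivity) h3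
            rw [Real.log_pow] at h4
            have : (0:ℝ) ≤ k := by positivity
            nlinarith
    refine h1.trans ?_
    simp only [Finset.sum_const, nsmul_eq_mul]
    have := Finset.card_image_le (s := idle K (Real.sqrt x) ×ˢ Finset.Icc 1 ⌊2 * Real.log x⌋₊)
      (f := fun y => y.1 ^ y.2)
    gcongr
  refine hb.trans ?_
  simp only [Finset.sum_const, nsmul_eq_mul, Finset.card_product, Nat.card_Icc, Nat.cast_mul]
  have h1 := hcard _ hsq
  have h2 : ((⌊2 * Real.log x⌋₊ + 1 - 1 : ℕ) : ℝ) ≤ 2 * Real.log x := by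
    simp only [add_tsub_cancel_right]
    exact Nat.floor_le (by positivity)
  have h3 : Real.log x ^ 3 ≤ 216 * Real.sqrt x := by
    have h4 := Real.log_le_rpow_div hx0 (by norm_num : (0:ℝ) < 1/6)
    have h5 : Real.log x ^ 3 ≤ (x ^ (1/6 : ℝ) / (1/6)) ^ 3 := by gcongr
    refine h5.trans (le_of_eq ?_)
    rw [div_pow, ← Real.rpow_natCast, ← Real.rpow_mul hx0, Real.sqrt_eq_rpow]
    norm_num
    ring
  have h6 : Real.sqrt x * Real.sqrt x = x := Real.mul_self_sqrt hx0
  calc _ ≤ (C * Real.sqrt x) * (2 * Real.log x) * Real.log x := by gcongr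
    _ = C * 2 * (Real.sqrt x * Real.log x ^ 3) / Real.log x := by field_simp
    _ ≤ C * 2 * (Real.sqrt x * (216 * Real.sqrt x)) / Real.log x := by gcongr
    _ = C * 2 * 216 * ((Real.sqrt x * Real.sqrt x) / Real.log x) := by ring
    _ = _ := by rw [h6]

theorem theta_K : ∃ C : ℝ, 0 < C ∧ ∀ x : ℝ, 2 ≤ x →
    |zPsi (tK K) x - x| ≤ C * (x / Real.log x) := by
  obtain ⟨κ, δ, C0, h⟩ := zdata_K K
  obtain ⟨C1, hC1, h1⟩ := h.pnt
  obtain ⟨C2, hC2, h2⟩ := psi_sub_theta_le K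
  refine ⟨C1 + C2, by positivity, fun x hx => ?_⟩
  have a1 := abs_le.mp (h1 x hx)
  have a2 := h2 x hx
  have a3 : 0 ≤ zPsi (LK K) x - zPsi (tK K) x := by
    rw [psi_sub_theta K (by linarith)]
    exact Finset.sum_nonneg fun _ _ => vm_nonneg _
  rw [abs_le]
  constructor <;> linarith
end IdealPart2

section BuchPart1
variable {B : ℝ → ℝ}

lemma IsBuchstab.w_cont (h : IsBuchstab B) : ContinuousOn (fun v => v * B v) (Set.Ici 1) :=
  continuousOn_id.mul h.1

lemma IsBuchstab.bd_nat (h : IsBuchstab B) (N : ℕ) : ∀ v : ℝ, 1 ≤ v → v ≤ (N:ℝ) + 2 →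
    1 / v ≤ B v ∧ B v ≤ 1 := by
  induction N with
  | zero =>
    intro v h1 h2
    rw [h.2.1 v h1 (by simpa using h2)]
    refine ⟨le_rfl, ?_⟩
    rw [div_le_one (by linarith)]; exact h1
  | succ N ih =>
    intro v h1 h2
    by_cases hv : v ≤ N + 2
    · exact ih v h1 hv
    push Not at hv
    have hv2 : 2 < v := by
      have : (0:ℝ) ≤ N := by positivity
      linarith
    push_cast at h2
    have hsub : Set.Icc 2 v ⊆ Set.Ici (1:ℝ) := fun x hx => by
      have := hx.1
      exact Set.mem_Ici.mpr (by linarith)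
    have hd : ∀ x ∈ interior (Set.Icc 2 v), HasDerivAt (fun v => v * B v) (B (x - 1)) x := by
      intro x hx
      rw [interior_Icc] at hx
      exact h.2.2 x hx.1
    have hb : ∀ x ∈ interior (Set.Icc 2 v), 0 ≤ B (x - 1) ∧ B (x - 1) ≤ 1 := by
      intro x hx
      rw [interior_Icc] at hx
      have := ih (x - 1) (by linarith [hx.1]) (by linarith [hx.2])
      refine ⟨le_trans ?_ this.1, this.2⟩
      exact div_nonneg zero_le_one (by linarith [hx.1])
    have m1 : MonotoneOn (fun v => v * B v) (Set.Icc 2 v) := by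
      refine monotoneOn_of_deriv_nonneg (convex_Icc _ _) (h.w_cont.mono hsub)
        (fun x hx => (hd x hx).differentiableAt.differentiableWithinAt) ?_
      intro x hx
      rw [(hd x hx).deriv]; exact (hb x hx).1
    have m2 : MonotoneOn (fun v => v - v * B v) (Set.Icc 2 v) := by
      refine monotoneOn_of_deriv_nonneg (convex_Icc _ _)
        (continuousOn_id.sub (h.w_cont.mono hsub))
        (fun x hx => ((hasDerivAt_id x).sub (hd x hx)).differentiableAt.differentiableWithinAt) ?_
      intro x hx
      have := ((hasDerivAt_id x).sub (hd x hx)).deriv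
      have e : deriv (fun v => v - v * B v) x = 1 - B (x - 1) := this
      rw [e]; linarith [(hb x hx).2]
    have l2 : (2:ℝ) ∈ Set.Icc 2 v := ⟨le_rfl, hv2.le⟩
    have lv : v ∈ Set.Icc 2 v := ⟨hv2.le, le_rfl⟩
    have a1 := m1 l2 lv hv2.le
    have a2 := m2 l2 lv hv2.le
    have hB2 := h.2.1 2 (by norm_num) le_rfl
    simp only [hB2] at a1 a2
    constructor
    · rw [div_le_iff₀ (by linarith)]; linarith
    · nlinarith

lemma IsBuchstab.bd (h : IsBuchstab B) {v : ℝ} (hv : 1 ≤ v) : 1 / v ≤ B v ∧ B v ≤ 1 := by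
  obtain ⟨N, hN⟩ := exists_nat_ge v
  exact h.bd_nat N v hv (by linarith)

lemma IsBuchstab.nonneg (h : IsBuchstab B) {v : ℝ} (hv : 1 ≤ v) : 0 ≤ B v :=
  le_trans (by positivity) (h.bd hv).1

lemma IsBuchstab.w_lip (h : IsBuchstab B) {v v' : ℝ} (hv : 1 ≤ v) (hvv : v ≤ v') :
    0 ≤ v' * B v' - v * B v ∧ v' * B v' - v * B v ≤ v' - v := by
  have hd : ∀ x ∈ interior (Set.Ici (2:ℝ)), HasDerivAt (fun v => v * B v) (B (x - 1)) x := by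
    intro x hx
    rw [interior_Ici] at hx
    exact h.2.2 x hx
  have hb : ∀ x ∈ interior (Set.Ici (2:ℝ)), 0 ≤ B (x - 1) ∧ B (x - 1) ≤ 1 := by
    intro x hx
    rw [interior_Ici] at hx
    have hx' : 1 ≤ x - 1 := by have : (2:ℝ) < x := hx; linarith
    exact ⟨h.nonneg hx', (h.bd hx').2⟩
  have hsub : Set.Ici (2:ℝ) ⊆ Set.Ici 1 := Set.Ici_subset_Ici.mpr (by norm_num)
  have m1 : MonotoneOn (fun v => v * B v) (Set.Ici 2) := by
    refine monotoneOn_of_deriv_nonneg (convex_Ici _) (h.w_cont.mono hsub)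
      (fun x hx => (hd x hx).differentiableAt.differentiableWithinAt) ?_
    intro x hx
    rw [(hd x hx).deriv]; exact (hb x hx).1
  have m2 : MonotoneOn (fun v => v - v * B v) (Set.Ici 2) := by
    refine monotoneOn_of_deriv_nonneg (convex_Ici _)
      (continuousOn_id.sub (h.w_cont.mono hsub))
      (fun x hx => ((hasDerivAt_id x).sub (hd x hx)).differentiableAt.differentiableWithinAt) ?_
    intro x hx
    have := ((hasDerivAt_id x).sub (hd x hx)).deriv
    have e : deriv (fun v => v - v * B v) x = 1 - B (x - 1) := this
    rw [e]; linarith [(hb x hx).2]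
  have hw : ∀ x, 1 ≤ x → x ≤ 2 → x * B x = 1 := fun x h1 h2 => by
    rw [h.2.1 x h1 h2]; field_simp
  rcases le_total v' 2 with h1 | h1
  · rw [hw v' (hv.trans hvv) h1, hw v hv (hvv.trans h1)]
    constructor <;> linarith
  · rcases le_total v 2 with h2 | h2
    · have a1 := m1 (Set.mem_Ici.mpr le_rfl) (Set.mem_Ici.mpr h1) h1
      have a2 := m2 (Set.mem_Ici.mpr le_rfl) (Set.mem_Ici.mpr h1) h1
      have h3 := hw 2 (by norm_num) le_rfl
      rw [hw v hv h2]
      simp only at a1 a2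
      constructor <;> linarith
    · have a1 := m1 (Set.mem_Ici.mpr h2) (Set.mem_Ici.mpr h1) hvv
      have a2 := m2 (Set.mem_Ici.mpr h2) (Set.mem_Ici.mpr h1) hvv
      simp only at a1 a2
      constructor <;> linarith

lemma IsBuchstab.lip (h : IsBuchstab B) {v v' : ℝ} (hv : 1 ≤ v) (hvv : v ≤ v') :
    |B v' - B v| ≤ 2 * (v' - v) := by
  obtain ⟨h1, h2⟩ := h.w_lip hv hvv
  have h3 := h.bd hv
  have h0 := h.nonneg hv
  have h0' := h.nonneg (hv.trans hvv)
  have e : v' * (B v' - B v) = (v' * B v' - v * B v) - B v * (v' - v) := by ring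
  have hv' : 1 ≤ v' := hv.trans hvv
  have h4 : |v' * (B v' - B v)| ≤ 2 * (v' - v) := by
    rw [e, abs_le]
    have : B v * (v' - v) ≤ 1 * (v' - v) := by
      apply mul_le_mul_of_nonneg_right h3.2 (by linarith)
    have : 0 ≤ B v * (v' - v) := mul_nonneg h0 (by linarith)
    constructor <;> linarith
  rw [abs_mul, abs_of_pos (by linarith)] at h4
  refine le_trans ?_ h4
  exact le_mul_of_one_le_left (abs_nonneg _) hv'

/-- the Buchstab integral -/
lemma IsBuchstab.integral (h : IsBuchstab B) {y z : ℝ} (hz : 1 < z) (hzy : z * z ≤ y)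
    (hintg : IntervalIntegrable (fun x => B (Real.log y / Real.log x - 1) * (y / (x * Real.log x ^ 2)))
      MeasureTheory.volume z (Real.sqrt y)) :
    ∫ x in z..Real.sqrt y, B (Real.log y / Real.log x - 1) * (y / (x * Real.log x ^ 2)) =
      B (Real.log y / Real.log z) * (y / Real.log z) - y / Real.log y := by
  have hy0 : 0 < y := lt_of_lt_of_le (by positivity) hzy
  have hzs : z ≤ Real.sqrt y := Real.le_sqrt_of_sq_le (by rw [sq]; exact hzy)
  have hs1 : 1 < Real.sqrt y := lt_of_lt_of_le hz hzs
  have hlz : 0 < Real.log z := Real.log_pos hz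
  have hlsq : Real.log (Real.sqrt y) = Real.log y / 2 := Real.log_sqrt hy0.le
  have hls : 0 < Real.log (Real.sqrt y) := Real.log_pos hs1
  have hly : 0 < Real.log y := by rw [hlsq] at hls; linarith
  have hrange : ∀ x ∈ Set.Icc z (Real.sqrt y), 0 < Real.log x ∧ 2 ≤ Real.log y / Real.log x := by
    intro x hx
    have hx1 : 0 < Real.log x := Real.log_pos (lt_of_lt_of_le hz hx.1)
    refine ⟨hx1, ?_⟩
    rw [le_div_iff₀ hx1]
    have := Real.log_le_log (by linarith [hx.1]) hx.2
    rw [hlsq] at this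
    linarith
  have hvc : ContinuousOn (fun x => Real.log y / Real.log x) (Set.Icc z (Real.sqrt y)) := by
    refine continuousOn_const.div (Real.continuousOn_log.mono ?_) (fun x hx => (hrange x hx).1.ne')
    intro x hx
    have := hx.1
    simp only [Set.mem_compl_iff, Set.mem_singleton_iff]
    linarith
  have key := intervalIntegral.integral_eq_sub_of_hasDerivAt_of_le hzs
    (f := fun x => -(y / Real.log y) * ((Real.log y / Real.log x) * B (Real.log y / Real.log x)))
    (f' := fun x => B (Real.log y / Real.log x - 1) * (y / (x * Real.log x ^ 2))) ?_ ?_ hintg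
  · rw [key, hlsq, h.2.1 (Real.log y / (Real.log y / 2))]
    · field_simp
      ring
    · rw [div_div_cancel₀ hly.ne']; norm_num
    · rw [div_div_cancel₀ hly.ne']
  · refine continuousOn_const.mul ?_
    refine ContinuousOn.comp (g := fun v => v * B v) (t := Set.Ici 1) h.w_cont hvc ?_
    intro x hx
    have := (hrange x hx).2
    exact Set.mem_Ici.mpr (by linarith)
  · intro x hx
    have hx0 : 0 < x := by linarith [hx.1]
    have hlx := (hrange x ⟨hx.1.le, hx.2.le⟩).1
    have hlt : 2 < Real.log y / Real.log x := by
      rw [lt_div_iff₀ hlx]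
      have := Real.log_lt_log hx0 hx.2
      rw [hlsq] at this
      linarith
    have d1 : HasDerivAt (fun x => Real.log y / Real.log x) (-(Real.log y / (x * Real.log x ^ 2))) x := by
      have := (hasDerivAt_const x (Real.log y)).div (Real.hasDerivAt_log hx0.ne') hlx.ne'
      refine HasDerivAt.congr_deriv this ?_
      field_simp
      ring
    have d2 := (h.2.2 _ hlt).comp x d1
    have d3 := d2.const_mul (-(y / Real.log y))
    refine HasDerivAt.congr_deriv d3 ?_
    field_simp
end BuchPart1

section AbelPart

lemma zPsi_natCast (t : ℕ → ℝ) (m : ℕ) : zPsi t (m:ℝ) = ∑ n ∈ Finset.Icc 1 m, t n := by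
  simp [zPsi]

lemma zPsi_succ_sub (t : ℕ → ℝ) (m : ℕ) : zPsi t ((m+1:ℕ):ℝ) - zPsi t (m:ℝ) = t (m+1) := by
  rw [zPsi_natCast, zPsi_natCast, Finset.sum_Icc_succ_top (by omega)]
  ring

lemma inv_le_two_log {m : ℕ} (hm : 1 ≤ m) : 1 / (m:ℝ) ≤ 2 * (Real.log ((m+1:ℕ):ℝ) - Real.log m) := by
  have hm' : (1:ℝ) ≤ m := by exact_mod_cast hm
  have h1 := Real.one_sub_inv_le_log_of_pos (x := ((m:ℝ)+1)/m) (by positivity)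
  rw [Real.log_div (by positivity) (by positivity)] at h1
  push_cast
  have h2 : 1 / (m:ℝ) ≤ 2 * (1 - (((m:ℝ)+1)/m)⁻¹) := by
    rw [inv_div]
    have : 1 - (m:ℝ)/(m+1) = 1/(m+1) := by field_simp; ring
    rw [this, mul_one_div, div_le_div_iff₀ (by positivity) (by positivity)]
    linarith
  linarith

variable {t : ℕ → ℝ} {C L Z : ℝ} {z : ℕ} {f : ℝ → ℝ}

lemma abel_nat (hC : 0 ≤ C) (hθ : ∀ x, 2 ≤ x → |zPsi t x - x| ≤ C * (x / Real.log x))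
    (hz : 2 ≤ z) (hL : 0 ≤ L) (hc : ContinuousOn f (Set.Icc (z:ℝ) Z))
    (hlip : ∀ x x', (z:ℝ) ≤ x → x ≤ x' → x' ≤ Z → |f x' - f x| ≤ L * ((x' - x) / x ^ 2))
    (m : ℕ) (hm : z ≤ m) : (m:ℝ) ≤ Z →
    |∑ n ∈ Finset.Ioc z m, f n * t n - (∫ x in (z:ℝ)..m, f x) - f m * (zPsi t m - m)
      + f z * (zPsi t z - z)| ≤ 2 * L * (1 + C) / Real.log z * (Real.log m - Real.log z) := by
  have hz2 : (2:ℝ) ≤ z := by exact_mod_cast hz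
  have hlz : 0 < Real.log z := Real.log_pos (by linarith)
  induction m, hm using Nat.le_induction with
  | base => intro _; simp
  | succ m hm ih =>
    intro hmZ
    have hzm : (z:ℝ) ≤ m := by exact_mod_cast hm
    have hm0 : (0:ℝ) < m := by linarith
    have hmm : (m:ℝ) ≤ ((m+1:ℕ):ℝ) := by push_cast; linarith
    have ih' := ih (hmm.trans hmZ)
    have i1 : IntervalIntegrable f MeasureTheory.volume (z:ℝ) m := by
      apply ContinuousOn.intervalIntegrable
      rw [Set.uIcc_of_le hzm]
      exact hc.mono (Set.Icc_subset_Icc_right (hmm.trans hmZ))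
    have i2 : IntervalIntegrable f MeasureTheory.volume (m:ℝ) ((m+1:ℕ):ℝ) := by
      apply ContinuousOn.intervalIntegrable
      rw [Set.uIcc_of_le hmm]
      exact hc.mono (Set.Icc_subset_Icc hzm hmZ)
    have hs : ∑ n ∈ Finset.Ioc z (m+1), f n * t n
        = ∑ n ∈ Finset.Ioc z m, f n * t n + f ((m+1:ℕ):ℝ) * t (m+1) := by
      rw [← Finset.insert_Ioc_right_eq_Ioc_add_one hm, Finset.sum_insert (by simp)]
      ring
    have hlogm : Real.log z ≤ Real.log m := Real.log_le_log (by linarith) hzm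
    have hd : |f ((m+1:ℕ):ℝ) - f m| ≤ L * (1 / (m:ℝ)^2) := by
      have := hlip m ((m+1:ℕ):ℝ) hzm hmm hmZ
      simpa using this
    have he : |zPsi t m - m| ≤ C * (m / Real.log z) := by
      refine (hθ m (by linarith)).trans ?_
      gcongr
    have hmz : Real.log z ≤ m := le_trans (Real.log_le_self (by linarith)) hzm
    have b1 : |f ((m+1:ℕ):ℝ) - ∫ x in (m:ℝ)..((m+1:ℕ):ℝ), f x| ≤ L * (1 / (m:ℝ)^2) := by
      have e : f ((m+1:ℕ):ℝ) - ∫ x in (m:ℝ)..((m+1:ℕ):ℝ), f x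
          = ∫ x in (m:ℝ)..((m+1:ℕ):ℝ), (f ((m+1:ℕ):ℝ) - f x) := by
        rw [intervalIntegral.integral_sub (by simp) i2, intervalIntegral.integral_const]
        simp
      rw [e]
      have := intervalIntegral.norm_integral_le_of_norm_le_const (a := (m:ℝ)) (b := ((m+1:ℕ):ℝ))
        (f := fun x => f ((m+1:ℕ):ℝ) - f x) (C := L * (1 / (m:ℝ)^2)) ?_
      · simpa using this
      · intro x hx
        rw [Set.uIoc_of_le hmm] at hx
        rw [Real.norm_eq_abs]
        refine (hlip x _ (hzm.trans hx.1.le) hx.2 hmZ).trans ?_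
        have h1 := hx.1
        have : ((m+1:ℕ):ℝ) - x ≤ 1 := by push_cast; linarith
        gcongr
    have b2 : |(f m - f ((m+1:ℕ):ℝ)) * (zPsi t m - m)| ≤ L * C / (m * Real.log z) := by
      rw [abs_mul, abs_sub_comm]
      calc _ ≤ (L * (1 / (m:ℝ)^2)) * (C * (m / Real.log z)) := by gcongr
        _ = _ := by field_simp
    have b3 : L * (1 / (m:ℝ)^2) ≤ L / (m * Real.log z) := by
      rw [mul_one_div, sq]
      gcongr
    have b4 : L * (1 + C) / Real.log z * (1 / m) ≤
        L * (1 + C) / Real.log z * (2 * (Real.log ((m+1:ℕ):ℝ) - Real.log m)) := by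
      gcongr
      exact inv_le_two_log (by omega)
    have e1 : ∑ n ∈ Finset.Ioc z (m+1), f n * t n - (∫ x in (z:ℝ)..((m+1:ℕ):ℝ), f x)
        - f ((m+1:ℕ):ℝ) * (zPsi t ((m+1:ℕ):ℝ) - ((m+1:ℕ):ℝ)) + f z * (zPsi t z - z)
        = (∑ n ∈ Finset.Ioc z m, f n * t n - (∫ x in (z:ℝ)..m, f x) - f m * (zPsi t m - m)
      + f z * (zPsi t z - z)) + (f ((m+1:ℕ):ℝ) - ∫ x in (m:ℝ)..((m+1:ℕ):ℝ), f x)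
        + (f m - f ((m+1:ℕ):ℝ)) * (zPsi t m - m) := by
      rw [hs, ← intervalIntegral.integral_add_adjacent_intervals i1 i2, ← zPsi_succ_sub t m]
      have : ((m+1:ℕ):ℝ) = m + 1 := by push_cast; ring
      linear_combination (f ((m+1:ℕ):ℝ)) * this
    rw [e1]
    refine (abs_add_le _ _).trans ?_
    refine (add_le_add_left (abs_add_le _ _) _).trans ?_
    have e2 : L * (1 + C) / Real.log z * (1 / m) = L / (m * Real.log z) + L * C / (m * Real.log z) := by
      field_simp
    have e3 : 2 * L * (1 + C) / Real.log z * (Real.log ((m+1:ℕ):ℝ) - Real.log z)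
       = 2 * L * (1 + C) / Real.log z * (Real.log m - Real.log z)
        + L * (1 + C) / Real.log z * (2 * (Real.log ((m+1:ℕ):ℝ) - Real.log m)) := by ring
    rw [e3]
    linarith

lemma abel_sum (hC : 0 ≤ C) (hθ : ∀ x, 2 ≤ x → |zPsi t x - x| ≤ C * (x / Real.log x))
    (hz : 2 ≤ z) (hzZ : (z:ℝ) ≤ Z) (hL : 0 ≤ L) (hc : ContinuousOn f (Set.Icc (z:ℝ) Z))
    (hf : ∀ x, (z:ℝ) ≤ x → x ≤ Z → |f x| ≤ L / x)
    (hlip : ∀ x x', (z:ℝ) ≤ x → x ≤ x' → x' ≤ Z → |f x' - f x| ≤ L * ((x' - x) / x ^ 2)) :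
    |∑ n ∈ Finset.Ioc z ⌊Z⌋₊, f n * t n - ∫ x in (z:ℝ)..Z, f x|
      ≤ 2 * L * (1 + C) / Real.log z * (Real.log Z - Real.log z + 1) := by
  have hz2 : (2:ℝ) ≤ z := by exact_mod_cast hz
  have hlz : 0 < Real.log z := Real.log_pos (by linarith)
  set m := ⌊Z⌋₊ with hmdef
  have hm : z ≤ m := Nat.le_floor hzZ
  have hzm : (z:ℝ) ≤ m := by exact_mod_cast hm
  have hmZ : (m:ℝ) ≤ Z := Nat.floor_le (by linarith)
  have hZm : Z - m ≤ 1 := by have := Nat.lt_floor_add_one Z; linarith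
  have key := abel_nat hC hθ hz hL hc hlip m hm hmZ
  have i1 : IntervalIntegrable f MeasureTheory.volume (z:ℝ) m := by
    apply ContinuousOn.intervalIntegrable
    rw [Set.uIcc_of_le hzm]
    exact hc.mono (Set.Icc_subset_Icc_right hmZ)
  have i2 : IntervalIntegrable f MeasureTheory.volume (m:ℝ) Z := by
    apply ContinuousOn.intervalIntegrable
    rw [Set.uIcc_of_le hmZ]
    exact hc.mono (Set.Icc_subset_Icc_left hzm)
  have hlmz : ∀ x:ℝ, (z:ℝ) ≤ x → |f x| ≤ L / x → |f x * (zPsi t x - x)| ≤ L * C / Real.log z := by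
    intro x hx hfx
    have hx0 : 0 < x := by linarith
    rw [abs_mul]
    have he : |zPsi t x - x| ≤ C * (x / Real.log z) := by
      refine (hθ x (by linarith)).trans ?_
      have := Real.log_le_log (by linarith) hx
      gcongr
    calc _ ≤ (L / x) * (C * (x / Real.log z)) := by gcongr
      _ = _ := by field_simp
  have a1 := hlmz m hzm (hf m hzm hmZ)
  have a2 := hlmz z le_rfl (hf z le_rfl hzZ)
  have a3 : |∫ x in (m:ℝ)..Z, f x| ≤ L / Real.log z := by
    have := intervalIntegral.norm_integral_le_of_norm_le_const (a := (m:ℝ)) (b := Z)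
        (f := f) (C := L / Real.log z) ?_
    · rw [Real.norm_eq_abs, abs_of_nonneg (by linarith : 0 ≤ Z - m)] at this
      refine this.trans ?_
      exact mul_le_of_le_one_right (by positivity) hZm
    · intro x hx
      rw [Set.uIoc_of_le hmZ] at hx
      have hxz := hzm.trans hx.1.le
      rw [Real.norm_eq_abs]
      refine (hf x hxz hx.2).trans ?_
      have := (Real.log_le_self (by linarith : (0:ℝ) ≤ z)).trans hxz
      gcongr
  have hlog : Real.log m ≤ Real.log Z := Real.log_le_log (by linarith) hmZ
  have a4 : 2 * L * (1 + C) / Real.log z * (Real.log m - Real.log z)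
    ≤ 2 * L * (1 + C) / Real.log z * (Real.log Z - Real.log z) := by gcongr
  rw [← intervalIntegral.integral_add_adjacent_intervals i1 i2]
  have e3 : 2 * L * (1 + C) / Real.log z * (Real.log Z - Real.log z + 1) =
    2 * L * (1 + C) / Real.log z * (Real.log Z - Real.log z) + 2 * (L / Real.log z) + 2 * (L * C / Real.log z) := by
    ring
  have a5 : 0 ≤ L / Real.log z := by positivity
  rw [e3]
  rw [abs_le] at *
  constructor <;> linarith [key.1, key.2, a1.1, a1.2, a2.1, a2.2, a3.1, a3.2]
end AbelPart

section BuchIdent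
variable (K : Type*) [Field K] [NumberField K]

lemma PrimeIdeal.prime {K : Type*} [Field K] [NumberField K] (q : PrimeIdeal K) : Prime q.1 :=
  Ideal.prime_of_isPrime q.2.1 q.2.2

lemma PrimeIdeal.isMax {K : Type*} [Field K] [NumberField K] (q : PrimeIdeal K) : q.1.IsMaximal :=
  q.2.2.isMaximal q.2.1

lemma PrimeIdeal.sup_eq_top {K : Type*} [Field K] [NumberField K] (q : PrimeIdeal K)
    {I : Ideal (𝓞 K)} (h : ¬ q.1 ∣ I) : I ⊔ q.1 = ⊤ := by
  have hq := q.isMax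
  rw [Ideal.dvd_iff_le] at h
  by_contra hne
  have : q.1 = I ⊔ q.1 := hq.eq_of_le hne le_sup_right
  exact h (le_sup_left.trans this.symm.le)

lemma PrimeIdeal.not_dvd {K : Type*} [Field K] [NumberField K] (q : PrimeIdeal K)
    {I : Ideal (𝓞 K)} (h : I ⊔ q.1 = ⊤) : ¬ q.1 ∣ I := by
  intro h2
  rw [Ideal.dvd_iff_le] at h2
  rw [sup_eq_right.mpr h2] at h
  exact q.2.2.ne_top h

lemma PrimeIdeal.two_le {K : Type*} [Field K] [NumberField K] (q : PrimeIdeal K) :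
    2 ≤ Ideal.absNorm q.1 := prime_absNorm q.prime

lemma PrimeIdeal.two_le_real {K : Type*} [Field K] [NumberField K] (q : PrimeIdeal K) :
    (2:ℝ) ≤ Ideal.absNorm q.1 := by exact_mod_cast q.two_le

lemma PrimeIdeal.ext' {K : Type*} [Field K] [NumberField K] {p q : PrimeIdeal K}
    (h : p.1 = q.1) : p = q := Subtype.ext h

/-- prime ideals of norm at most `x`. -/
noncomputable def pset (x : ℝ) : Finset (PrimeIdeal K) :=
  (idle K x).preimage (fun q : PrimeIdeal K => q.1) (fun _ _ _ _ h => PrimeIdeal.ext' h)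

lemma mem_pset {x : ℝ} (hx : 0 ≤ x) {q : PrimeIdeal K} :
    q ∈ pset K x ↔ (Ideal.absNorm q.1 : ℝ) ≤ x := by
  refine Finset.mem_preimage.trans ((mem_idle hx).trans ?_)
  exact ⟨fun h => h.2, fun h => ⟨q.2.1, h⟩⟩

/-- ideals of norm at most `y` free of prime factors below `p`. -/
noncomputable def rF (lt : PrimeIdeal K → PrimeIdeal K → Prop) (y : ℝ) (p : PrimeIdeal K) : ℝ :=
  ((idle K y).filter (CoprimeBelow K lt p)).card

lemma phi_eq_rF (lt : PrimeIdeal K → PrimeIdeal K → Prop) {N : ℝ} (hN : 0 ≤ N)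
    (r : Ideal (𝓞 K)) (hr : r ≠ ⊥) (p : PrimeIdeal K) :
    Phi K lt (fun a => if (Ideal.absNorm a : ℝ) ≤ N then 1 else 0) r p
      = rF K lt (N / Ideal.absNorm r) p := by
  have hr1 : (1:ℝ) ≤ Ideal.absNorm r := by exact_mod_cast absNorm_ge_one hr
  have hy : 0 ≤ N / Ideal.absNorm r := by positivity
  have hiff : ∀ a : Ideal (𝓞 K), (Ideal.absNorm (a * r) : ℝ) ≤ N ↔
      (Ideal.absNorm a : ℝ) ≤ N / Ideal.absNorm r := by
    intro a
    rw [map_mul, le_div_iff₀ (by linarith)]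
    push_cast; rfl
  rw [Phi, tsum_eq_sum (s := idle K (N / Ideal.absNorm r))]
  · rw [rF, Finset.card_filter]
    push_cast
    refine Finset.sum_congr rfl fun a ha => ?_
    rw [mem_idle hy] at ha
    by_cases h : CoprimeBelow K lt p a
    · simp only [h, ha.1, ne_eq, not_false_eq_true, and_self, if_true]
      rw [if_pos ((hiff a).mpr ha.2)]
    · simp [h]
  · intro a ha
    rw [mem_idle hy] at ha
    by_cases h : a ≠ ⊥ ∧ CoprimeBelow K lt p a
    · rw [if_pos h, if_neg]
      rw [hiff]
      exact fun h2 => ha ⟨h.1, h2⟩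
    · rw [if_neg h]

lemma buch_identity (lt : PrimeIdeal K → PrimeIdeal K → Prop)
    (hord : IsStrictTotalOrder (PrimeIdeal K) lt) {y : ℝ} (hy : 1 ≤ y) (p : PrimeIdeal K) :
    rF K lt y p = 1 + ∑ q ∈ (pset K y).filter (fun q => ¬ lt q p),
      rF K lt (y / Ideal.absNorm q.1) q := by
  have hy0 : 0 ≤ y := by linarith
  have hset : (idle K y).filter (CoprimeBelow K lt p) =
      insert ⊤ (((pset K y).filter (fun q => ¬ lt q p)).biUnion (fun q =>
        ((idle K (y / Ideal.absNorm q.1)).filter (CoprimeBelow K lt q)).image (fun a => q.1 * a))) := by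
    ext I
    rw [Finset.mem_filter, mem_idle hy0, Finset.mem_insert, Finset.mem_biUnion]
    constructor
    · rintro ⟨⟨hI0, hIy⟩, hcop⟩
      by_cases hI : I = ⊤
      · left; exact hI
      right
      have hsub : {q : PrimeIdeal K | q.1 ∣ I} ⊆ (pset K y : Set (PrimeIdeal K)) := by
        intro q hq
        rw [Finset.mem_coe, mem_pset K hy0]
        refine le_trans ?_ hIy
        have := Nat.le_of_dvd (Nat.pos_of_ne_zero (by
          have := absNorm_ge_one hI0; omega)) (Ideal.absNorm_dvd_absNorm_of_le (Ideal.dvd_iff_le.mp hq))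
        exact_mod_cast this
      have hfin : {q : PrimeIdeal K | q.1 ∣ I}.Finite := (Finset.finite_toSet _).subset hsub
      have hne : {q : PrimeIdeal K | q.1 ∣ I}.Nonempty := by
        obtain ⟨M, hM, hIM⟩ := Ideal.exists_le_maximal I hI
        have hM0 : M ≠ ⊥ := by
          rintro rfl
          exact hI0 (le_bot_iff.mp hIM)
        exact ⟨⟨M, hM0, hM.isPrime⟩, Ideal.dvd_iff_le.mpr hIM⟩
      have hwf := hfin.wellFoundedOn (r := lt)
      obtain ⟨q0, hq0⟩ := hne
      obtain ⟨⟨q, hq⟩, _, hmin⟩ := WellFounded.has_min hwf Set.univ ⟨⟨q0, hq0⟩, trivial⟩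
      have hmin' : ∀ q' : PrimeIdeal K, q'.1 ∣ I → ¬ lt q' q := fun q' h => hmin ⟨q', h⟩ trivial
      have hq' : q.1 ∣ I := hq
      refine ⟨q, ?_, ?_⟩
      · rw [Finset.mem_filter]
        exact ⟨hsub hq, fun hlt => q.not_dvd (hcop q hlt) hq'⟩
      · obtain ⟨a, rfl⟩ := hq'
        rw [Finset.mem_image]
        refine ⟨a, ?_, rfl⟩
        have hNq := q.two_le_real
        rw [Finset.mem_filter, mem_idle (by positivity)]
        refine ⟨⟨fun h => hI0 (by rw [h]; simp), ?_⟩, ?_⟩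
        · rw [le_div_iff₀ (by linarith), mul_comm]
          rw [map_mul] at hIy
          exact_mod_cast hIy
        · intro q' hlt
          exact q'.sup_eq_top fun hd => hmin' q' (hd.mul_left _) hlt
    · rintro (rfl | ⟨q, hq, hI⟩)
      · refine ⟨⟨top_ne_bot, by simpa using hy⟩, fun q _ => by simp⟩
      · rw [Finset.mem_filter] at hq
        rw [Finset.mem_image] at hI
        obtain ⟨a, ha, rfl⟩ := hI
        have hNq := q.two_le_real
        rw [Finset.mem_filter, mem_idle (by positivity)] at ha
        obtain ⟨⟨ha0, hay⟩, hac⟩ := ha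
        refine ⟨⟨mul_ne_zero q.2.1 ha0, ?_⟩, ?_⟩
        · rw [le_div_iff₀ (by linarith), mul_comm] at hay
          rw [map_mul]
          exact_mod_cast hay
        · intro q' hlt
          have hq'q : lt q' q := by
            rcases trichotomous_of lt p q with h3 | h3 | h3
            · exact _root_.trans hlt h3
            · exact h3 ▸ hlt
            · exact absurd h3 hq.2
          apply q'.sup_eq_top
          intro hd
          rcases q'.prime.dvd_or_dvd hd with h2 | h2
          · have := PrimeIdeal.ext' (prime_eq_of_dvd q'.prime q.prime h2)
            subst this
            exact hord.toIrrefl.irrefl _ hq'q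
          · exact q'.not_dvd (hac q' hq'q) h2
  have hdisj : ∀ q ∈ (pset K y).filter (fun q => ¬ lt q p), ∀ q' ∈ (pset K y).filter (fun q => ¬ lt q p),
      q ≠ q' → Disjoint
        (((idle K (y / Ideal.absNorm q.1)).filter (CoprimeBelow K lt q)).image (fun a => q.1 * a))
        (((idle K (y / Ideal.absNorm q'.1)).filter (CoprimeBelow K lt q')).image (fun a => q'.1 * a)) := by
    have aux : ∀ q q' : PrimeIdeal K, lt q q' → ∀ a a', CoprimeBelow K lt q' a' → q.1 * a ≠ q'.1 * a' := by
      intro q q' hlt a a' ha' h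
      have h1 : q.1 ∣ q'.1 * a' := ⟨a, h.symm⟩
      rcases q.prime.dvd_or_dvd h1 with h2 | h2
      · have := PrimeIdeal.ext' (prime_eq_of_dvd q.prime q'.prime h2)
        subst this
        exact hord.toIrrefl.irrefl _ hlt
      · exact q.not_dvd (ha' q hlt) h2
    intro q _ q' _ hne
    rw [Finset.disjoint_left]
    intro I h1 h2
    rw [Finset.mem_image] at h1 h2
    obtain ⟨a, ha, rfl⟩ := h1
    obtain ⟨a', ha', h⟩ := h2
    rw [Finset.mem_filter] at ha ha'
    rcases trichotomous_of lt q q' with h3 | h3 | h3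
    · exact aux q q' h3 a a' ha'.2 h.symm
    · exact hne h3
    · exact aux q' q h3 a' a ha.2 h
  rw [rF, hset, Finset.card_insert_of_notMem, Finset.card_biUnion hdisj]
  · push_cast
    rw [add_comm]
    congr 1
    refine Finset.sum_congr rfl fun q _ => ?_
    rw [Finset.card_image_of_injective, rF]
    exact mul_right_injective₀ (q.2.1)
  · rw [Finset.mem_biUnion]
    rintro ⟨q, _, hq⟩
    rw [Finset.mem_image] at hq
    obtain ⟨a, _, ha⟩ := hq
    apply q.2.2.ne_top
    rw [eq_top_iff, ← ha]
    exact Ideal.mul_le_left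

lemma rF_one (lt : PrimeIdeal K → PrimeIdeal K → Prop)
    (hord : IsStrictTotalOrder (PrimeIdeal K) lt)
    (hcompat : ∀ p q : PrimeIdeal K, Ideal.absNorm p.1 < Ideal.absNorm q.1 → lt p q)
    {x : ℝ} (hx : 1 ≤ x) (q : PrimeIdeal K) (hxq : x < Ideal.absNorm q.1) :
    rF K lt x q = 1 := by
  rw [buch_identity K lt hord hx q, Finset.filter_false_of_mem, Finset.sum_empty, add_zero]
  intro q' hq'
  rw [mem_pset K (by linarith)] at hq'
  rw [not_not]
  apply hcompat
  have := hq'.trans_lt hxq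
  exact_mod_cast this

lemma card_pset_eq {x : ℝ} (hx : 0 ≤ x) {n : ℕ} (hn : (n:ℝ) ≤ x) (hn0 : n ≠ 0) :
    (((pset K x).filter (fun q => Ideal.absNorm q.1 = n)).card : ℝ) = cK K n := by
  rw [cK]
  congr 1
  refine Finset.card_bij (fun q _ => q.1) ?_ ?_ ?_
  · intro q hq
    rw [Finset.mem_filter] at hq ⊢
    exact ⟨mem_idn.mpr ⟨hq.2, hn0⟩, q.prime⟩
  · intro q _ q' _ h
    exact PrimeIdeal.ext' h
  · intro I hI
    rw [Finset.mem_filter, mem_idn] at hI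
    refine ⟨⟨I, hI.2.ne_zero, Ideal.isPrime_of_prime hI.2⟩, ?_, rfl⟩
    rw [← hI.1.1] at hn
    exact Finset.mem_filter.mpr ⟨(mem_pset K hx).mpr hn, hI.1.1⟩

lemma sum_pset {x : ℝ} (hx : 0 ≤ x) (z : ℕ) (g : ℝ → ℝ) :
    ∑ q ∈ (pset K x).filter (fun q => z < Ideal.absNorm q.1), g (Ideal.absNorm q.1)
      = ∑ n ∈ Finset.Ioc z ⌊x⌋₊, g n * cK K n := by
  rw [← Finset.sum_fiberwise_of_maps_to (t := Finset.Ioc z ⌊x⌋₊)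
    (g := fun q : PrimeIdeal K => Ideal.absNorm q.1)]
  · refine Finset.sum_congr rfl fun n hn => ?_
    rw [Finset.mem_Ioc] at hn
    have hnx : (n:ℝ) ≤ x := (Nat.le_floor_iff hx).mp hn.2
    rw [← card_pset_eq K hx hnx (by omega), Finset.filter_filter]
    have e : (pset K x).filter (fun q => z < Ideal.absNorm q.1 ∧ Ideal.absNorm q.1 = n)
        = (pset K x).filter (fun q => Ideal.absNorm q.1 = n) := by
      apply Finset.filter_congr
      intro q _
      constructor
      · exact fun h => h.2
      · exact fun h => ⟨by omega, h⟩
    rw [e, Finset.sum_congr rfl (g := fun _ => g n)]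
    · rw [Finset.sum_const, nsmul_eq_mul, mul_comm]
    · intro q hq
      rw [Finset.mem_filter] at hq
      rw [hq.2]
  · intro q hq
    rw [Finset.mem_filter, mem_pset K hx] at hq
    rw [Finset.mem_Ioc]
    exact ⟨hq.2, Nat.le_floor hq.1⟩

lemma sum_pset_split (lt : PrimeIdeal K → PrimeIdeal K → Prop)
    (hord : IsStrictTotalOrder (PrimeIdeal K) lt)
    (hcompat : ∀ p q : PrimeIdeal K, Ideal.absNorm p.1 < Ideal.absNorm q.1 → lt p q)
    (x : ℝ) (p : PrimeIdeal K) (G : PrimeIdeal K → ℝ) :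
    ∑ q ∈ (pset K x).filter (fun q => ¬ lt q p), G q =
      ∑ q ∈ (pset K x).filter (fun q => Ideal.absNorm p.1 < Ideal.absNorm q.1), G q +
      ∑ q ∈ (pset K x).filter (fun q => ¬ lt q p ∧ Ideal.absNorm q.1 = Ideal.absNorm p.1), G q := by
  rw [← Finset.sum_union]
  · refine Finset.sum_congr ?_ fun _ _ => rfl
    ext q
    rw [Finset.mem_union, Finset.mem_filter, Finset.mem_filter, Finset.mem_filter]
    constructor
    · rintro ⟨h1, h2⟩
      rcases lt_trichotomy (Ideal.absNorm p.1) (Ideal.absNorm q.1) with h | h | h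
      · exact Or.inl ⟨h1, h⟩
      · exact Or.inr ⟨h1, h2, h.symm⟩
      · exact absurd (hcompat _ _ h) h2
    · rintro (⟨h1, h2⟩ | ⟨h1, h2, _⟩)
      · refine ⟨h1, fun h => ?_⟩
        exact hord.toIrrefl.irrefl _ (_root_.trans h (hcompat _ _ h2))
      · exact ⟨h1, h2⟩
  · rw [Finset.disjoint_filter]
    rintro q _ h1 ⟨_, h2⟩
    omega

lemma tK_bound {C : ℝ} (hC : 0 ≤ C)
    (hθ : ∀ x, 2 ≤ x → |zPsi (tK K) x - x| ≤ C * (x / Real.log x)) {z : ℕ} (hz : 2 ≤ z) :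
    tK K z ≤ (2 + 3 * C) * (z / Real.log z) := by
  have hz2 : (2:ℝ) ≤ z := by exact_mod_cast hz
  have hlz : 0 < Real.log z := Real.log_pos (by linarith)
  have h1 : 1 ≤ z / Real.log z := by
    rw [one_le_div hlz]; exact Real.log_le_self (by linarith)
  have hz1 := hθ z hz2
  rw [abs_le] at hz1
  obtain ⟨m, rfl⟩ : ∃ m, z = m + 1 := ⟨z - 1, by omega⟩
  have hs := zPsi_succ_sub (tK K) m
  rcases Nat.lt_or_ge m 2 with hm | hm
  · have hm1 : m = 1 := by omega
    subst hm1
    have h0 : 0 ≤ zPsi (tK K) ((1:ℕ):ℝ) := Finset.sum_nonneg fun n _ => tK_nonneg K n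
    have h2 : (((1+1:ℕ)):ℝ) ≤ 2 * ((((1+1:ℕ)):ℝ) / Real.log ((1+1:ℕ):ℝ)) := by
      push_cast at h1 ⊢; linarith
    have h6 : 0 ≤ C * ((((1+1:ℕ)):ℝ) / Real.log ((1+1:ℕ):ℝ)) := mul_nonneg hC (by linarith)
    rw [← hs]
    have hz12 := hz1.2
    clear hs hz1 hlz hz2 h1
    generalize ((1+1:ℕ):ℝ) = w at *
    generalize zPsi (tK K) ((1:ℕ):ℝ) = w2 at *
    linarith
  · have hm2 : (2:ℝ) ≤ m := by exact_mod_cast hm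
    have hm1 := hθ m hm2
    rw [abs_le] at hm1
    have hlm : 0 < Real.log m := Real.log_pos (by linarith)
    have hlog : Real.log ((m+1:ℕ):ℝ) ≤ 2 * Real.log m := by
      rw [← Real.log_rpow (by linarith)]
      apply Real.log_le_log (by positivity)
      push_cast
      rw [Real.rpow_two]; nlinarith
    have h3 : (m:ℝ) / Real.log m ≤ 2 * (((m+1:ℕ):ℝ) / Real.log ((m+1:ℕ):ℝ)) := by
      rw [← mul_div_assoc, div_le_div_iff₀ hlm hlz]
      push_cast at hlog ⊢
      nlinarith
    have h4 : ((m+1:ℕ):ℝ) = m + 1 := by push_cast; ring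
    have h5 := mul_le_mul_of_nonneg_left h3 hC
    nlinarith
end BuchIdent

section SumPart
variable (K : Type*) [Field K] [NumberField K]

lemma half_lt_log {x : ℝ} (hx : 2 ≤ x) : 1 / 2 < Real.log x := by
  have h1 := Real.log_le_log (by norm_num) hx
  have := Real.log_two_gt_d9
  linarith

lemma theta_cheb : ∃ A, 0 < A ∧ ∀ x, 1 ≤ x → zPsi (tK K) x ≤ A * x := by
  obtain ⟨κ, δ, C0, hz⟩ := zdata_K K
  obtain ⟨A, hA, h⟩ := hz.psi_cheb
  refine ⟨A, hA, fun x hx => ?_⟩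
  have h1 := psi_sub_theta K (x := x) (by linarith)
  have h2 : 0 ≤ ∑ Q ∈ (idle K x).filter (fun Q => ¬ Prime Q), vm Q :=
    Finset.sum_nonneg fun Q _ => vm_nonneg Q
  linarith [h x hx]

lemma cK_le {z n : ℕ} (hz : 2 ≤ z) (hn : z ≤ n) : cK K n ≤ tK K n / Real.log z := by
  have hz2 : (2:ℝ) ≤ z := by exact_mod_cast hz
  have hlz : 0 < Real.log z := Real.log_pos (by linarith)
  have hzn : (z:ℝ) ≤ n := by exact_mod_cast hn
  rw [le_div_iff₀ hlz, tK]
  exact mul_le_mul_of_nonneg_left (Real.log_le_log (by linarith) hzn) (cK_nonneg K n)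

lemma count_lemma {C A : ℝ} (hC : 0 ≤ C) (hA : 0 < A)
    (hθ : ∀ x, 2 ≤ x → |zPsi (tK K) x - x| ≤ C * (x / Real.log x))
    (hch : ∀ x, 1 ≤ x → zPsi (tK K) x ≤ A * x) {z M : ℕ} (hz : 2 ≤ z) (hzM : z ≤ M)
    {y : ℝ} (hzy : (z:ℝ) ≤ y) (hMy : (M:ℝ) ≤ y) (hM : (M:ℝ) ≤ z + Real.sqrt y) :
    |∑ n ∈ Finset.Ioc M ⌊y⌋₊, cK K n - y / Real.log y| ≤
      (C + 4 * A) * (y / Real.log z ^ 2 + z / Real.log z) := by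
  have hz2 : (2:ℝ) ≤ z := by exact_mod_cast hz
  have hlz : 0 < Real.log z := Real.log_pos (by linarith)
  have hy0 : 0 < y := by linarith
  have hly : Real.log z ≤ Real.log y := Real.log_le_log (by linarith) hzy
  have hly0 : 0 < Real.log y := by linarith
  have hMf : M ≤ ⌊y⌋₊ := Nat.le_floor hMy
  set S := ∑ n ∈ Finset.Ioc M ⌊y⌋₊, cK K n with hS
  have hmem : ∀ n ∈ Finset.Ioc M ⌊y⌋₊, (z:ℝ) ≤ n ∧ (n:ℝ) ≤ y := by
    intro n hn
    rw [Finset.mem_Ioc] at hn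
    refine ⟨?_, (Nat.le_floor_iff hy0.le).mp hn.2⟩
    have : z ≤ n := by omega
    exact_mod_cast this
  have e1 : S * Real.log y = (zPsi (tK K) y - zPsi (tK K) M) +
      ∑ n ∈ Finset.Ioc M ⌊y⌋₊, cK K n * Real.log (y / n) := by
    have h1 : zPsi (tK K) y - zPsi (tK K) M = ∑ n ∈ Finset.Ioc M ⌊y⌋₊, tK K n := by
      rw [zPsi_natCast, zPsi, sub_eq_iff_eq_add, add_comm]
      rw [← Finset.sum_union]
      · refine Finset.sum_congr ?_ fun _ _ => rfl
        ext n
        rw [Finset.mem_union, Finset.mem_Icc, Finset.mem_Icc, Finset.mem_Ioc]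
        omega
      · rw [Finset.disjoint_left]
        intro n h1 h2
        rw [Finset.mem_Icc] at h1
        rw [Finset.mem_Ioc] at h2
        omega
    rw [h1, ← Finset.sum_add_distrib, hS, Finset.sum_mul]
    refine Finset.sum_congr rfl fun n hn => ?_
    have := hmem n hn
    rw [tK, Real.log_div hy0.ne' (by linarith)]
    ring
  have hT := zT_le (tK_nonneg K) hA hch y (by linarith)
  have e2 : ∑ n ∈ Finset.Ioc M ⌊y⌋₊, cK K n * Real.log (y / n) ≤ 2 * A * y / Real.log z := by
    rw [le_div_iff₀ hlz]
    refine le_trans ?_ hT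
    rw [zT, Finset.sum_mul]
    have hsub : Finset.Ioc M ⌊y⌋₊ ⊆ Finset.Icc 1 ⌊y⌋₊ := by
      intro n hn
      rw [Finset.mem_Ioc] at hn
      rw [Finset.mem_Icc]
      omega
    refine le_trans ?_ (Finset.sum_le_sum_of_subset_of_nonneg hsub ?_)
    · refine Finset.sum_le_sum fun n hn => ?_
      have h := hmem n hn
      rw [Finset.mem_Ioc] at hn
      have h1 := cK_le K hz (n := n) (by omega)
      rw [le_div_iff₀ hlz] at h1
      have h2 : 0 ≤ Real.log (y / n) := Real.log_nonneg (by
        rw [one_le_div (by linarith)]; exact h.2)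
      nlinarith
    · intro n hn _
      have h := mem_Icc_floor hy0.le hn
      exact mul_nonneg (tK_nonneg K n) (Real.log_nonneg (by
        rw [one_le_div (by linarith)]; exact h.2))
  have e3 : 0 ≤ ∑ n ∈ Finset.Ioc M ⌊y⌋₊, cK K n * Real.log (y / n) := by
    refine Finset.sum_nonneg fun n hn => ?_
    have h := hmem n hn
    exact mul_nonneg (cK_nonneg K n) (Real.log_nonneg (by
        rw [one_le_div (by linarith)]; exact h.2))
  have e4 : 0 ≤ zPsi (tK K) M := Finset.sum_nonneg fun n _ => tK_nonneg K n
  have e5 : zPsi (tK K) M ≤ A * (z + Real.sqrt y) := by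
    have hzM' : (z:ℝ) ≤ M := by exact_mod_cast hzM
    exact (hch M (by linarith)).trans (by gcongr)
  have e6 := hθ y (by linarith)
  have hsq : Real.log z ≤ 2 * Real.sqrt y := by
    have h1 := Real.log_le_self (Real.sqrt_nonneg y)
    rw [Real.log_sqrt hy0.le] at h1
    linarith
  have e7 : Real.sqrt y ≤ 2 * y / Real.log z := by
    rw [le_div_iff₀ hlz]
    have := Real.mul_self_sqrt hy0.le
    nlinarith [Real.sqrt_nonneg y]
  have e8 : C * (y / Real.log y) ≤ C * (y / Real.log z) := by gcongr
  have e9 : |S * Real.log y - y| ≤ (C + 4 * A) * (y / Real.log z + z) := by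
    have hb : (C + 4 * A) * (y / Real.log z + z) = C * (y / Real.log z) + A * (2 * y / Real.log z)
      + 2 * A * y / Real.log z + A * z + (C + 3 * A) * z := by ring
    have hp : 0 ≤ (C + 3 * A) * z := by positivity
    have e7' := mul_le_mul_of_nonneg_left e7 hA.le
    have hp2 : 0 ≤ A * (2 * y / Real.log z) := by positivity
    have hp3 : 0 ≤ A * z := by positivity
    rw [hb, e1]
    rw [abs_le] at *
    constructor <;> linarith [e6.1, e6.2]
  have e10 : S - y / Real.log y = (S * Real.log y - y) / Real.log y := by field_simp
  rw [e10, abs_div, abs_of_pos hly0, div_le_iff₀ hly0]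
  refine e9.trans ?_
  have e11 : (C + 4 * A) * (y / Real.log z ^ 2 + z / Real.log z) * Real.log z =
    (C + 4 * A) * (y / Real.log z + z) := by field_simp
  rw [← e11]
  gcongr

lemma rec_sum {C : ℝ} (hC : 0 ≤ C)
    (hθ : ∀ x, 2 ≤ x → |zPsi (tK K) x - x| ≤ C * (x / Real.log x))
    {z : ℕ} (hz : 2 ≤ z) {Z : ℝ} (hzZ : (z:ℝ) ≤ Z) :
    ∑ n ∈ Finset.Ioc z ⌊Z⌋₊, 1 / (n:ℝ) * tK K n ≤ (5 + 4 * C) * (Real.log Z + 1) := by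
  have hz2 : (2:ℝ) ≤ z := by exact_mod_cast hz
  have hlz := half_lt_log hz2
  have h := abel_sum (t := tK K) (f := fun x => 1 / x) (L := 1) hC hθ hz hzZ zero_le_one ?_ ?_ ?_
  · have hi : ∫ x in (z:ℝ)..Z, 1 / x = Real.log Z - Real.log z := by
      rw [integral_one_div_of_pos (by linarith) (by linarith), Real.log_div (by linarith) (by linarith)]
    rw [hi] at h
    have h2 := (abs_le.mp h).2
    have hlog : Real.log z ≤ Real.log Z := Real.log_le_log (by linarith) hzZ
    have h3 : 2 * 1 * (1 + C) / Real.log z ≤ 4 * (1 + C) := by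
      rw [div_le_iff₀ (by linarith)]; nlinarith
    have h4 : 2 * 1 * (1 + C) / Real.log z * (Real.log Z - Real.log z + 1) ≤
        4 * (1 + C) * (Real.log Z + 1) := by
      apply mul_le_mul h3 (by linarith) (by linarith) (by positivity)
    linarith
  · refine continuousOn_const.div continuousOn_id ?_
    intro x hx
    have := hx.1
    intro h0; linarith [show x = 0 from h0]
  · intro x hx _
    rw [abs_of_pos (by apply one_div_pos.mpr; linarith)]
  · intro x x' hx hxx _
    have hx0 : 0 < x := by linarith
    have hx0' : 0 < x' := by linarith
    have e : 1 / x' - 1 / x = -((x' - x) / (x * x')) := by field_simp; ring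
    rw [e, abs_neg, abs_of_nonneg (div_nonneg (by linarith) (by positivity)), one_mul, sq]
    gcongr
end SumPart

section MainSum
variable {B : ℝ → ℝ}

lemma log_sub_le {x x' : ℝ} (hx : 0 < x) (hxx : x ≤ x') : Real.log x' - Real.log x ≤ (x' - x) / x := by
  have h := Real.log_le_sub_one_of_pos (x := x' / x) (div_pos (by linarith) hx)
  rw [Real.log_div (by linarith) (by linarith)] at h
  refine h.trans (le_of_eq ?_)
  field_simp

lemma inv_log_sub {l s s' d : ℝ} (hl : 0 < l) (hs : l ≤ s) (hss : s ≤ s') (hd : s' - s ≤ d) :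
    1 / s - 1 / s' ≤ d / l ^ 2 := by
  have hs0 : 0 < s := by linarith
  have hs0' : 0 < s' := by linarith
  have e : 1 / s - 1 / s' = (s' - s) / (s * s') := by field_simp
  rw [e, sq]
  have : 0 ≤ d := by linarith
  gcongr
  linarith

lemma inv_log_sq_sub {l s s' d : ℝ} (hl : 0 < l) (hs : l ≤ s) (hss : s ≤ s') (hd : s' - s ≤ d) :
    1 / s ^ 2 - 1 / s' ^ 2 ≤ 2 * d / l ^ 3 := by
  have hs0 : 0 < s := by linarith
  have hs0' : 0 < s' := by linarith
  have h1 := inv_log_sub hl hs hss hd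
  have h2 : 1 / s + 1 / s' ≤ 2 / l := by
    have a1 : 1 / s ≤ 1 / l := by gcongr
    have a2 : 1 / s' ≤ 1 / l := by gcongr; linarith
    have : 2 / l = 1 / l + 1 / l := by ring
    linarith
  have e : 1 / s ^ 2 - 1 / s' ^ 2 = (1 / s - 1 / s') * (1 / s + 1 / s') := by ring
  have e2 : 2 * d / l ^ 3 = (d / l ^ 2) * (2 / l) := by ring
  rw [e, e2]
  apply mul_le_mul h1 h2 (by positivity)
  have : 0 ≤ d := by linarith
  positivity

/-- the integrand -/
noncomputable def bf (B : ℝ → ℝ) (y x : ℝ) : ℝ :=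
  B (Real.log y / Real.log x - 1) * (y / (x * Real.log x ^ 2))

variable {y z k : ℝ}

lemma bf_range (hz : 2 ≤ z) (hy : 0 < y) {x : ℝ} (hx : z ≤ x) (hxy : x ≤ Real.sqrt y) :
    1 / 2 < Real.log x ∧ Real.log z ≤ Real.log x ∧ 1 ≤ Real.log y / Real.log x - 1 := by
  have h1 : 1 / 2 < Real.log x := half_lt_log (by linarith)
  refine ⟨h1, Real.log_le_log (by linarith) hx, ?_⟩
  have h2 := Real.log_le_log (by linarith) hxy
  rw [Real.log_sqrt hy.le] at h2
  have : 2 ≤ Real.log y / Real.log x := by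
    rw [le_div_iff₀ (by linarith)]; linarith
  linarith

lemma bf_cont (h : IsBuchstab B) (hz : 2 ≤ z) (hy : 0 < y) :
    ContinuousOn (bf B y) (Set.Icc z (Real.sqrt y)) := by
  have hlog : ContinuousOn (fun x => Real.log x) (Set.Icc z (Real.sqrt y)) := by
    refine Real.continuousOn_log.mono ?_
    intro x hx
    have := hx.1
    simp only [Set.mem_compl_iff, Set.mem_singleton_iff]
    linarith
  have hne : ∀ x ∈ Set.Icc z (Real.sqrt y), Real.log x ≠ 0 := by
    intro x hx
    have := bf_range hz hy hx.1 hx.2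
    linarith
  refine ContinuousOn.mul ?_ ?_
  · refine ContinuousOn.comp (g := B) (t := Set.Ici 1) h.1
      ((continuousOn_const.div hlog hne).sub continuousOn_const) ?_
    intro x hx
    exact Set.mem_Ici.mpr (bf_range hz hy hx.1 hx.2).2.2
  · refine continuousOn_const.div (continuousOn_id.mul (hlog.pow 2)) ?_
    intro x hx
    have := hx.1
    have hx0 : x ≠ 0 := by linarith
    exact mul_ne_zero hx0 (pow_ne_zero 2 (hne x hx))

lemma bf_bound (h : IsBuchstab B) (hz : 2 ≤ z) (hy : 0 < y) {x : ℝ} (hx : z ≤ x)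
    (hxy : x ≤ Real.sqrt y) : |bf B y x| ≤ (y / Real.log z ^ 2) / x := by
  obtain ⟨h1, h2, h3⟩ := bf_range hz hy hx hxy
  have hlz := half_lt_log hz
  have hx0 : 0 < x := by linarith
  have hb := h.bd h3
  have hb0 := h.nonneg h3
  rw [bf, abs_of_nonneg (by positivity), div_div, mul_comm (Real.log z ^ 2)]
  calc _ ≤ 1 * (y / (x * Real.log x ^ 2)) := by gcongr; exact hb.2
    _ ≤ _ := by rw [one_mul]; gcongr

lemma bf_lip (h : IsBuchstab B) (hz : 2 ≤ z) (hy : 0 < y) (hk : 0 ≤ k)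
    (hyk : Real.log y ≤ k * Real.log z) {x x' : ℝ} (hx : z ≤ x)
    (hxx : x ≤ x') (hxy : x' ≤ Real.sqrt y) :
    |bf B y x' - bf B y x| ≤ ((5 + 4 * k) * (y / Real.log z ^ 2)) * ((x' - x) / x ^ 2) := by
  obtain ⟨h1, h2, h3⟩ := bf_range hz hy hx (hxx.trans hxy)
  obtain ⟨h1', h2', h3'⟩ := bf_range hz hy (hx.trans hxx) hxy
  have hlz := half_lt_log hz
  have hx0 : 0 < x := by linarith
  have hx0' : 0 < x' := by linarith
  set l := Real.log z with hl
  have hl0 : 0 < l := by linarith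
  have hss : Real.log x ≤ Real.log x' := Real.log_le_log hx0 hxx
  have hd := log_sub_le hx0 hxx
  set d := (x' - x) / x with hdd
  have hd0 : 0 ≤ d := div_nonneg (by linarith) hx0.le
  have hly : 0 ≤ Real.log y := by
    have : 1 ≤ Real.log y / Real.log x := by linarith
    rw [le_div_iff₀ (by linarith)] at this
    linarith
  have il : 1 / l ≤ 2 := by rw [div_le_iff₀ hl0]; linarith
  -- b part
  have hb : |B (Real.log y / Real.log x' - 1) - B (Real.log y / Real.log x - 1)| ≤ 4 * k * d := by
    have hvv : Real.log y / Real.log x' - 1 ≤ Real.log y / Real.log x - 1 := by gcongr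
    have h4 := h.lip h3' hvv
    rw [abs_sub_comm]
    refine h4.trans ?_
    have h5 := inv_log_sub hl0 h2 hss hd
    have h6 := mul_le_mul_of_nonneg_left h5 hly
    have h7 : Real.log y * (d / l ^ 2) ≤ (k * l) * (d / l ^ 2) := by gcongr
    have h8 : (k * l) * (d / l ^ 2) = k * d * (1 / l) := by field_simp
    have h9 : k * d * (1 / l) ≤ k * d * 2 := by gcongr
    have e : Real.log y / Real.log x - 1 - (Real.log y / Real.log x' - 1) =
      Real.log y * (1 / Real.log x - 1 / Real.log x') := by ring
    rw [e]
    linarith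
  have ha : |y / (x' * Real.log x' ^ 2) - y / (x * Real.log x ^ 2)| ≤ 5 * (y / (l ^ 2 * x)) * d := by
    have a1 : 1 / x - 1 / x' ≤ d / x := by
      have e : 1 / x - 1 / x' = (x' - x) / x / x' := by field_simp
      rw [e, ← hdd]
      gcongr
    have a2 := inv_log_sq_sub hl0 h2 hss hd
    have a1' : 0 ≤ 1 / x - 1 / x' := sub_nonneg.mpr (by gcongr)
    have a2' : 0 ≤ 1 / Real.log x ^ 2 - 1 / Real.log x' ^ 2 := sub_nonneg.mpr (by gcongr)
    have e : y / (x' * Real.log x' ^ 2) - y / (x * Real.log x ^ 2) =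
      -(y * ((1 / x - 1 / x') * (1 / Real.log x ^ 2) + (1 / x') * (1 / Real.log x ^ 2 - 1 / Real.log x' ^ 2))) := by
      have : Real.log x ≠ 0 := by linarith
      have : Real.log x' ≠ 0 := by linarith
      field_simp
      ring
    rw [e, abs_neg, abs_of_nonneg (by positivity)]
    have b1 : (1 / x - 1 / x') * (1 / Real.log x ^ 2) ≤ (d / x) * (1 / l ^ 2) := by gcongr
    have b2 : (1 / x') * (1 / Real.log x ^ 2 - 1 / Real.log x' ^ 2) ≤ (1 / x) * (2 * d / l ^ 3) := by
      gcongr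
    have b3 : (1 / x) * (2 * d / l ^ 3) = 2 * ((d / x) * (1 / l ^ 2)) * (1 / l) := by field_simp
    have b4 : 2 * ((d / x) * (1 / l ^ 2)) * (1 / l) ≤ 2 * ((d / x) * (1 / l ^ 2)) * 2 := by gcongr
    have b5 : 5 * (y / (l ^ 2 * x)) * d = y * (5 * ((d / x) * (1 / l ^ 2))) := by field_simp
    rw [b5]
    gcongr
    linarith
  have ha' : |y / (x' * Real.log x' ^ 2)| ≤ y / (l ^ 2 * x) := by
    rw [abs_of_nonneg (by positivity), mul_comm]
    gcongr
  have hB1 : |B (Real.log y / Real.log x - 1)| ≤ 1 := by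
    rw [abs_of_nonneg (h.nonneg h3)]; exact (h.bd h3).2
  have e : bf B y x' - bf B y x =
      (B (Real.log y / Real.log x' - 1) - B (Real.log y / Real.log x - 1)) * (y / (x' * Real.log x' ^ 2))
      + B (Real.log y / Real.log x - 1) * (y / (x' * Real.log x' ^ 2) - y / (x * Real.log x ^ 2)) := by
    rw [bf, bf]; ring
  rw [e]
  refine (abs_add_le _ _).trans ?_
  rw [abs_mul, abs_mul]
  calc _ ≤ (4 * k * d) * (y / (l ^ 2 * x)) + 1 * (5 * (y / (l ^ 2 * x)) * d) := by gcongr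
    _ = _ := by rw [hdd]; field_simp; ring

lemma main_sum (h : IsBuchstab B) (K : Type*) [Field K] [NumberField K] {C : ℝ} (hC : 0 ≤ C)
    (hθ : ∀ x, 2 ≤ x → |zPsi (tK K) x - x| ≤ C * (x / Real.log x))
    {z : ℕ} (hz : 2 ≤ z) {y k : ℝ} (hk : 0 ≤ k) (hzy : (z:ℝ) * z ≤ y)
    (hyk : Real.log y ≤ k * Real.log z) :
    |∑ n ∈ Finset.Ioc z ⌊Real.sqrt y⌋₊, bf B y n * tK K n -
      (B (Real.log y / Real.log z) * (y / Real.log z) - y / Real.log y)| ≤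
      (2 * (5 + 4 * k) * (1 + C) * (k + 2)) * (y / Real.log z ^ 2) := by
  have hz2 : (2:ℝ) ≤ z := by exact_mod_cast hz
  have hlz := half_lt_log hz2
  have hy : 0 < y := by nlinarith
  have hzs : (z:ℝ) ≤ Real.sqrt y := Real.le_sqrt_of_sq_le (by rw [sq]; exact hzy)
  have hs0 : 0 < Real.sqrt y := by linarith
  have hc := bf_cont h hz2 hy
  have hintg : IntervalIntegrable (bf B y) MeasureTheory.volume (z:ℝ) (Real.sqrt y) := by
    apply ContinuousOn.intervalIntegrable
    rw [Set.uIcc_of_le hzs]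
    exact hc
  have hI := h.integral (y := y) (z := z) (by linarith) hzy hintg
  have hL : 0 ≤ (5 + 4 * k) * (y / Real.log z ^ 2) := by positivity
  have key := abel_sum (t := tK K) (f := bf B y) hC hθ hz hzs hL hc ?_ ?_
  · have hI' : ∫ x in (z:ℝ)..Real.sqrt y, bf B y x =
      B (Real.log y / Real.log z) * (y / Real.log z) - y / Real.log y := hI
    rw [hI'] at key
    refine key.trans ?_
    have h1 : Real.log (Real.sqrt y) ≤ k * Real.log z := by
      rw [Real.log_sqrt hy.le]
      have : 0 ≤ Real.log y := Real.log_nonneg (by nlinarith)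
      linarith
    have h2 : Real.log (Real.sqrt y) - Real.log z + 1 ≤ (k + 2) * Real.log z := by linarith
    calc _ ≤ 2 * ((5 + 4 * k) * (y / Real.log z ^ 2)) * (1 + C) / Real.log z * ((k + 2) * Real.log z) := by
          gcongr
      _ = _ := by
          have : Real.log z ≠ 0 := by linarith
          field_simp
  · intro x hx hxy
    refine (bf_bound h hz2 hy hx hxy).trans ?_
    have : 0 < x := by linarith
    have h3 : 0 ≤ y / Real.log z ^ 2 := by positivity
    gcongr
    nlinarith
  · intro x x' hx hxx hxy
    exact bf_lip h hz2 hy hk hyk hx hxx hxy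
end MainSum

section InductPart
variable (K : Type*) [Field K] [NumberField K]

lemma buch_split (lt : PrimeIdeal K → PrimeIdeal K → Prop)
    (hord : IsStrictTotalOrder (PrimeIdeal K) lt)
    (hcompat : ∀ p q : PrimeIdeal K, Ideal.absNorm p.1 < Ideal.absNorm q.1 → lt p q)
    (p : PrimeIdeal K) {y : ℝ} (hy : 1 ≤ y) :
    rF K lt y p = 1 + ∑ n ∈ Finset.Ioc (max (Ideal.absNorm p.1) ⌊Real.sqrt y⌋₊) ⌊y⌋₊, cK K n +
      ∑ q ∈ (pset K (Real.sqrt y)).filter (fun q => Ideal.absNorm p.1 < Ideal.absNorm q.1),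
        rF K lt (y / Ideal.absNorm q.1) q +
      ∑ q ∈ (pset K y).filter (fun q => ¬ lt q p ∧ Ideal.absNorm q.1 = Ideal.absNorm p.1),
        rF K lt (y / Ideal.absNorm q.1) q := by
  have hy0 : 0 ≤ y := by linarith
  have hsy : Real.sqrt y ≤ y := by
    rw [Real.sqrt_le_left hy0]; nlinarith
  rw [buch_identity K lt hord hy p, sum_pset_split K lt hord hcompat y p, ← add_assoc]
  congr 1
  rw [add_assoc]
  congr 1
  rw [← Finset.sum_filter_add_sum_filter_not _
    (fun q => max (Ideal.absNorm p.1) ⌊Real.sqrt y⌋₊ < Ideal.absNorm q.1)]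
  congr 1
  · have e := sum_pset K hy0 (max (Ideal.absNorm p.1) ⌊Real.sqrt y⌋₊) (fun _ => 1)
    simp only [one_mul] at e
    rw [← e, Finset.filter_filter]
    refine Finset.sum_congr ?_ ?_
    · apply Finset.filter_congr
      intro q _
      constructor
      · exact fun h => h.2
      · exact fun h => ⟨lt_of_le_of_lt (le_max_left _ _) h, h⟩
    · intro q hq
      rw [Finset.mem_filter, mem_pset K hy0] at hq
      have h2 := q.two_le_real
      apply rF_one K lt hord hcompat
      · rw [one_le_div (by linarith)]; exact hq.1
      · have h3 : ⌊Real.sqrt y⌋₊ < Ideal.absNorm q.1 := lt_of_le_of_lt (le_max_right _ _) hq.2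
        rw [Nat.floor_lt (Real.sqrt_nonneg y), Real.sqrt_lt' (by linarith)] at h3
        rw [div_lt_iff₀ (by linarith), ← sq]
        exact h3
  · refine Finset.sum_congr ?_ fun _ _ => rfl
    ext q
    rw [Finset.mem_filter, Finset.mem_filter, Finset.mem_filter, mem_pset K hy0,
      mem_pset K (Real.sqrt_nonneg y), ← Nat.le_floor_iff (Real.sqrt_nonneg y), max_lt_iff]
    have hf : Ideal.absNorm q.1 ≤ ⌊Real.sqrt y⌋₊ → (Ideal.absNorm q.1 : ℝ) ≤ y := fun h =>
      ((Nat.le_floor_iff (Real.sqrt_nonneg y)).mp h).trans hsy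
    constructor
    · rintro ⟨⟨_, h2⟩, h3⟩
      exact ⟨by omega, h2⟩
    · rintro ⟨h1, h2⟩
      exact ⟨⟨hf h1, h2⟩, by omega⟩

/-- terms with `N q = N p` -/
lemma seq_bound {C : ℝ} (hC : 0 ≤ C)
    (hθ : ∀ x, 2 ≤ x → |zPsi (tK K) x - x| ≤ C * (x / Real.log x))
    (lt : PrimeIdeal K → PrimeIdeal K → Prop) (p : PrimeIdeal K) {y H : ℝ}
    (hy : (Ideal.absNorm p.1 : ℝ) ≤ y) (hH : 0 ≤ H) (G : PrimeIdeal K → ℝ)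
    (hG : ∀ q : PrimeIdeal K, Ideal.absNorm q.1 = Ideal.absNorm p.1 → |G q| ≤ H) :
    |∑ q ∈ (pset K y).filter (fun q => ¬ lt q p ∧ Ideal.absNorm q.1 = Ideal.absNorm p.1), G q| ≤
      (2 + 3 * C) * ((Ideal.absNorm p.1 : ℝ) / Real.log (Ideal.absNorm p.1) ^ 2) * H := by
  have hp2 := p.two_le_real
  have hl := half_lt_log hp2
  have hy0 : 0 ≤ y := by linarith
  refine (Finset.abs_sum_le_sum_abs _ _).trans ?_
  have h1 : ∑ q ∈ (pset K y).filter (fun q => ¬ lt q p ∧ Ideal.absNorm q.1 = Ideal.absNorm p.1), |G q|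
      ≤ ∑ q ∈ (pset K y).filter (fun q => Ideal.absNorm q.1 = Ideal.absNorm p.1), H := by
    refine le_trans (Finset.sum_le_sum (g := fun _ => H) ?_) ?_
    · intro q hq
      rw [Finset.mem_filter] at hq
      exact hG q hq.2.2
    · refine Finset.sum_le_sum_of_subset_of_nonneg ?_ (fun _ _ _ => hH)
      intro q hq
      rw [Finset.mem_filter] at hq ⊢
      exact ⟨hq.1, hq.2.2⟩
  refine h1.trans ?_
  rw [Finset.sum_const, nsmul_eq_mul, card_pset_eq K hy0 hy (by have := p.two_le; omega)]
  refine mul_le_mul_of_nonneg_right ?_ hH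
  refine (cK_le K p.two_le le_rfl).trans ?_
  rw [div_le_iff₀ (by linarith)]
  refine (tK_bound K hC hθ p.two_le).trans (le_of_eq ?_)
  have : Real.log (Ideal.absNorm p.1 : ℝ) ≠ 0 := by linarith
  field_simp


variable {K} in
lemma ih_apply {lt : PrimeIdeal K → PrimeIdeal K → Prop} {B : ℝ → ℝ} {D : ℝ} {k : ℕ} (hD : 0 ≤ D)
    (hIH : ∀ (q : PrimeIdeal K) (x : ℝ), (Ideal.absNorm q.1 : ℝ) ≤ x →
      x < (Ideal.absNorm q.1 : ℝ) ^ (k + 1) →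
      |rF K lt x q - B (Real.log x / Real.log (Ideal.absNorm q.1)) *
        (x / Real.log (Ideal.absNorm q.1))| ≤
      D * (x / Real.log (Ideal.absNorm q.1) ^ 2 + Ideal.absNorm q.1 / Real.log (Ideal.absNorm q.1)))
    (q : PrimeIdeal K) {z y : ℝ} (hz : 2 ≤ z) (hy : 0 < y) (hyz : y < z ^ (k + 2))
    (hq : z ≤ Ideal.absNorm q.1) (hqy : (Ideal.absNorm q.1 : ℝ) ≤ Real.sqrt y) :
    |rF K lt (y / Ideal.absNorm q.1) q - B (Real.log y / Real.log (Ideal.absNorm q.1) - 1) *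
      (y / Ideal.absNorm q.1 / Real.log (Ideal.absNorm q.1))| ≤
      D * (y / Ideal.absNorm q.1 / Real.log z ^ 2 + Ideal.absNorm q.1 / Real.log z) := by
  have hlz := half_lt_log hz
  generalize hn : (Ideal.absNorm q.1 : ℝ) = n at *
  have hln : Real.log z ≤ Real.log n := Real.log_le_log (by linarith) hq
  have hn0 : 0 < n := by linarith
  have h1 : n ≤ y / n := by
    rw [le_div_iff₀ hn0, ← sq]
    exact (Real.le_sqrt hn0.le hy.le).mp hqy
  have h2 : y / n < n ^ (k + 1) := by
    rw [div_lt_iff₀ hn0, ← pow_succ]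
    refine hyz.trans_le ?_
    gcongr
  have h := hIH q (y / n) (by rw [hn]; exact h1) (by rw [hn]; exact h2)
  rw [hn] at h
  have e : Real.log (y / n) / Real.log n = Real.log y / Real.log n - 1 := by
    rw [Real.log_div hy.ne' hn0.ne']
    have : Real.log n ≠ 0 := by linarith
    field_simp
  rw [e] at h
  refine h.trans ?_
  gcongr

lemma smid_bound {lt : PrimeIdeal K → PrimeIdeal K → Prop} {B : ℝ → ℝ} {D : ℝ} {k : ℕ} (hD : 0 ≤ D)
    (hIH : ∀ (q : PrimeIdeal K) (x : ℝ), (Ideal.absNorm q.1 : ℝ) ≤ x →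
      x < (Ideal.absNorm q.1 : ℝ) ^ (k + 1) →
      |rF K lt x q - B (Real.log x / Real.log (Ideal.absNorm q.1)) *
        (x / Real.log (Ideal.absNorm q.1))| ≤
      D * (x / Real.log (Ideal.absNorm q.1) ^ 2 + Ideal.absNorm q.1 / Real.log (Ideal.absNorm q.1)))
    {C A : ℝ} (hC : 0 ≤ C) (hA : 0 < A)
    (hθ : ∀ x, 2 ≤ x → |zPsi (tK K) x - x| ≤ C * (x / Real.log x))
    (hch : ∀ x, 1 ≤ x → zPsi (tK K) x ≤ A * x) {z : ℕ} (hz : 2 ≤ z) {y : ℝ} (hzy : (z:ℝ) * z ≤ y)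
    (hyz : y < (z:ℝ) ^ (k + 2)) (hyk : Real.log y ≤ (k + 2) * Real.log z) :
    |∑ q ∈ (pset K (Real.sqrt y)).filter (fun q => z < Ideal.absNorm q.1),
        rF K lt (y / Ideal.absNorm q.1) q
      - ∑ n ∈ Finset.Ioc z ⌊Real.sqrt y⌋₊, bf B y n * tK K n| ≤
      D * ((5 + 4 * C) * (k + 4) + A) * (y / Real.log z ^ 2) := by
  have hz2 : (2:ℝ) ≤ z := by exact_mod_cast hz
  have hlz := half_lt_log hz2
  have hy : 0 < y := by nlinarith
  have hzs : (z:ℝ) ≤ Real.sqrt y := Real.le_sqrt_of_sq_le (by rw [sq]; exact hzy)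
  have hs0 : 0 < Real.sqrt y := by linarith
  have hmem : ∀ n ∈ Finset.Ioc z ⌊Real.sqrt y⌋₊, z ≤ n ∧ (z:ℝ) ≤ n ∧ (n:ℝ) ≤ Real.sqrt y := by
    intro n hn
    rw [Finset.mem_Ioc] at hn
    refine ⟨hn.1.le, by exact_mod_cast hn.1.le, (Nat.le_floor_iff hs0.le).mp hn.2⟩
  have e1 : ∑ n ∈ Finset.Ioc z ⌊Real.sqrt y⌋₊, bf B y n * tK K n =
      ∑ q ∈ (pset K (Real.sqrt y)).filter (fun q => z < Ideal.absNorm q.1),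
        B (Real.log y / Real.log (Ideal.absNorm q.1) - 1) *
      (y / Ideal.absNorm q.1 / Real.log (Ideal.absNorm q.1)) := by
    rw [sum_pset K hs0.le z (fun x => B (Real.log y / Real.log x - 1) * (y / x / Real.log x))]
    refine Finset.sum_congr rfl fun n hn => ?_
    obtain ⟨_, h1, h2⟩ := hmem n hn
    have hl := half_lt_log (hz2.trans h1)
    have : Real.log n ≠ 0 := by linarith
    have : (n:ℝ) ≠ 0 := by linarith
    rw [bf, tK]
    field_simp
  rw [e1, ← Finset.sum_sub_distrib]
  refine (Finset.abs_sum_le_sum_abs _ _).trans ?_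
  refine (Finset.sum_le_sum (g := fun q => D * (y / Ideal.absNorm q.1 / Real.log z ^ 2
    + Ideal.absNorm q.1 / Real.log z)) ?_).trans ?_
  · intro q hq
    rw [Finset.mem_filter, mem_pset K hs0.le] at hq
    exact ih_apply hD hIH q hz2 hy hyz (by exact_mod_cast hq.2.le) hq.1
  rw [sum_pset K hs0.le z (fun x => D * (y / x / Real.log z ^ 2 + x / Real.log z))]
  have e2 : ∑ n ∈ Finset.Ioc z ⌊Real.sqrt y⌋₊, D * (y / n / Real.log z ^ 2 + n / Real.log z) * cK K n
      ≤ ∑ n ∈ Finset.Ioc z ⌊Real.sqrt y⌋₊, (D * (y / Real.log z ^ 3) * (1 / (n:ℝ) * tK K n)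
        + D * (Real.sqrt y / Real.log z ^ 2) * tK K n) := by
    refine Finset.sum_le_sum fun n hn => ?_
    obtain ⟨h0, h1, h2⟩ := hmem n hn
    have hc := cK_le K hz h0
    have hn0 : (0:ℝ) < n := by linarith
    have ht := tK_nonneg K n
    calc _ ≤ D * (y / n / Real.log z ^ 2 + Real.sqrt y / Real.log z) * (tK K n / Real.log z) := by
          gcongr
          exact cK_nonneg K n
      _ = _ := by
          have : Real.log z ≠ 0 := by linarith
          field_simp
  refine e2.trans ?_
  rw [Finset.sum_add_distrib, ← Finset.mul_sum, ← Finset.mul_sum]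
  have r1 := rec_sum K hC hθ hz hzs
  have r2 : ∑ n ∈ Finset.Ioc z ⌊Real.sqrt y⌋₊, tK K n ≤ A * Real.sqrt y := by
    refine le_trans ?_ (hch _ (by linarith))
    rw [zPsi]
    refine Finset.sum_le_sum_of_subset_of_nonneg ?_ (fun n _ _ => tK_nonneg K n)
    intro n hn
    rw [Finset.mem_Ioc] at hn
    rw [Finset.mem_Icc]
    omega
  have r3 : Real.log (Real.sqrt y) + 1 ≤ (k + 4) * Real.log z := by
    rw [Real.log_sqrt hy.le]
    have : 0 ≤ Real.log y := Real.log_nonneg (by nlinarith)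
    nlinarith
  have r4 : D * (y / Real.log z ^ 3) * ∑ n ∈ Finset.Ioc z ⌊Real.sqrt y⌋₊, 1 / (n:ℝ) * tK K n
      ≤ D * ((5 + 4 * C) * (k + 4)) * (y / Real.log z ^ 2) := by
    calc _ ≤ D * (y / Real.log z ^ 3) * ((5 + 4 * C) * ((k + 4) * Real.log z)) := by
          gcongr
          exact r1.trans (by gcongr)
      _ = _ := by
          have : Real.log z ≠ 0 := by linarith
          field_simp
  have r5 : D * (Real.sqrt y / Real.log z ^ 2) * ∑ n ∈ Finset.Ioc z ⌊Real.sqrt y⌋₊, tK K n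
      ≤ D * A * (y / Real.log z ^ 2) := by
    calc _ ≤ D * (Real.sqrt y / Real.log z ^ 2) * (A * Real.sqrt y) := by gcongr
      _ = D * A * ((Real.sqrt y * Real.sqrt y) / Real.log z ^ 2) := by ring
      _ = _ := by rw [Real.mul_self_sqrt hy.le]
  calc _ ≤ D * ((5 + 4 * C) * (k + 4)) * (y / Real.log z ^ 2) + D * A * (y / Real.log z ^ 2) :=
        add_le_add r4 r5
    _ = _ := by ring
end InductPart

section InductMain
variable (K : Type*) [Field K] [NumberField K]

set_option maxHeartbeats 1000000 in
theorem rough_induct (lt : PrimeIdeal K → PrimeIdeal K → Prop)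
    (hord : IsStrictTotalOrder (PrimeIdeal K) lt)
    (hcompat : ∀ p q : PrimeIdeal K, Ideal.absNorm p.1 < Ideal.absNorm q.1 → lt p q)
    (B : ℝ → ℝ) (hB : IsBuchstab B) (k : ℕ) :
    ∃ D : ℝ, 0 ≤ D ∧ ∀ (q : PrimeIdeal K) (x : ℝ), (Ideal.absNorm q.1 : ℝ) ≤ x →
      x < (Ideal.absNorm q.1 : ℝ) ^ (k + 1) →
      |rF K lt x q - B (Real.log x / Real.log (Ideal.absNorm q.1)) *
        (x / Real.log (Ideal.absNorm q.1))| ≤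
      D * (x / Real.log (Ideal.absNorm q.1) ^ 2
        + Ideal.absNorm q.1 / Real.log (Ideal.absNorm q.1)) := by
  induction k with
  | zero =>
    refine ⟨0, le_rfl, fun q x h1 h2 => ?_⟩
    simp only [zero_add, pow_one] at h2
    linarith
  | succ k ih =>
    obtain ⟨D, hD, hIH⟩ := ih
    obtain ⟨C, hC, hθ⟩ := theta_K K
    obtain ⟨A, hA, hch⟩ := theta_cheb K
    set E1 := 2 * (5 + 4 * ((k:ℝ) + 2)) * (1 + C) * ((k:ℝ) + 2 + 2) with hE1
    set E2 := D * ((5 + 4 * C) * (k + 4) + A) with hE2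
    set E3 := 2 * ((2 + 3 * C) * (1 + 3 * D)) with hE3
    have hE1' : 0 ≤ E1 := by positivity
    have hE2' : 0 ≤ E2 := by positivity
    have hE3' : 0 ≤ E3 := by positivity
    refine ⟨1 + (C + 4 * A) + E1 + E2 + E3, by positivity, fun p y hzy hyz => ?_⟩
    have hz := p.two_le
    have hz2 := p.two_le_real
    have hlz := half_lt_log hz2
    have hy2 : 2 ≤ y := hz2.trans hzy
    have hy0 : 0 < y := by linarith
    have hyk : Real.log y ≤ ((k:ℝ) + 2) * Real.log (Ideal.absNorm p.1) := by
      have := Real.log_le_log hy0 hyz.le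
      rw [Real.log_pow] at this
      push_cast at this
      linarith
    rw [buch_split K lt hord hcompat p (by linarith)]
    set M := max (Ideal.absNorm p.1) ⌊Real.sqrt y⌋₊ with hM
    have hsy : Real.sqrt y ≤ y := by
      rw [Real.sqrt_le_left hy0.le]; nlinarith
    have hfl : ((⌊Real.sqrt y⌋₊ : ℕ) : ℝ) ≤ Real.sqrt y := Nat.floor_le (Real.sqrt_nonneg y)
    have hM1 : (M:ℝ) ≤ y := by
      rw [hM, Nat.cast_max]
      exact max_le hzy (hfl.trans hsy)
    have hM2 : (M:ℝ) ≤ Ideal.absNorm p.1 + Real.sqrt y := by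
      rw [hM, Nat.cast_max]
      have := Real.sqrt_nonneg y
      exact max_le (by linarith) (by linarith)
    have hcount := count_lemma K hC.le hA hθ hch hz (le_max_left _ _ : Ideal.absNorm p.1 ≤ M) hzy hM1 hM2
    have hW : 1 ≤ (Ideal.absNorm p.1 : ℝ) / Real.log (Ideal.absNorm p.1) := by
      rw [one_le_div (by linarith)]; exact Real.log_le_self (by linarith)
    set z : ℝ := (Ideal.absNorm p.1 : ℝ) with hzdef
    set l := Real.log z with hl
    have hl0 : 0 < l := by linarith
    have hX : 0 ≤ y / l ^ 2 := by positivity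
    set X := y / l ^ 2 with hXdef
    set W := z / l with hWdef
    set S := ∑ n ∈ Finset.Ioc M ⌊y⌋₊, cK K n with hS
    rcases lt_or_ge y (z * z) with hcase | hcase
    · have hsz : Real.sqrt y < z := by
        rw [Real.sqrt_lt' (by linarith), sq]; exact hcase
      have hempty : (pset K (Real.sqrt y)).filter (fun q => Ideal.absNorm p.1 < Ideal.absNorm q.1) = ∅ := by
        apply Finset.filter_false_of_mem
        intro q hq h2
        rw [mem_pset K (Real.sqrt_nonneg y)] at hq
        have h3 : z ≤ Ideal.absNorm q.1 := by rw [hzdef]; exact_mod_cast h2.le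
        linarith
      have hseq := seq_bound K hC.le hθ lt p hzy zero_le_one
        (fun q => rF K lt (y / Ideal.absNorm q.1) q) ?_
      · rw [hempty, Finset.sum_empty]
        have hu1 : 1 ≤ Real.log y / l := by
          rw [one_le_div hl0]; exact Real.log_le_log (by linarith) hzy
        have hu2 : Real.log y / l ≤ 2 := by
          rw [div_le_iff₀ hl0]
          have := Real.log_le_log hy0 hcase.le
          rw [Real.log_mul (by linarith) (by linarith)] at this
          linarith
        have hmain : B (Real.log y / l) * (y / l) = y / Real.log y := by
          rw [hB.2.1 _ hu1 hu2]
          have : Real.log y ≠ 0 := (Real.log_pos (by linarith)).ne'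
          field_simp
        rw [hmain]
        have hs2 : (2 + 3 * C) * (z / l ^ 2) * 1 ≤ E3 * W := by
          have e : (2 + 3 * C) * (z / l ^ 2) * 1 = (2 + 3 * C) * (W * (1 / l)) := by
            rw [hWdef]; field_simp
          have i : 1 / l ≤ 2 := by rw [div_le_iff₀ hl0]; linarith
          have hWp : 0 ≤ W := by linarith
          calc _ = (2 + 3 * C) * (W * (1 / l)) := e
            _ ≤ (2 + 3 * C) * (W * 2) := by gcongr
            _ ≤ _ := by
              rw [hE3]
              have : 0 ≤ (2 + 3 * C) * D * W := by positivity
              nlinarith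
        have hp : 0 ≤ (E1 + E2) * (X + W) + E3 * X + X := by
          have hWp : 0 ≤ W := by linarith
          positivity
        have hseq' := hseq.trans hs2
        have hfin : (1 + (C + 4 * A) + E1 + E2 + E3) * (X + W) = (C + 4 * A) * (X + W)
          + E3 * W + W + ((E1 + E2) * (X + W) + E3 * X + X) := by ring
        rw [hfin]
        rw [abs_le] at hseq' hcount ⊢
        constructor <;> linarith [hseq'.1, hseq'.2, hcount.1, hcount.2]
      · intro q hq
        have hq' : (Ideal.absNorm q.1 : ℝ) = z := by rw [hq]
        simp only [hq']
        rw [rF_one K lt hord hcompat, abs_one]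
        · rw [one_le_div (by linarith)]; exact hzy
        · rw [hq', div_lt_iff₀ (by linarith)]; exact hcase
    · have hzs : z ≤ Real.sqrt y := Real.le_sqrt_of_sq_le (by rw [sq]; exact hcase)
      have hsum := main_sum hB K hC.le hθ hz (k := (k:ℝ) + 2) (by positivity) hcase hyk
      have hmid := smid_bound K hD hIH hC.le hA hθ hch hz hcase hyz hyk
      have hH0 : 0 ≤ (1 + 3 * D) * (y / z / l) := by positivity
      have hseq := seq_bound K hC.le hθ lt p hzy hH0
        (fun q => rF K lt (y / Ideal.absNorm q.1) q) ?_
      · have hs2 : (2 + 3 * C) * (z / l ^ 2) * ((1 + 3 * D) * (y / z / l)) ≤ E3 * X := by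
          have e : (2 + 3 * C) * (z / l ^ 2) * ((1 + 3 * D) * (y / z / l)) =
            (2 + 3 * C) * (1 + 3 * D) * X * (1 / l) := by
            rw [hXdef]
            have : z ≠ 0 := by linarith
            field_simp
          have i : 1 / l ≤ 2 := by rw [div_le_iff₀ hl0]; linarith
          rw [e, hE3]
          calc _ ≤ (2 + 3 * C) * (1 + 3 * D) * X * 2 := by gcongr
            _ = _ := by ring
        have hWp : 0 ≤ W := by linarith
        have hp : 0 ≤ (E1 + E2 + E3) * W + X := by positivity
        have hseq' := hseq.trans hs2
        rw [← hzdef, ← hl, ← hXdef] at hsum hmid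
        have hfin : (1 + (C + 4 * A) + E1 + E2 + E3) * (X + W) = (C + 4 * A) * (X + W) + E1 * X + E2 * X
          + E3 * X + W + ((E1 + E2 + E3) * W + X) := by ring
        rw [hfin]
        rw [abs_le] at hseq' hcount hsum hmid ⊢
        constructor <;> linarith [hseq'.1, hseq'.2, hcount.1, hcount.2, hsum.1, hsum.2, hmid.1, hmid.2]
      · intro q hq
        have hq' : (Ideal.absNorm q.1 : ℝ) = z := by rw [hq]
        have h := ih_apply hD hIH q hz2 hy0 hyz hq'.ge (by rw [hq']; exact hzs)
        rw [hq', ← hl] at h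
        simp only [hq']
        have hr := (bf_range hz2 hy0 le_rfl hzs).2.2
        rw [← hl] at hr
        have hb := hB.bd hr
        have hb0 := hB.nonneg hr
        have hbm : |B (Real.log y / l - 1) * (y / z / l)| ≤ y / z / l := by
          rw [abs_of_nonneg (by positivity)]
          exact mul_le_of_le_one_left (by positivity) hb.2
        have i : 1 / l ≤ 2 := by rw [div_le_iff₀ hl0]; linarith
        have h5 : y / z / l ^ 2 ≤ 2 * (y / z / l) := by
          have e : y / z / l ^ 2 = (y / z / l) * (1 / l) := by field_simp
          rw [e, mul_comm 2]
          gcongr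
        have h6 : z / l ≤ y / z / l := by
          gcongr
          rw [le_div_iff₀ (by linarith)]; exact hcase
        have h7 : D * (y / z / l ^ 2 + z / l) ≤ D * (3 * (y / z / l)) := by
          gcongr
          linarith
        rw [abs_le] at h hbm ⊢
        constructor <;> linarith [h.1, h.2, hbm.1, hbm.2]
end InductMain

/-- **Asymptotics for ideals free of small prime ideal factors (sharp weights).**
With `W` the characteristic function of ideals of norm `≤ N`, and `y = N/𝒩(𝔯)`,
`u = log y / log 𝒩(𝔭)` with `α ≤ u ≤ β`, one has
`Φ_𝔯(W, 𝔭) = ℬ(u)·y/log 𝒩(𝔭)·(1 + O_{α,β}(1/log y))`. -/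
theorem rough_ideals
    (lt : PrimeIdeal K → PrimeIdeal K → Prop)
    (hord : IsStrictTotalOrder (PrimeIdeal K) lt)
    (hcompat : ∀ p q : PrimeIdeal K, Ideal.absNorm p.1 < Ideal.absNorm q.1 → lt p q)
    (B : ℝ → ℝ) (hB : IsBuchstab B)
    (α β : ℝ) (hα1 : 1 < α) (hα2 : α < 2) (hβ : 2 < β) :
    ∃ C : ℝ, ∀ N : ℝ, 2 ≤ N →
      ∀ (p : PrimeIdeal K) (r : Ideal (𝓞 K)), r ≠ ⊥ → (Ideal.absNorm r : ℝ) ≤ N / 2 →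
      ∀ y u : ℝ, y = N / (Ideal.absNorm r : ℝ) →
        u = Real.log y / Real.log (Ideal.absNorm p.1 : ℝ) →
        α ≤ u → u ≤ β →
      |Phi K lt (fun a => if (Ideal.absNorm a : ℝ) ≤ N then 1 else 0) r p -
          B u * y / Real.log (Ideal.absNorm p.1 : ℝ)|
        ≤ C * (B u * y / (Real.log (Ideal.absNorm p.1 : ℝ) * Real.log y)) := by
  obtain ⟨k, hk⟩ := exists_nat_gt β
  obtain ⟨D, hD, hmain⟩ := rough_induct K lt hord hcompat B hB k
  refine ⟨D * (1 + 1 / (α - 1)) * β ^ 2, ?_⟩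
  intro N hN p r hr hrN y u hy hu hau hub
  have hr1 : (1:ℝ) ≤ Ideal.absNorm r := by exact_mod_cast absNorm_ge_one hr
  rw [phi_eq_rF K lt (by linarith) r hr p, ← hy]
  have hy2 : 2 ≤ y := by
    rw [hy, le_div_iff₀ (by linarith)]; linarith
  have hz2 := p.two_le_real
  have hl := half_lt_log hz2
  set z : ℝ := (Ideal.absNorm p.1 : ℝ) with hz
  set l := Real.log z with hldef
  have hl0 : 0 < l := by linarith
  have hlogy : Real.log y = u * l := by rw [hu]; field_simp
  have hu0 : 0 < u := by linarith
  have hz0 : 0 < z := by linarith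
  have hy0 : 0 < y := by linarith
  have hzy : z ≤ y := by
    rw [← Real.log_le_log_iff hz0 hy0, hlogy]
    nlinarith
  have hyk : y < z ^ (k + 1) := by
    rw [← Real.log_lt_log_iff hy0 (by positivity), Real.log_pow, hlogy]
    push_cast
    rw [← hldef]
    have : u < k + 1 := by linarith
    gcongr
  have h := hmain p y hzy hyk
  rw [← hz, ← hldef, ← hu] at h
  have hlog : (α - 1) * l ≤ y / z := by
    refine le_trans ?_ (Real.log_le_self (by positivity))
    rw [Real.log_div hy0.ne' hz0.ne', hlogy, ← hldef]
    nlinarith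
  have ha : 0 < α - 1 := by linarith
  have hW : z / l ≤ 1 / (α - 1) * (y / l ^ 2) := by
    rw [le_div_iff₀ hz0] at hlog
    have e : 1 / (α - 1) * (y / l ^ 2) = y / ((α - 1) * l) / l := by field_simp
    rw [e]
    gcongr
    rw [le_div_iff₀ (by positivity)]
    linarith
  have hbu := (hB.bd (v := u) (by linarith)).1
  have hX : y / l ^ 2 ≤ β ^ 2 * (B u * y / (l * Real.log y)) := by
    have e1 : y / l ^ 2 = u ^ 2 * ((1 / u) * y / (l * Real.log y)) := by
      rw [hlogy]; field_simp
    have hp : 0 ≤ B u * y / (l * Real.log y) := by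
      have := hB.nonneg (v := u) (by linarith)
      rw [hlogy]; positivity
    rw [e1]
    calc _ ≤ u ^ 2 * (B u * y / (l * Real.log y)) := by
          rw [hlogy]
          gcongr
      _ ≤ _ := by gcongr
  have e0 : B u * y / l = B u * (y / l) := by ring
  rw [e0]
  refine h.trans ?_
  calc D * (y / l ^ 2 + z / l) ≤ D * (y / l ^ 2 + 1 / (α - 1) * (y / l ^ 2)) := by gcongr
    _ = D * (1 + 1 / (α - 1)) * (y / l ^ 2) := by ring
    _ ≤ D * (1 + 1 / (α - 1)) * (β ^ 2 * (B u * y / (l * Real.log y))) := by gcongr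
    _ = _ := by ring
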